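/- arXiv:2508.12757 — 4 statements merged into one kernel-verified Lean document; each statement's English description precedes it below -/
import Mathlib

section
/- Classification of rank-six three-forms in six variables: let ω be a three-form on V = Fin 6 → ℂ of maximal rank, i.e. the only v ∈ V with ω(v,u,w) = 0 for all u,w is v = 0. Then ω is GL₆-equivalent to exactly one of ω₁ = e^{123} + e^{456} and ω₂ = e^{124} + e^{135} + e^{236}: there is a linear automorphism g of V with ω(gu,gv,gw) = ω₁(u,v,w) for all u,v,w, or one with ω(gu,gv,gw) = ω₂(u,v,w) for all u,v,w; moreover ω₁ is not GL₆-equivalent to ω₂. -/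
noncomputable section

/-- `eDet i j k u v w` is the three-form `e^{ijk}` evaluated at `(u, v, w)`:
the determinant of the 3×3 matrix with rows `(uᵢ, vᵢ, wᵢ)`, `(uⱼ, vⱼ, wⱼ)`, `(uₖ, vₖ, wₖ)`. -/
def eDet {n : ℕ} (i j k : Fin n) (u v w : Fin n → ℂ) : ℂ :=
  Matrix.det !![u i, v i, w i; u j, v j, w j; u k, v k, w k]

/-- `ω₁ = e^{123} + e^{456}` (indices `1,…,6` rendered as `0,…,5` in `Fin 6`). -/
def omega1 (u v w : Fin 6 → ℂ) : ℂ :=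
  eDet 0 1 2 u v w + eDet 3 4 5 u v w

/-- `ω₂ = e^{124} + e^{135} + e^{236}` (indices `1,…,6` rendered as `0,…,5` in `Fin 6`). -/
def omega2 (u v w : Fin 6 → ℂ) : ℂ :=
  eDet 0 1 3 u v w + eDet 0 2 4 u v w + eDet 1 2 5 u v w

set_option linter.unusedSimpArgs false
set_option linter.unusedVariables false

namespace TF

abbrev V6 := Fin 6 → ℂ
abbrev F3 := AlternatingMap ℂ V6 ℂ (Fin 3)

def T (ω : F3) (x y z : V6) : ℂ := ω ![x, y, z]

theorem T_add1 (ω : F3) (x x' y z : V6) : T ω (x + x') y z = T ω x y z + T ω x' y z := by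
  have h : ∀ t, Function.update ![x, y, z] 0 t = ![t, y, z] := by
    intro t; ext i : 1; fin_cases i <;> simp
  have := ω.map_update_add ![x, y, z] 0 x x'
  rwa [h, h, h] at this

theorem T_smul1 (ω : F3) (c : ℂ) (x y z : V6) : T ω (c • x) y z = c * T ω x y z := by
  have h : ∀ t, Function.update ![x, y, z] 0 t = ![t, y, z] := by
    intro t; ext i : 1; fin_cases i <;> simp
  have := ω.map_update_smul ![x, y, z] 0 c x
  rwa [h, h] at this

theorem T_s12 (ω : F3) (x y z : V6) : T ω y x z = - T ω x y z := by
  have := ω.map_swap ![x, y, z] (i := 0) (j := 1) (by decide)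
  rw [T, T, ← this]; congr 1; ext i; fin_cases i <;> rfl

theorem T_s23 (ω : F3) (x y z : V6) : T ω x z y = - T ω x y z := by
  have := ω.map_swap ![x, y, z] (i := 1) (j := 2) (by decide)
  rw [T, T, ← this]; congr 1; ext i; fin_cases i <;> rfl

theorem T_e12 (ω : F3) (x y : V6) : T ω x x y = 0 :=
  ω.map_eq_zero_of_eq ![x, x, y] (i := 0) (j := 1) rfl (by decide)

theorem T_e23 (ω : F3) (x y : V6) : T ω y x x = 0 :=
  ω.map_eq_zero_of_eq ![y, x, x] (i := 1) (j := 2) rfl (by decide)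

theorem T_e13 (ω : F3) (x y : V6) : T ω x y x = 0 :=
  ω.map_eq_zero_of_eq ![x, y, x] (i := 0) (j := 2) rfl (by decide)

theorem T_add2 (ω : F3) (x y y' z : V6) : T ω x (y + y') z = T ω x y z + T ω x y' z := by
  rw [T_s12, T_add1, T_s12 ω x y, T_s12 ω x y']; ring

theorem T_smul2 (ω : F3) (c : ℂ) (x y z : V6) : T ω x (c • y) z = c * T ω x y z := by
  rw [T_s12, T_smul1, T_s12 ω x y]; ring

theorem T_add3 (ω : F3) (x y z z' : V6) : T ω x y (z + z') = T ω x y z + T ω x y z' := by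
  rw [T_s23, T_add2, T_s23 ω x y, T_s23 ω x y z']; ring

theorem T_smul3 (ω : F3) (c : ℂ) (x y z : V6) : T ω x y (c • z) = c * T ω x y z := by
  rw [T_s23, T_smul2, T_s23 ω x y]; ring

theorem alt_ext (A B : F3)
    (h : ∀ i j k : Fin 6, i < j → j < k →
      T A (Pi.single i 1) (Pi.single j 1) (Pi.single k 1)
        = T B (Pi.single i 1) (Pi.single j 1) (Pi.single k 1)) : A = B := by
  have h3 : ∀ i j : Fin 6, i < j → ∀ k,
      T A (Pi.single i 1) (Pi.single j 1) (Pi.single k 1)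
        = T B (Pi.single i 1) (Pi.single j 1) (Pi.single k 1) := by
    intro i j hij k
    rcases lt_trichotomy j k with h1 | h1 | h1
    · exact h i j k hij h1
    · subst h1; rw [T_e23, T_e23]
    · rw [T_s23, T_s23 B]
      rcases lt_trichotomy i k with h2 | h2 | h2
      · rw [h i k j h2 h1]
      · subst h2; rw [T_e12, T_e12]
      · rw [T_s12, T_s12 B, h k i j h2 hij]
  have h4 : ∀ i j k,
      T A (Pi.single i 1) (Pi.single j 1) (Pi.single k 1)
        = T B (Pi.single i 1) (Pi.single j 1) (Pi.single k 1) := by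
    intro i j k
    rcases lt_trichotomy i j with h1 | h1 | h1
    · exact h3 i j h1 k
    · subst h1; rw [T_e12, T_e12]
    · rw [T_s12, T_s12 B, h3 j i h1]
  refine Module.Basis.ext_alternating (Pi.basisFun ℂ (Fin 6)) ?_
  intro v _
  have := h4 (v 0) (v 1) (v 2)
  simp only [T] at this
  convert this using 2 <;> (ext i : 1; fin_cases i <;> simp)

def eAlt (i j k : Fin 6) : F3 :=
  (Matrix.detRowAlternating (R := ℂ) (n := Fin 3)).compLinearMap
    (LinearMap.funLeft ℂ ℂ ![i, j, k])

theorem eAlt_apply (i j k : Fin 6) (u v w : V6) : T (eAlt i j k) u v w = eDet i j k u v w := by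
  simp only [T, eAlt, eDet, AlternatingMap.compLinearMap_apply]
  rw [← Matrix.det_transpose]
  change Matrix.det _ = _
  congr 1
  ext a b
  fin_cases a <;> fin_cases b <;> rfl

theorem T_add (A B : F3) (u v w : V6) : T (A + B) u v w = T A u v w + T B u v w := rfl

def lc (b : Fin 6 → V6) : V6 →ₗ[ℂ] V6 := Fintype.linearCombination ℂ b

theorem lc_single (b : Fin 6 → V6) (i : Fin 6) : lc b (Pi.single i 1) = b i := by
  simp [lc, Fintype.linearCombination_apply_single]

theorem T_comp (A : F3) (f : V6 →ₗ[ℂ] V6) (u v w : V6) :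
    T (A.compLinearMap f) u v w = T A (f u) (f v) (f w) := by
  simp only [T, AlternatingMap.compLinearMap_apply]
  congr 1; ext i : 1; fin_cases i <;> rfl

/-- If the values on a tuple of vectors agree with a nondegenerate form, we get an equivalence. -/
theorem equiv_of (ω B : F3) (hB : ∀ v, (∀ u w, T B v u w = 0) → v = 0) (b : Fin 6 → V6)
    (h : ∀ i j k : Fin 6, i < j → j < k →
      T ω (b i) (b j) (b k) = T B (Pi.single i 1) (Pi.single j 1) (Pi.single k 1)) :
    ∃ g : V6 ≃ₗ[ℂ] V6, ∀ u v w, T ω (g u) (g v) (g w) = T B u v w := by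
  have hE : ω.compLinearMap (lc b) = B := by
    apply alt_ext
    intro i j k hi hj
    rw [T_comp, lc_single, lc_single, lc_single, h i j k hi hj]
  have hv : ∀ u v w, T ω (lc b u) (lc b v) (lc b w) = T B u v w := by
    intro u v w; rw [← hE, T_comp]
  have hinj : Function.Injective (lc b) := by
    rw [← LinearMap.ker_eq_bot, LinearMap.ker_eq_bot']
    intro m hm
    apply hB
    intro u w
    rw [← hv, hm]
    have := T_smul1 ω 0 0 (lc b u) (lc b w)
    simpa using this
  refine ⟨LinearEquiv.ofInjectiveEndo _ hinj, ?_⟩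
  intro u v w
  simpa using hv u v w

def om1 : F3 := eAlt 0 1 2 + eAlt 3 4 5
def om2 : F3 := eAlt 0 1 3 + eAlt 0 2 4 + eAlt 1 2 5

theorem om1_apply (u v w : V6) : T om1 u v w = omega1 u v w := by
  simp [om1, omega1, T_add, eAlt_apply]
theorem om2_apply (u v w : V6) : T om2 u v w = omega2 u v w := by
  simp [om2, omega2, T_add, eAlt_apply]

theorem om1_nd (v : V6) (h : ∀ u w, T om1 v u w = 0) : v = 0 := by
  simp only [om1_apply, omega1, eDet, Matrix.det_fin_three] at h
  ext i
  have h0 := h (Pi.single 1 1) (Pi.single 2 1)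
  have h1 := h (Pi.single 0 1) (Pi.single 2 1)
  have h2 := h (Pi.single 0 1) (Pi.single 1 1)
  have h3 := h (Pi.single 4 1) (Pi.single 5 1)
  have h4 := h (Pi.single 3 1) (Pi.single 5 1)
  have h5 := h (Pi.single 3 1) (Pi.single 4 1)
  simp [Pi.single_apply] at h0 h1 h2 h3 h4 h5
  fin_cases i <;> simp [*]

theorem om2_nd (v : V6) (h : ∀ u w, T om2 v u w = 0) : v = 0 := by
  simp only [om2_apply, omega2, eDet, Matrix.det_fin_three] at h
  ext i
  have h0 := h (Pi.single 1 1) (Pi.single 3 1)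
  have h1 := h (Pi.single 0 1) (Pi.single 3 1)
  have h2 := h (Pi.single 0 1) (Pi.single 4 1)
  have h3 := h (Pi.single 0 1) (Pi.single 1 1)
  have h4 := h (Pi.single 0 1) (Pi.single 2 1)
  have h5 := h (Pi.single 1 1) (Pi.single 2 1)
  simp [Pi.single_apply] at h0 h1 h2 h3 h4 h5
  fin_cases i <;> simp [*]

theorem forall_lt3 {P : Fin 6 → Fin 6 → Fin 6 → Prop}
    (h : P 0 1 2 ∧ P 0 1 3 ∧ P 0 1 4 ∧ P 0 1 5 ∧ P 0 2 3 ∧ P 0 2 4 ∧ P 0 2 5 ∧ P 0 3 4 ∧ P 0 3 5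
      ∧ P 0 4 5 ∧ P 1 2 3 ∧ P 1 2 4 ∧ P 1 2 5 ∧ P 1 3 4 ∧ P 1 3 5 ∧ P 1 4 5 ∧ P 2 3 4 ∧ P 2 3 5
      ∧ P 2 4 5 ∧ P 3 4 5) : ∀ i j k : Fin 6, i < j → j < k → P i j k := by
  intro i j k hi hj
  fin_cases i <;> fin_cases j <;> first | (exfalso; revert hi; decide) | skip
  all_goals fin_cases k <;> first | (exfalso; revert hj; decide) | skip
  all_goals simp_all

theorem case1 (ω : F3) (p q r a b c : V6) (h012 : T ω p q r = 1) (h345 : T ω a b c = 1)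
    (h013 : T ω p q a = 0) (h014 : T ω p q b = 0) (h015 : T ω p q c = 0)
    (h023 : T ω p r a = 0) (h024 : T ω p r b = 0) (h025 : T ω p r c = 0)
    (h034 : T ω p a b = 0) (h035 : T ω p a c = 0) (h045 : T ω p b c = 0)
    (h123 : T ω q r a = 0) (h124 : T ω q r b = 0) (h125 : T ω q r c = 0)
    (h134 : T ω q a b = 0) (h135 : T ω q a c = 0) (h145 : T ω q b c = 0)
    (h234 : T ω r a b = 0) (h235 : T ω r a c = 0) (h245 : T ω r b c = 0) :
    ∃ g : V6 ≃ₗ[ℂ] V6, ∀ u v w, ω ![g u, g v, g w] = omega1 u v w := by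
  simp only [← om1_apply]
  apply equiv_of ω om1 om1_nd ![p, q, r, a, b, c]
  apply forall_lt3
  simp only [om1_apply, omega1, eDet, Matrix.det_fin_three]
  simp [Pi.single_apply, *]

theorem case2 (ω : F3) (p q r a b c : V6) (h012 : T ω p q r = 0) (h345 : T ω a b c = 0)
    (h013 : T ω p q a = 1) (h014 : T ω p q b = 0) (h015 : T ω p q c = 0)
    (h023 : T ω p r a = 0) (h024 : T ω p r b = 1) (h025 : T ω p r c = 0)
    (h034 : T ω p a b = 0) (h035 : T ω p a c = 0) (h045 : T ω p b c = 0)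
    (h123 : T ω q r a = 0) (h124 : T ω q r b = 0) (h125 : T ω q r c = 1)
    (h134 : T ω q a b = 0) (h135 : T ω q a c = 0) (h145 : T ω q b c = 0)
    (h234 : T ω r a b = 0) (h235 : T ω r a c = 0) (h245 : T ω r b c = 0) :
    ∃ g : V6 ≃ₗ[ℂ] V6, ∀ u v w, ω ![g u, g v, g w] = omega2 u v w := by
  simp only [← om2_apply]
  apply equiv_of ω om2 om2_nd ![p, q, r, a, b, c]
  apply forall_lt3
  simp only [om2_apply, omega2, eDet, Matrix.det_fin_three]
  simp [Pi.single_apply, *]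

def GG (A : Fin 6 → Fin 6 → ℂ) (B : Fin 6 → Fin 6 → Fin 6 → ℂ) (a b c d e : Fin 6) : ℂ :=
  A a b * B c d e - A a c * B b d e + A a d * B b c e - A a e * B b c d + A b c * B a d e
   - A b d * B a c e + A b e * B a c d + A c d * B a b e - A c e * B a b d + A d e * B a b c

def Pf (A : Fin 6 → Fin 6 → ℂ) (i j k l : Fin 6) : ℂ := A i j * A k l - A i k * A j l + A i l * A j k

theorem pf_sum (A : Fin 6 → Fin 6 → ℂ) (B : Fin 6 → Fin 6 → Fin 6 → ℂ) (v : V6)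
    (hA1 : ∀ i j, A j i = - A i j) (hv : ∀ i, ∑ m, v m * A m i = 0)
    (hAB : ∀ i j, A i j = ∑ m, v m * B m i j) (i j k l : Fin 6) :
    2 * Pf A i j k l = ∑ m, v m * GG A B m i j k l := by
  have e : ∑ m, v m * GG A B m i j k l =
      (∑ m, v m * A m i) * B j k l - (∑ m, v m * A m j) * B i k l + (∑ m, v m * A m k) * B i j l
      - (∑ m, v m * A m l) * B i j k + A i j * (∑ m, v m * B m k l) - A i k * (∑ m, v m * B m j l)
      + A i l * (∑ m, v m * B m j k) + A j k * (∑ m, v m * B m i l) - A j l * (∑ m, v m * B m i k)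
      + A k l * (∑ m, v m * B m i j) := by
    simp only [Fin.sum_univ_six, GG]; ring
  rw [e, hv, hv, hv, hv]
  simp only [← hAB, Pf]
  ring

theorem pf_zero_lt (A : Fin 6 → Fin 6 → ℂ) (B : Fin 6 → Fin 6 → Fin 6 → ℂ) (v : V6) (μ : ℂ)
    (hA0 : ∀ i, A i i = 0) (hA : ∀ i j, i < j → A j i = - A i j)
    (hB12 : ∀ i j, B i i j = 0) (hB23 : ∀ i j, B i j j = 0) (hB13 : ∀ i j, B i j i = 0)
    (hs12 : ∀ i j k, i < j → B j i k = - B i j k) (hs23 : ∀ i j k, j < k → B i k j = - B i j k)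
    (hP : ∀ i j k l, 2 * Pf A i j k l = ∑ m, v m * GG A B m i j k l)
    (h0 : GG A B 1 2 3 4 5 = μ * v 0) (h1 : - GG A B 0 2 3 4 5 = μ * v 1)
    (h2 : GG A B 0 1 3 4 5 = μ * v 2) (h3 : - GG A B 0 1 2 4 5 = μ * v 3)
    (h4 : GG A B 0 1 2 3 5 = μ * v 4) (h5 : - GG A B 0 1 2 3 4 = μ * v 5) :
    Pf A 0 1 2 3 = 0
    ∧ Pf A 0 1 2 4 = 0
    ∧ Pf A 0 1 2 5 = 0
    ∧ Pf A 0 1 3 4 = 0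
    ∧ Pf A 0 1 3 5 = 0
    ∧ Pf A 0 1 4 5 = 0
    ∧ Pf A 0 2 3 4 = 0
    ∧ Pf A 0 2 3 5 = 0
    ∧ Pf A 0 2 4 5 = 0
    ∧ Pf A 0 3 4 5 = 0
    ∧ Pf A 1 2 3 4 = 0
    ∧ Pf A 1 2 3 5 = 0
    ∧ Pf A 1 2 4 5 = 0
    ∧ Pf A 1 3 4 5 = 0
    ∧ Pf A 2 3 4 5 = 0 := by
  simp only [GG] at h0 h1 h2 h3 h4 h5
  refine ⟨?_, ?_, ?_, ?_, ?_, ?_, ?_, ?_, ?_, ?_, ?_, ?_, ?_, ?_, ?_⟩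
  · have h := hP 0 1 2 3
    simp [Fin.sum_univ_six, GG, hA0, hA, hB12, hB23, hB13, hs12, hs23] at h
    linear_combination (1/2) * h + (-1) * (1/2) * (v 4 * h5 - v 5 * h4)
  · have h := hP 0 1 2 4
    simp [Fin.sum_univ_six, GG, hA0, hA, hB12, hB23, hB13, hs12, hs23] at h
    linear_combination (1/2) * h + (1/2) * (v 3 * h5 - v 5 * h3)
  · have h := hP 0 1 2 5
    simp [Fin.sum_univ_six, GG, hA0, hA, hB12, hB23, hB13, hs12, hs23] at h
    linear_combination (1/2) * h + (-1) * (1/2) * (v 3 * h4 - v 4 * h3)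
  · have h := hP 0 1 3 4
    simp [Fin.sum_univ_six, GG, hA0, hA, hB12, hB23, hB13, hs12, hs23] at h
    linear_combination (1/2) * h + (-1) * (1/2) * (v 2 * h5 - v 5 * h2)
  · have h := hP 0 1 3 5
    simp [Fin.sum_univ_six, GG, hA0, hA, hB12, hB23, hB13, hs12, hs23] at h
    linear_combination (1/2) * h + (1/2) * (v 2 * h4 - v 4 * h2)
  · have h := hP 0 1 4 5
    simp [Fin.sum_univ_six, GG, hA0, hA, hB12, hB23, hB13, hs12, hs23] at h
    linear_combination (1/2) * h + (-1) * (1/2) * (v 2 * h3 - v 3 * h2)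
  · have h := hP 0 2 3 4
    simp [Fin.sum_univ_six, GG, hA0, hA, hB12, hB23, hB13, hs12, hs23] at h
    linear_combination (1/2) * h + (1/2) * (v 1 * h5 - v 5 * h1)
  · have h := hP 0 2 3 5
    simp [Fin.sum_univ_six, GG, hA0, hA, hB12, hB23, hB13, hs12, hs23] at h
    linear_combination (1/2) * h + (-1) * (1/2) * (v 1 * h4 - v 4 * h1)
  · have h := hP 0 2 4 5
    simp [Fin.sum_univ_six, GG, hA0, hA, hB12, hB23, hB13, hs12, hs23] at h
    linear_combination (1/2) * h + (1/2) * (v 1 * h3 - v 3 * h1)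
  · have h := hP 0 3 4 5
    simp [Fin.sum_univ_six, GG, hA0, hA, hB12, hB23, hB13, hs12, hs23] at h
    linear_combination (1/2) * h + (-1) * (1/2) * (v 1 * h2 - v 2 * h1)
  · have h := hP 1 2 3 4
    simp [Fin.sum_univ_six, GG, hA0, hA, hB12, hB23, hB13, hs12, hs23] at h
    linear_combination (1/2) * h + (-1) * (1/2) * (v 0 * h5 - v 5 * h0)
  · have h := hP 1 2 3 5
    simp [Fin.sum_univ_six, GG, hA0, hA, hB12, hB23, hB13, hs12, hs23] at h
    linear_combination (1/2) * h + (1/2) * (v 0 * h4 - v 4 * h0)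
  · have h := hP 1 2 4 5
    simp [Fin.sum_univ_six, GG, hA0, hA, hB12, hB23, hB13, hs12, hs23] at h
    linear_combination (1/2) * h + (-1) * (1/2) * (v 0 * h3 - v 3 * h0)
  · have h := hP 1 3 4 5
    simp [Fin.sum_univ_six, GG, hA0, hA, hB12, hB23, hB13, hs12, hs23] at h
    linear_combination (1/2) * h + (1/2) * (v 0 * h2 - v 2 * h0)
  · have h := hP 2 3 4 5
    simp [Fin.sum_univ_six, GG, hA0, hA, hB12, hB23, hB13, hs12, hs23] at h
    linear_combination (1/2) * h + (-1) * (1/2) * (v 0 * h1 - v 1 * h0)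

theorem forall_lt4 {P : Fin 6 → Fin 6 → Fin 6 → Fin 6 → Prop}
    (h : P 0 1 2 3 ∧ P 0 1 2 4 ∧ P 0 1 2 5 ∧ P 0 1 3 4 ∧ P 0 1 3 5 ∧ P 0 1 4 5 ∧ P 0 2 3 4 ∧ P 0 2 3 5 ∧ P 0 2 4 5 ∧ P 0 3 4 5 ∧ P 1 2 3 4 ∧ P 1 2 3 5 ∧ P 1 2 4 5 ∧ P 1 3 4 5 ∧ P 2 3 4 5) :
    ∀ i j k l : Fin 6, i < j → j < k → k < l → P i j k l := by
  intro i j k l hi hj hk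
  fin_cases i <;> fin_cases j <;> first | (exfalso; revert hi; decide) | skip
  all_goals fin_cases k <;> first | (exfalso; revert hj; decide) | skip
  all_goals fin_cases l <;> first | (exfalso; revert hk; decide) | skip
  all_goals simp_all

theorem pf_zero (A : Fin 6 → Fin 6 → ℂ) (hA : ∀ i j, A j i = - A i j) (hA0 : ∀ i, A i i = 0)
    (h : ∀ i j k l : Fin 6, i < j → j < k → k < l → Pf A i j k l = 0) (i j k l : Fin 6) :
    Pf A i j k l = 0 := by
  have s12 : ∀ i j k l, Pf A j i k l = - Pf A i j k l := by
    intro i j k l; simp only [Pf]; rw [hA i j]; ring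
  have s23 : ∀ i j k l, Pf A i k j l = - Pf A i j k l := by
    intro i j k l; simp only [Pf]; rw [hA j k]; ring
  have s34 : ∀ i j k l, Pf A i j l k = - Pf A i j k l := by
    intro i j k l; simp only [Pf]; rw [hA k l]; ring
  have e12 : ∀ i k l, Pf A i i k l = 0 := by
    intro i k l; simp only [Pf]; rw [hA0]; ring
  have e23 : ∀ i j l, Pf A i j j l = 0 := by
    intro i j l; simp only [Pf]; rw [hA0]; ring
  have e34 : ∀ i j k, Pf A i j k k = 0 := by
    intro i j k; simp only [Pf]; rw [hA0]; ring
  have a4 : ∀ i j k l : Fin 6, i < j → j < k → Pf A i j k l = 0 := by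
    intro i j k l hi hj
    rcases lt_trichotomy k l with h1 | h1 | h1
    · exact h i j k l hi hj h1
    · subst h1; exact e34 _ _ _
    rw [s34, neg_eq_zero]
    rcases lt_trichotomy j l with h2 | h2 | h2
    · exact h i j l k hi h2 h1
    · subst h2; exact e23 _ _ _
    rw [s23, neg_eq_zero]
    rcases lt_trichotomy i l with h3 | h3 | h3
    · exact h i l j k h3 h2 hj
    · subst h3; exact e12 _ _ _
    rw [s12, neg_eq_zero]
    exact h l i j k h3 hi hj
  have a3 : ∀ i j k l : Fin 6, i < j → Pf A i j k l = 0 := by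
    intro i j k l hi
    rcases lt_trichotomy j k with h2 | h2 | h2
    · exact a4 i j k l hi h2
    · subst h2; exact e23 _ _ _
    rw [s23, neg_eq_zero]
    rcases lt_trichotomy i k with h3 | h3 | h3
    · exact a4 i k j l h3 h2
    · subst h3; exact e12 _ _ _
    rw [s12, neg_eq_zero]
    exact a4 k i j l h3 hi
  rcases lt_trichotomy i j with h3 | h3 | h3
  · exact a3 i j k l h3
  · subst h3; exact e12 _ _ _
  rw [s12, neg_eq_zero]
  exact a3 j i k l h3

def E (i : Fin 6) : V6 := Pi.single i 1

theorem T_zero1 (ω : F3) (y z : V6) : T ω 0 y z = 0 := by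
  have := T_smul1 ω 0 0 y z
  simpa using this

def TL (ω : F3) (y z : V6) : V6 →ₗ[ℂ] ℂ where
  toFun x := T ω x y z
  map_add' x x' := T_add1 ω x x' y z
  map_smul' c x := T_smul1 ω c x y z

theorem TL_apply (ω : F3) (x y z : V6) : TL ω y z x = T ω x y z := rfl

theorem sum_E (v : V6) : ∑ m, v m • E m = v := by
  ext i; simp [E, Finset.sum_apply, Pi.single_apply]

theorem T_expand (ω : F3) (x y z : V6) : T ω x y z = ∑ m, x m * T ω (E m) y z := by
  conv_lhs => rw [← TL_apply, ← sum_E x, map_sum]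
  simp [TL_apply]

def GLf (ω : F3) (a b c d e : Fin 6) : V6 →ₗ[ℂ] ℂ where
  toFun v := GG (fun i j => T ω v (E i) (E j)) (fun i j k => T ω (E i) (E j) (E k)) a b c d e
  map_add' x y := by simp only [GG, T_add1]; ring
  map_smul' t x := by simp only [GG, T_smul1, RingHom.id_apply, smul_eq_mul]; ring

theorem exists_pf (ω : F3) : ∃ v : V6, v ≠ 0 ∧ ∀ i j k l,
    Pf (fun i j => T ω v (E i) (E j)) i j k l = 0 := by
  let K : Module.End ℂ V6 := LinearMap.pi
    ![GLf ω 1 2 3 4 5, - GLf ω 0 2 3 4 5, GLf ω 0 1 3 4 5, - GLf ω 0 1 2 4 5, GLf ω 0 1 2 3 5,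
      - GLf ω 0 1 2 3 4]
  obtain ⟨μ, hμ⟩ := Module.End.exists_eigenvalue K
  obtain ⟨v, hv⟩ := hμ.exists_hasEigenvector
  have hKv : K v = μ • v := hv.apply_eq_smul
  refine ⟨v, hv.2, ?_⟩
  apply pf_zero
  · intro i j; exact T_s23 _ _ _ _
  · intro i; exact T_e23 _ _ _
  apply forall_lt4
  apply pf_zero_lt _ (fun i j k => T ω (E i) (E j) (E k)) v μ
  · intro i; exact T_e23 _ _ _
  · intro i j _; exact T_s23 _ _ _ _
  · intro i j; exact T_e12 _ _ _
  · intro i j; exact T_e23 _ _ _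
  · intro i j; exact T_e13 _ _ _
  · intro i j k _; exact T_s12 _ _ _ _
  · intro i j k _; exact T_s23 _ _ _ _
  · apply pf_sum
    · intro i j; exact T_s23 _ _ _ _
    · intro i
      have := T_expand ω v v (E i)
      rw [T_e12] at this
      rw [← neg_zero, this, ← Finset.sum_neg_distrib]
      refine Finset.sum_congr rfl fun m _ => ?_
      change v m * T ω v (E m) (E i) = _
      rw [T_s12]; ring
    · intro i j; exact T_expand _ _ _ _
  · exact congrFun hKv 0
  · exact congrFun hKv 1
  · exact congrFun hKv 2
  · exact congrFun hKv 3
  · exact congrFun hKv 4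
  · exact congrFun hKv 5

theorem exists_vpq (ω : F3) (hrk : ∀ v, (∀ u w, T ω v u w = 0) → v = 0) :
    ∃ v p q : V6, v ≠ 0 ∧ T ω v p q = 1 ∧ ∀ x y,
      T ω v x y = T ω v p x * T ω v q y - T ω v p y * T ω v q x := by
  obtain ⟨v, hv0, hv⟩ := exists_pf ω
  have ex2 : ∀ x y z, T ω x y z = ∑ m, y m * T ω x (E m) z := by
    intro x y z
    rw [T_s12, T_expand, ← Finset.sum_neg_distrib]
    refine Finset.sum_congr rfl fun m _ => ?_
    rw [T_s12]; ring
  have ex3 : ∀ x y z, T ω x y z = ∑ m, z m * T ω x y (E m) := by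
    intro x y z
    rw [T_s23, ex2, ← Finset.sum_neg_distrib]
    refine Finset.sum_congr rfl fun m _ => ?_
    rw [T_s23]; ring
  have hne : ∃ i j, T ω v (E i) (E j) ≠ 0 := by
    by_contra! hc
    apply hv0
    apply hrk
    intro u w
    rw [ex2]
    refine Finset.sum_eq_zero fun m _ => ?_
    rw [ex3]
    simp [hc]
  obtain ⟨i, j, hij⟩ := hne
  set c := T ω v (E i) (E j) with hc
  have key : ∀ x y, c * T ω v x y = T ω v (E i) x * T ω v (E j) y - T ω v (E i) y * T ω v (E j) x := by
    have k1 : ∀ k y, c * T ω v (E k) y =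
        T ω v (E i) (E k) * T ω v (E j) y - T ω v (E i) y * T ω v (E j) (E k) := by
      intro k y
      rw [ex3 v (E k) y, ex3 v (E j) y, ex3 v (E i) y, Finset.mul_sum, Finset.mul_sum,
        Finset.sum_mul, ← Finset.sum_sub_distrib]
      refine Finset.sum_congr rfl fun l _ => ?_
      have := hv i j k l
      simp only [Pf] at this
      linear_combination y l * this
    intro x y
    rw [ex2 v x y, ex3 v (E j) x, ex3 v (E i) x, Finset.mul_sum, Finset.mul_sum,
        Finset.sum_mul, ← Finset.sum_sub_distrib]
    refine Finset.sum_congr rfl fun l _ => ?_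
    linear_combination x l * k1 l y
  refine ⟨v, c⁻¹ • E i, E j, hv0, ?_, ?_⟩
  · rw [T_smul2, ← hc, inv_mul_cancel₀ hij]
  · intro x y
    rw [T_smul2, T_smul2]
    have := key x y
    field_simp
    linear_combination this

theorem not_equiv : ¬ (∃ g : (Fin 6 → ℂ) ≃ₗ[ℂ] (Fin 6 → ℂ), ∀ u v w : Fin 6 → ℂ,
        omega1 (g u) (g v) (g w) = omega2 u v w) := by
  rintro ⟨g, hg⟩
  let f : (Fin 3 → ℂ) →ₗ[ℂ] V6 := g.toLinearMap ∘ₗ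
    (Fintype.linearCombination ℂ (![Pi.single 3 1, Pi.single 4 1, Pi.single 5 1] : Fin 3 → V6))
  have hf0 : ∀ x y w, omega1 (f x) (f y) w = 0 := by
    intro x y w
    obtain ⟨w, rfl⟩ := g.surjective w
    change omega1 (g _) (g _) (g w) = 0
    rw [hg]
    simp [omega2, eDet, Matrix.det_fin_three, Fintype.linearCombination_apply,
      Fin.sum_univ_three, Pi.single_apply]
  have hfi : ∀ x, f x = 0 → x = 0 := by
    intro x hx
    have hx' : g (Fintype.linearCombination ℂ
      (![Pi.single 3 1, Pi.single 4 1, Pi.single 5 1] : Fin 3 → V6) x) = 0 := hx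
    rw [map_eq_zero_iff g g.injective] at hx'
    have h3 := congrFun hx' 3
    have h4 := congrFun hx' 4
    have h5 := congrFun hx' 5
    simp [Fintype.linearCombination_apply, Fin.sum_univ_three, Pi.single_apply] at h3 h4 h5
    ext i; fin_cases i <;> simp [h3, h4, h5]
  have hb1 : ∃ i : Fin 6, ∀ x, f x i = 0 → f x 0 = 0 ∧ f x 1 = 0 ∧ f x 2 = 0 := by
    by_cases hh : ∀ x, f x 0 = 0 ∧ f x 1 = 0 ∧ f x 2 = 0
    · exact ⟨0, fun x _ => hh x⟩
    · push Not at hh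
      obtain ⟨y, hy⟩ := hh
      have H : ∀ x, f x 0 * f y 1 = f x 1 * f y 0 ∧ f x 0 * f y 2 = f x 2 * f y 0
          ∧ f x 1 * f y 2 = f x 2 * f y 1 := by
        intro x
        have a0 := hf0 x y (Pi.single 0 1)
        have a1 := hf0 x y (Pi.single 1 1)
        have a2 := hf0 x y (Pi.single 2 1)
        simp [omega1, eDet, Matrix.det_fin_three, Pi.single_apply] at a0 a1 a2
        refine ⟨?_, ?_, ?_⟩ <;> grind
      by_cases y0 : f y 0 = 0
      · by_cases y1 : f y 1 = 0
        · exact ⟨2, fun x hx => by have := H x; grind⟩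
        · exact ⟨1, fun x hx => by have := H x; grind⟩
      · exact ⟨0, fun x hx => by have := H x; grind⟩
  have hb2 : ∃ i : Fin 6, ∀ x, f x i = 0 → f x 3 = 0 ∧ f x 4 = 0 ∧ f x 5 = 0 := by
    by_cases hh : ∀ x, f x 3 = 0 ∧ f x 4 = 0 ∧ f x 5 = 0
    · exact ⟨0, fun x _ => hh x⟩
    · push Not at hh
      obtain ⟨y, hy⟩ := hh
      have H : ∀ x, f x 3 * f y 4 = f x 4 * f y 3 ∧ f x 3 * f y 5 = f x 5 * f y 3
          ∧ f x 4 * f y 5 = f x 5 * f y 4 := by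
        intro x
        have a0 := hf0 x y (Pi.single 3 1)
        have a1 := hf0 x y (Pi.single 4 1)
        have a2 := hf0 x y (Pi.single 5 1)
        simp [omega1, eDet, Matrix.det_fin_three, Pi.single_apply] at a0 a1 a2
        refine ⟨?_, ?_, ?_⟩ <;> grind
      by_cases y0 : f y 3 = 0
      · by_cases y1 : f y 4 = 0
        · exact ⟨5, fun x hx => by have := H x; grind⟩
        · exact ⟨4, fun x hx => by have := H x; grind⟩
      · exact ⟨3, fun x hx => by have := H x; grind⟩
  obtain ⟨i, hi⟩ := hb1
  obtain ⟨j, hj⟩ := hb2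
  have hk := LinearMap.ker_ne_bot_of_finrank_lt
    (f := (LinearMap.funLeft ℂ ℂ (![i, j] : Fin 2 → Fin 6)) ∘ₗ f) (by simp)
  obtain ⟨x, hx, hx0⟩ := (Submodule.ne_bot_iff _).1 hk
  apply hx0
  apply hfi
  rw [LinearMap.mem_ker] at hx
  have e1 : f x i = 0 := congrFun hx 0
  have e2 : f x j = 0 := congrFun hx 1
  have := hi x e1
  have := hj x e2
  ext k; fin_cases k <;> simp_all

theorem skew3 {W : Type*} [AddCommGroup W] [Module ℂ W] (hd : Module.finrank ℂ W = 3)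
    (β : W →ₗ[ℂ] W →ₗ[ℂ] ℂ) (hβ : ∀ x, β x x = 0) : ∃ x, x ≠ 0 ∧ ∀ y, β x y = 0 := by
  haveI : Module.Finite ℂ W := Module.finite_of_finrank_pos (by omega)
  let b : Module.Basis (Fin 3) ℂ W := Module.finBasisOfFinrankEq ℂ W hd
  have hs : ∀ x y, β y x = - β x y := by
    intro x y
    have := hβ (x + y)
    simp only [map_add, LinearMap.add_apply, hβ] at this
    linear_combination this
  have hex : ∀ x, (∀ i, β x (b i) = 0) → ∀ y, β x y = 0 := by
    intro x hx y
    have : β x = 0 := b.ext (by simpa using hx)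
    rw [this]; rfl
  by_cases h0 : β (b 0) (b 1) = 0 ∧ β (b 0) (b 2) = 0
  · refine ⟨b 0, b.ne_zero 0, hex _ ?_⟩
    intro i; fin_cases i
    · exact hβ _
    · exact h0.1
    · exact h0.2
  · refine ⟨β (b 1) (b 2) • b 0 - β (b 0) (b 2) • b 1 + β (b 0) (b 1) • b 2, ?_, hex _ ?_⟩
    · intro hz
      apply h0
      have h1 := congrArg (fun t => b.repr t 1) hz
      have h2 := congrArg (fun t => b.repr t 2) hz
      simp [Finsupp.single_apply] at h1 h2
      exact ⟨h2, h1⟩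
    · intro i
      have s01 := hs (b 0) (b 1)
      have s02 := hs (b 0) (b 2)
      have s12 := hs (b 1) (b 2)
      fin_cases i <;> simp [hβ, s01, s02, s12] <;> ring

theorem main (ω : F3) (hrk : ∀ v, (∀ u w, T ω v u w = 0) → v = 0) :
    (∃ g : V6 ≃ₗ[ℂ] V6, ∀ u v w, ω ![g u, g v, g w] = omega1 u v w) ∨
    (∃ g : V6 ≃ₗ[ℂ] V6, ∀ u v w, ω ![g u, g v, g w] = omega2 u v w) := by
  obtain ⟨v, p, q, hv0, hpq, hd⟩ := exists_vpq ω hrk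
  have hW : ∀ x, T ω v p x = 0 → T ω v q x = 0 → ∀ y, T ω v x y = 0 := by
    intro x h1 h2 y; rw [hd, h1, h2]; ring
  have hpqv : T ω p q v = 1 := by rw [T_s23, T_s12, hpq]; ring
  by_cases hc : ∃ a b c, (T ω v p a = 0 ∧ T ω v q a = 0) ∧ (T ω v p b = 0 ∧ T ω v q b = 0) ∧
      (T ω v p c = 0 ∧ T ω v q c = 0) ∧ T ω a b c ≠ 0
  · left
    obtain ⟨a, b, c, ⟨ha1, ha2⟩, ⟨hb1, hb2⟩, ⟨hc1, hc2⟩, hne⟩ := hc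
    -- normalise
    obtain ⟨a, ha1, ha2, habc⟩ : ∃ a', T ω v p a' = 0 ∧ T ω v q a' = 0 ∧ T ω a' b c = 1 :=
      ⟨(T ω a b c)⁻¹ • a, by rw [T_smul3, ha1, mul_zero], by rw [T_smul3, ha2, mul_zero],
        by rw [T_smul1, inv_mul_cancel₀ hne]⟩
    have key : ∀ p, (∀ y, T ω v a y = 0) → ∃ w, (∀ y, T ω v w y = 0) ∧
        T ω (p + w) a b = 0 ∧ T ω (p + w) a c = 0 ∧ T ω (p + w) b c = 0 := by
      intro p _
      refine ⟨(- T ω p b c) • a + (T ω p a c) • b + (- T ω p a b) • c, ?_, ?_, ?_, ?_⟩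
      · intro y
        simp only [T_add2, T_smul2, hW a ha1 ha2, hW b hb1 hb2, hW c hc1 hc2]; ring
      · simp only [T_add1, T_smul1, T_e12, T_e13]
        rw [T_s12 ω a c, T_s23 ω a b, habc]; ring
      · simp only [T_add1, T_smul1, T_e12, T_e13]
        rw [T_s12 ω a b, habc]; ring
      · simp only [T_add1, T_smul1, T_e12, T_e13]
        rw [habc]; ring
    have hva := hW a ha1 ha2
    have hvb := hW b hb1 hb2
    have hvc := hW c hc1 hc2
    obtain ⟨w, hw, hp1, hp2, hp3⟩ := key p hva
    obtain ⟨w', hw', hq1, hq2, hq3⟩ := key q hva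
    have hv3 : ∀ x y, (∀ z, T ω v x z = 0) → T ω y v x = 0 := by
      intro x y h
      rw [T_s12, T_s23, h]; ring
    generalize hP : p + w = P at *
    generalize hQ : q + w' = Q at *
    have hPQ : T ω P Q v = 1 := by
      have : T ω v P Q = 1 := by
        rw [← hP, ← hQ, T_add2, T_add3, hw, hpq, T_s23, hw']; ring
      rw [T_s23, T_s12, this]; ring
    have ht : ∀ a, (∀ z, T ω v a z = 0) → ∃ t : ℂ, T ω P Q (a + t • v) = 0 := by
      intro a _
      exact ⟨- T ω P Q a, by rw [T_add3, T_smul3, hPQ]; ring⟩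
    obtain ⟨ta, hta⟩ := ht a hva
    obtain ⟨tb, htb⟩ := ht b hvb
    obtain ⟨tc, htc⟩ := ht c hvc
    have hva3 := fun y => hv3 a y hva
    have hvb3 := fun y => hv3 b y hvb
    have hvc3 := fun y => hv3 c y hvc
    have ra : ∀ y, T ω y a v = 0 := fun y => by rw [T_s23, hva3, neg_zero]
    have rb : ∀ y, T ω y b v = 0 := fun y => by rw [T_s23, hvb3, neg_zero]
    have rc : ∀ y, T ω y c v = 0 := fun y => by rw [T_s23, hvc3, neg_zero]
    refine case1 ω P Q v (a + ta • v) (b + tb • v) (c + tc • v) hPQ ?_ hta htb htc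
      ?_ ?_ ?_ ?_ ?_ ?_ ?_ ?_ ?_ ?_ ?_ ?_ ?_ ?_ ?_ <;>
    simp only [T_add1, T_add2, T_add3, T_smul1, T_smul2, T_smul3, T_e12, T_e13, T_e23,
      hva, hvb, hvc, hva3, hvb3, hvc3, ra, rb, rc, habc, hp1, hp2, hp3, hq1, hq2, hq3] <;> ring
  · right
    have hc' : ∀ a b c, T ω v p a = 0 → T ω v q a = 0 → T ω v p b = 0 → T ω v q b = 0 →
      T ω v p c = 0 → T ω v q c = 0 → T ω a b c = 0 := by
      intro a b c h1 h2 h3 h4 h5 h6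
      by_contra h
      exact hc ⟨a, b, c, ⟨h1, h2⟩, ⟨h3, h4⟩, ⟨h5, h6⟩, h⟩
    clear hc
    have hqp : T ω v q p = -1 := by rw [T_s23, hpq]
    obtain ⟨φ, hφ⟩ : ∃ φ : V6 →ₗ[ℂ] ℂ, φ v = 1 := by
      obtain ⟨i, hi⟩ := Function.ne_iff.1 hv0
      exact ⟨(v i)⁻¹ • LinearMap.proj i, by simpa using inv_mul_cancel₀ hi⟩
    let L3 : V6 → V6 → V6 →ₗ[ℂ] ℂ := fun x y =>
      { toFun := fun z => T ω x y z
        map_add' := fun z z' => T_add3 ω x y z z'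
        map_smul' := fun c z => T_smul3 ω c x y z }
    let L : V6 →ₗ[ℂ] (Fin 3 → ℂ) := LinearMap.pi ![L3 v p, L3 v q, φ]
    have hL : ∀ x, L x = ![T ω v p x, T ω v q x, φ x] := by
      intro x; ext i; fin_cases i <;> rfl
    have hsurj : LinearMap.range L = ⊤ := by
      rw [LinearMap.range_eq_top]
      intro y
      refine ⟨y 0 • q + (- y 1) • p + (y 2 - y 0 * φ q + y 1 * φ p) • v, ?_⟩
      rw [hL]
      ext i
      fin_cases i
      · change T ω v p _ = y 0
        simp only [T_add3, T_smul3, hpq, T_e13, T_e23]; ring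
      · change T ω v q _ = y 1
        simp only [T_add3, T_smul3, hqp, T_e13, T_e23]; ring
      · simp [hφ]; ring
    have hfr : Module.finrank ℂ (LinearMap.ker L) = 3 := by
      have := LinearMap.finrank_range_add_finrank_ker L
      rw [hsurj, finrank_top] at this
      simp at this
      omega
    have hker : ∀ x : LinearMap.ker L, T ω v p x = 0 ∧ T ω v q x = 0 ∧ φ x = 0 := by
      intro x
      have := x.2
      rw [LinearMap.mem_ker, hL] at this
      exact ⟨congrFun this 0, congrFun this 1, congrFun this 2⟩
    have hvk : ∀ x, T ω v p x = 0 → T ω v q x = 0 → x - φ x • v ∈ LinearMap.ker L := by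
      intro x h1 h2
      rw [LinearMap.mem_ker, hL]
      have e : x - φ x • v = x + (- φ x) • v := by module
      ext i
      fin_cases i
      · change T ω v p _ = 0
        rw [e, T_add3, T_smul3, h1, T_e13]; ring
      · change T ω v q _ = 0
        rw [e, T_add3, T_smul3, h2, T_e13]; ring
      · simp [hφ]
    have kerv : ∀ r, ∃ x : V6, T ω v p x = 0 ∧ T ω v q x = 0 ∧ φ x = 0 ∧ x ≠ 0 ∧
        ∀ y, T ω v p y = 0 → T ω v q y = 0 → T ω r x y = 0 := by
      intro r
      let β : LinearMap.ker L →ₗ[ℂ] LinearMap.ker L →ₗ[ℂ] ℂ := LinearMap.mk₂ ℂ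
        (fun x y => T ω r x y) (fun _ _ _ => T_add2 _ _ _ _ _) (fun _ _ _ => T_smul2 _ _ _ _ _)
        (fun _ _ _ => T_add3 _ _ _ _ _) (fun _ _ _ => T_smul3 _ _ _ _ _)
      obtain ⟨x, hx0, hx⟩ := skew3 hfr β (fun x => T_e23 _ _ _)
      obtain ⟨k1, k2, k3⟩ := hker x
      refine ⟨x, k1, k2, k3, fun h => hx0 (Subtype.ext h), ?_⟩
      intro y h1 h2
      have h3 : T ω r x (y - φ y • v) = 0 := hx ⟨_, hvk y h1 h2⟩
      have e : y = (y - φ y • v) + φ y • v := by module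
      rw [e, T_add3, h3, T_smul3, T_s23 ω r v x, T_s12 ω v r x, T_s23 ω v x r, hW x k1 k2]; ring
    -- a vector of `W` killed by both `p` and `q` vanishes
    have nz : ∀ x, T ω v p x = 0 → T ω v q x = 0 → φ x = 0 →
        (∀ y, T ω v p y = 0 → T ω v q y = 0 → T ω p x y = 0) →
        (∀ y, T ω v p y = 0 → T ω v q y = 0 → T ω q x y = 0) → x = 0 := by
      intro x k1 k2 k3 h1 h2
      have hz : x + (- T ω p q x) • v = 0 := by
        set z := x + (- T ω p q x) • v with hzdef
        have z1 : T ω v p z = 0 := by rw [hzdef, T_add3, T_smul3, k1, T_e13]; ring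
        have z2 : T ω v q z = 0 := by rw [hzdef, T_add3, T_smul3, k2, T_e13]; ring
        have z3 : T ω p q z = 0 := by rw [hzdef, T_add3, T_smul3, hpqv]; ring
        have z4 : ∀ y, T ω v p y = 0 → T ω v q y = 0 → T ω p z y = 0 := by
          intro y y1 y2
          rw [hzdef, T_add2, T_smul2, h1 y y1 y2, T_s12 ω v p y, y1]; ring
        have z5 : ∀ y, T ω v p y = 0 → T ω v q y = 0 → T ω q z y = 0 := by
          intro y y1 y2
          rw [hzdef, T_add2, T_smul2, h2 y y1 y2, T_s12 ω v q y, y2]; ring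
        apply hrk
        -- every vector decomposes
        have dec : ∀ u : V6, ∃ (a b : ℂ) (w : V6), u = a • p + b • q + w ∧ T ω v p w = 0 ∧ T ω v q w = 0 := by
          intro u
          refine ⟨- T ω v q u, T ω v p u, u + T ω v q u • p + (- T ω v p u) • q, by module, ?_, ?_⟩
          · simp only [T_add3, T_smul3, T_e23, hpq]; ring
          · simp only [T_add3, T_smul3, T_e23, hqp]; ring
        intro u w
        obtain ⟨a, b, s, rfl, s1, s2⟩ := dec u
        obtain ⟨a', b', s', rfl, s1', s2'⟩ := dec w
        have f1 : T ω z p q = 0 := by rw [T_s12, T_s23, z3]; ring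
        have f2 : T ω z q p = 0 := by rw [T_s23, f1]; ring
        have f3 : ∀ y, T ω v p y = 0 → T ω v q y = 0 → T ω z p y = 0 := by
          intro y y1 y2; rw [T_s12, z4 y y1 y2]; ring
        have f4 : ∀ y, T ω v p y = 0 → T ω v q y = 0 → T ω z q y = 0 := by
          intro y y1 y2; rw [T_s12, z5 y y1 y2]; ring
        have f5 : T ω z s p = 0 := by rw [T_s23, f3 s s1 s2]; ring
        have f6 : T ω z s q = 0 := by rw [T_s23, f4 s s1 s2]; ring
        simp only [T_add2, T_add3, T_smul2, T_smul3, T_e23, f1, f2, f3 s' s1' s2', f4 s' s1' s2',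
          f5, f6, hc' z s s' z1 z2 s1 s2 s1' s2']
        ring
      have := congrArg φ hz
      simp [k3, hφ] at this
      simpa [this] using hz
    obtain ⟨c, c1, c2, c3, c0, hcp⟩ := kerv p
    obtain ⟨b, b1, b2, b3, b0, hbq⟩ := kerv q
    obtain ⟨y, y1, y2, hy⟩ : ∃ y, T ω v p y = 0 ∧ T ω v q y = 0 ∧ T ω p b y ≠ 0 := by
      by_contra! h
      exact b0 (nz b b1 b2 b3 h hbq)
    obtain ⟨x, x1, x2, hx⟩ : ∃ y, T ω v p y = 0 ∧ T ω v q y = 0 ∧ T ω q c y ≠ 0 := by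
      by_contra! h
      exact c0 (nz c c1 c2 c3 hcp h)
    obtain ⟨a, a1, a2, hab, hac⟩ : ∃ a, T ω v p a = 0 ∧ T ω v q a = 0 ∧ T ω p b a ≠ 0 ∧
        T ω q c a ≠ 0 := by
      by_cases hy' : T ω q c y = 0
      · by_cases hx' : T ω p b x = 0
        · exact ⟨x + y, by rw [T_add3, x1, y1]; ring, by rw [T_add3, x2, y2]; ring,
            by rw [T_add3, hx', zero_add]; exact hy, by rw [T_add3, hy', add_zero]; exact hx⟩
        · exact ⟨x, x1, x2, hx', hx⟩
      · exact ⟨y, y1, y2, hy, hy'⟩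
    -- adjust by multiples of `v`
    have hva := hW a a1 a2
    have hvb := hW b b1 b2
    have hvc := hW c c1 c2
    have hv3 : ∀ x y, (∀ z, T ω v x z = 0) → T ω y v x = 0 := by
      intro x y h
      rw [T_s12, T_s23, h]; ring
    have hva3 := fun y => hv3 a y hva
    have hvb3 := fun y => hv3 b y hvb
    have hvc3 := fun y => hv3 c y hvc
    have ra : ∀ y, T ω y a v = 0 := fun y => by rw [T_s23, hva3, neg_zero]
    have rb : ∀ y, T ω y b v = 0 := fun y => by rw [T_s23, hvb3, neg_zero]
    have rc : ∀ y, T ω y c v = 0 := fun y => by rw [T_s23, hvc3, neg_zero]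
    have habc := hc' a b c a1 a2 b1 b2 c1 c2
    have hpbc : T ω p b c = 0 := by rw [T_s23, hcp b b1 b2, neg_zero]
    have hpac : T ω p a c = 0 := by rw [T_s23, hcp a a1 a2, neg_zero]
    have hqbc : T ω q b c = 0 := hbq c c1 c2
    have hqab : T ω q a b = 0 := by rw [T_s23, hbq a a1 a2, neg_zero]
    have hpab : T ω p a b ≠ 0 := by rw [T_s23]; exact neg_ne_zero.2 hab
    have hqac : T ω q a c ≠ 0 := by rw [T_s23]; exact neg_ne_zero.2 hac
    refine case2 ω p q (a + (- T ω p q a) • v) v ((T ω p a b)⁻¹ • (b + (- T ω p q b) • v))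
      ((T ω q a c)⁻¹ • (c + (- T ω p q c) • v)) ?_ ?_ ?_ ?_ ?_ ?_ ?_ ?_ ?_ ?_ ?_ ?_ ?_ ?_ ?_ ?_ ?_ ?_
      ?_ ?_ <;>
    simp only [T_add1, T_add2, T_add3, T_smul1, T_smul2, T_smul3, T_e12, T_e13, T_e23,
      hva, hvb, hvc, hva3, hvb3, hvc3, ra, rb, rc, habc, hpbc, hpac, hqbc, hqab, hpqv] <;>
    field_simp <;> ring

end TF

/-- Classification of rank-six three-forms in six variables: any such form is
`GL₆`-equivalent to exactly one of `ω₁ = e^{123} + e^{456}` and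
`ω₂ = e^{124} + e^{135} + e^{236}`. -/
theorem rankSix_threeForm_classification
    (ω : AlternatingMap ℂ (Fin 6 → ℂ) ℂ (Fin 3))
    (hrk : ∀ v : Fin 6 → ℂ, (∀ u w : Fin 6 → ℂ, ω ![v, u, w] = 0) → v = 0) :
    ((∃ g : (Fin 6 → ℂ) ≃ₗ[ℂ] (Fin 6 → ℂ), ∀ u v w : Fin 6 → ℂ,
        ω ![g u, g v, g w] = omega1 u v w) ∨
     (∃ g : (Fin 6 → ℂ) ≃ₗ[ℂ] (Fin 6 → ℂ), ∀ u v w : Fin 6 → ℂ,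
        ω ![g u, g v, g w] = omega2 u v w)) ∧
    ¬ (∃ g : (Fin 6 → ℂ) ≃ₗ[ℂ] (Fin 6 → ℂ), ∀ u v w : Fin 6 → ℂ,
        omega1 (g u) (g v) (g w) = omega2 u v w) := by
  exact ⟨TF.main ω hrk, TF.not_equiv⟩
end
end

section
/- Schouten's theorem: let ω be a three-form on V = Fin 7 → ℂ of maximal rank, i.e. the only v ∈ V with ω(v,u,w) = 0 for all u,w is v = 0. Then ω is GL₇-equivalent to one of the following five forms: ω₁ = e^{125}+e^{136}+e^{147}; ω₂ = e^{125}+e^{136}+e^{147}+e^{234}; ω₃ = e^{125}+e^{236}+e^{347}; ω₄ = e^{125}+e^{147}+e^{346}+e^{327}; ω₅ = e^{125}+e^{136}+e^{147}+e^{234}+e^{567}. That is, there exist i ∈ {1,2,3,4,5} and a linear automorphism g of V with ω(gu,gv,gw) = ωᵢ(u,v,w) for all u,v,w ∈ V. -/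
noncomputable section

/-- `ω₁ = e^{125} + e^{136} + e^{147}` (indices `1,…,7` rendered as `0,…,6` in `Fin 7`). -/
def schouten1 (u v w : Fin 7 → ℂ) : ℂ :=
  eDet 0 1 4 u v w + eDet 0 2 5 u v w + eDet 0 3 6 u v w

/-- `ω₂ = e^{125} + e^{136} + e^{147} + e^{234}`. -/
def schouten2 (u v w : Fin 7 → ℂ) : ℂ :=
  eDet 0 1 4 u v w + eDet 0 2 5 u v w + eDet 0 3 6 u v w + eDet 1 2 3 u v w

/-- `ω₃ = e^{125} + e^{236} + e^{347}`. -/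
def schouten3 (u v w : Fin 7 → ℂ) : ℂ :=
  eDet 0 1 4 u v w + eDet 1 2 5 u v w + eDet 2 3 6 u v w

/-- `ω₄ = e^{125} + e^{147} + e^{346} + e^{327}`. -/
def schouten4 (u v w : Fin 7 → ℂ) : ℂ :=
  eDet 0 1 4 u v w + eDet 0 3 6 u v w + eDet 2 3 5 u v w + eDet 2 1 6 u v w

/-- `ω₅ = e^{125} + e^{136} + e^{147} + e^{234} + e^{567}`. -/
def schouten5 (u v w : Fin 7 → ℂ) : ℂ :=
  eDet 0 1 4 u v w + eDet 0 2 5 u v w + eDet 0 3 6 u v w + eDet 1 2 3 u v w +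
    eDet 4 5 6 u v w



set_option linter.unusedSimpArgs false
set_option linter.unusedSectionVars false
set_option linter.unreachableTactic false
set_option linter.unusedTactic false
set_option linter.style.setOption false
section Aux

variable {E : Type*} [AddCommGroup E] [Module ℂ E]

def W3 (ω : AlternatingMap ℂ E ℂ (Fin 3)) (u v w : E) : ℂ := ω ![u, v, w]

variable (ω : AlternatingMap ℂ E ℂ (Fin 3))

lemma upd0 (u v w x : E) : Function.update ![u, v, w] 0 x = ![x, v, w] := by
  ext i
  fin_cases i <;> rfl

lemma W3_add1 (u u' v w : E) : W3 ω (u + u') v w = W3 ω u v w + W3 ω u' v w := by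
  have h := ω.map_update_add ![u, v, w] 0 u u'
  rwa [upd0, upd0, upd0] at h

lemma W3_smul1 (c : ℂ) (u v w : E) : W3 ω (c • u) v w = c * W3 ω u v w := by
  have h := ω.map_update_smul ![u, v, w] 0 c u
  rwa [upd0, upd0] at h

lemma W3_swap12 (u v w : E) : W3 ω u v w = - W3 ω v u w := by
  have h := ω.map_swap ![v, u, w] (i := 0) (j := 1) (by decide)
  rw [W3, W3, ← h]
  congr 1
  ext i
  fin_cases i <;> rfl

lemma W3_swap23 (u v w : E) : W3 ω u v w = - W3 ω u w v := by
  have h := ω.map_swap ![u, w, v] (i := 1) (j := 2) (by decide)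
  rw [W3, W3, ← h]
  congr 1
  ext i
  fin_cases i <;> rfl

lemma W3_self12 (u w : E) : W3 ω u u w = 0 :=
  ω.map_eq_zero_of_eq ![u, u, w] (i := 0) (j := 1) rfl (by decide)

lemma W3_self23 (u w : E) : W3 ω u w w = 0 :=
  ω.map_eq_zero_of_eq ![u, w, w] (i := 1) (j := 2) rfl (by decide)

lemma W3_self13 (u w : E) : W3 ω u w u = 0 :=
  ω.map_eq_zero_of_eq ![u, w, u] (i := 0) (j := 2) rfl (by decide)

lemma W3_add2 (u v v' w : E) : W3 ω u (v + v') w = W3 ω u v w + W3 ω u v' w := by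
  rw [W3_swap12, W3_add1, W3_swap12 ω v, W3_swap12 ω v']; ring

lemma W3_add3 (u v w w' : E) : W3 ω u v (w + w') = W3 ω u v w + W3 ω u v w' := by
  rw [W3_swap23, W3_add2, W3_swap23 ω u w, W3_swap23 ω u w']; ring

lemma W3_smul2 (c : ℂ) (u v w : E) : W3 ω u (c • v) w = c * W3 ω u v w := by
  rw [W3_swap12, W3_smul1, W3_swap12 ω v]; ring

lemma W3_smul3 (c : ℂ) (u v w : E) : W3 ω u v (c • w) = c * W3 ω u v w := by
  rw [W3_swap23, W3_smul2, W3_swap23 ω u w]; ring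

lemma W3_neg1 (u v w : E) : W3 ω (-u) v w = - W3 ω u v w := by
  rw [← neg_one_smul ℂ u, W3_smul1]; ring

lemma W3_neg2 (u v w : E) : W3 ω u (-v) w = - W3 ω u v w := by
  rw [← neg_one_smul ℂ v, W3_smul2]; ring

lemma W3_neg3 (u v w : E) : W3 ω u v (-w) = - W3 ω u v w := by
  rw [← neg_one_smul ℂ w, W3_smul3]; ring

lemma W3_sub1 (u u' v w : E) : W3 ω (u - u') v w = W3 ω u v w - W3 ω u' v w := by
  rw [sub_eq_add_neg, W3_add1, W3_neg1]; ring

lemma W3_sub2 (u v v' w : E) : W3 ω u (v - v') w = W3 ω u v w - W3 ω u v' w := by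
  rw [sub_eq_add_neg, W3_add2, W3_neg2]; ring

lemma W3_sub3 (u v w w' : E) : W3 ω u v (w - w') = W3 ω u v w - W3 ω u v w' := by
  rw [sub_eq_add_neg, W3_add3, W3_neg3]; ring

lemma W3_zero1 (v w : E) : W3 ω 0 v w = 0 := by
  rw [← zero_smul ℂ (0 : E), W3_smul1]; ring

/-- The linear functional in the last slot. -/
def F3 (u v : E) : E →ₗ[ℂ] ℂ where
  toFun w := W3 ω u v w
  map_add' := W3_add3 ω u v
  map_smul' c w := W3_smul3 ω c u v w

lemma F3_apply (u v w : E) : F3 ω u v w = W3 ω u v w := rfl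

lemma W3_ord12 (z : Fin 7 → E) (i j : Fin 7) (w : E) (_h : j < i) :
    W3 ω (z i) (z j) w = - W3 ω (z j) (z i) w := W3_swap12 ω _ _ _

lemma W3_ord23 (z : Fin 7 → E) (i j : Fin 7) (u : E) (_h : j < i) :
    W3 ω u (z i) (z j) = - W3 ω u (z j) (z i) := W3_swap23 ω _ _ _

/-- Extension lemma: alternating forms agreeing on increasing triples agree. -/
lemma W3_ext_sorted {E' : Type*} [AddCommGroup E'] [Module ℂ E']
    (ω' : AlternatingMap ℂ E' ℂ (Fin 3)) (b : Fin 7 → E) (b' : Fin 7 → E')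
    (h : ∀ i j k : Fin 7, i < j → j < k → W3 ω (b i) (b j) (b k) = W3 ω' (b' i) (b' j) (b' k))
    (i j k : Fin 7) : W3 ω (b i) (b j) (b k) = W3 ω' (b' i) (b' j) (b' k) := by
  rcases lt_trichotomy i j with h1 | h1 | h1
  · rcases lt_trichotomy j k with h2 | h2 | h2
    · exact h _ _ _ h1 h2
    · subst h2; simp [W3_self23]
    · rw [W3_swap23, W3_swap23 ω']
      rcases lt_trichotomy i k with h3 | h3 | h3
      · rw [h _ _ _ h3 h2]
      · subst h3; simp [W3_self12]
      · rw [W3_swap12, W3_swap12 ω', h _ _ _ h3 h1]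
  · subst h1; simp [W3_self12]
  · rw [W3_swap12, W3_swap12 ω']
    rcases lt_trichotomy i k with h2 | h2 | h2
    · rw [h _ _ _ h1 h2]
    · subst h2; simp [W3_self23]
    · rw [W3_swap23, W3_swap23 ω']
      rcases lt_trichotomy j k with h3 | h3 | h3
      · rw [h _ _ _ h3 h2]
      · subst h3; simp [W3_self12]
      · rw [W3_swap12, W3_swap12 ω', h _ _ _ h3 h1]

end Aux

/-- Sufficiency of 35 sorted equalities. -/
lemma forall_sorted (P : Fin 7 → Fin 7 → Fin 7 → Prop)
    (h0 : P 0 1 2 ∧ P 0 1 3 ∧ P 0 1 4 ∧ P 0 1 5 ∧ P 0 1 6 ∧ P 0 2 3 ∧ P 0 2 4 ∧ P 0 2 5 ∧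
      P 0 2 6 ∧ P 0 3 4 ∧ P 0 3 5 ∧ P 0 3 6 ∧ P 0 4 5 ∧ P 0 4 6 ∧ P 0 5 6)
    (h1 : P 1 2 3 ∧ P 1 2 4 ∧ P 1 2 5 ∧ P 1 2 6 ∧ P 1 3 4 ∧ P 1 3 5 ∧ P 1 3 6 ∧
      P 1 4 5 ∧ P 1 4 6 ∧ P 1 5 6)
    (h2 : P 2 3 4 ∧ P 2 3 5 ∧ P 2 3 6 ∧ P 2 4 5 ∧ P 2 4 6 ∧ P 2 5 6 ∧
      P 3 4 5 ∧ P 3 4 6 ∧ P 3 5 6 ∧ P 4 5 6) :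
    ∀ i j k : Fin 7, i < j → j < k → P i j k := by
  intro i j k hij hjk
  fin_cases i <;> fin_cases j <;> first | (exact absurd hij (by decide)) | skip
  all_goals (fin_cases k <;> first | (exact absurd hjk (by decide)) | (simp; tauto))

def eDetAlt (i j k : Fin 7) : AlternatingMap ℂ (Fin 7 → ℂ) ℂ (Fin 3) :=
  (Matrix.detRowAlternating (n := Fin 3) (R := ℂ)).compLinearMap
    (LinearMap.pi ![LinearMap.proj i, LinearMap.proj j, LinearMap.proj k])

lemma eDetAlt_apply (i j k : Fin 7) (u v w : Fin 7 → ℂ) :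
    W3 (eDetAlt i j k) u v w = eDet i j k u v w := by
  simp only [W3, eDetAlt, eDet, AlternatingMap.compLinearMap_apply]
  rw [← Matrix.det_transpose]
  change Matrix.det _ = _
  congr 1
  ext a b
  fin_cases a <;> fin_cases b <;> rfl

lemma W3_addAlt {E : Type*} [AddCommGroup E] [Module ℂ E]
    (ω ω' : AlternatingMap ℂ E ℂ (Fin 3)) (u v w : E) :
    W3 (ω + ω') u v w = W3 ω u v w + W3 ω' u v w := rfl

/-- Build the equivalence from a family with prescribed values. -/
lemma build (ω S : AlternatingMap ℂ (Fin 7 → ℂ) ℂ (Fin 3)) (b : Fin 7 → Fin 7 → ℂ)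
    (h : ∀ i j k : Fin 7, i < j → j < k →
      W3 ω (b i) (b j) (b k) =
        W3 S (Pi.single i 1) (Pi.single j 1) (Pi.single k 1))
    (hS : ∀ v, (∀ j k : Fin 7, W3 S v (Pi.single j 1) (Pi.single k 1) = 0) → v = 0) :
    ∃ g : (Fin 7 → ℂ) ≃ₗ[ℂ] (Fin 7 → ℂ), ∀ u v w : Fin 7 → ℂ,
        ω ![g u, g v, g w] = W3 S u v w := by
  have hall := W3_ext_sorted ω S b (fun i => Pi.single i 1) h
  have key : ∀ (c : Fin 7 → ℂ) (j k : Fin 7),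
      W3 ω (∑ i, c i • b i) (b j) (b k) = W3 S c (Pi.single j 1) (Pi.single k 1) := by
    intro c j k
    have hc : c = ∑ i, c i • (Pi.single i 1 : Fin 7 → ℂ) := by
      ext t; simp [Finset.sum_apply, Pi.single_apply]
    conv_rhs => rw [hc]
    simp only [Fin.sum_univ_seven, W3_add1, W3_smul1, hall]
  have hli : LinearIndependent ℂ b := by
    rw [Fintype.linearIndependent_iff]
    intro c hc
    have : c = 0 := by
      apply hS
      intro j k
      rw [← key, hc, W3_zero1]
    intro i; rw [this]; rfl
  let B := basisOfLinearIndependentOfCardEqFinrank hli (by simp)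
  have hB : ∀ i, B i = b i := fun i => by simp [B]
  refine ⟨B.equivFun.symm, ?_⟩
  have hg : ∀ i, B.equivFun.symm (Pi.single i 1) = b i := by
    intro i; simp [hB]
  have : ω.compLinearMap (B.equivFun.symm : (Fin 7 → ℂ) →ₗ[ℂ] (Fin 7 → ℂ)) = S := by
    apply Module.Basis.ext_alternating (Pi.basisFun ℂ (Fin 7))
    intro v _
    have h1 := hall (v 0) (v 1) (v 2)
    simp only [W3] at h1
    rw [AlternatingMap.compLinearMap_apply]
    convert h1 using 2
    · ext a t; fin_cases a <;> simp [hg]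
    · ext a t; fin_cases a <;> simp
  intro u v w
  rw [← this, W3, AlternatingMap.compLinearMap_apply]
  congr 1
  ext a t; fin_cases a <;> rfl
section Rank

variable {E : Type*} [AddCommGroup E] [Module ℂ E] (ω : AlternatingMap ℂ E ℂ (Fin 3))

structure Fr (z : Fin 7 → E) : Prop where
  h012 : W3 ω (z 0) (z 1) (z 2) = 0
  h013 : W3 ω (z 0) (z 1) (z 3) = 0
  h014 : W3 ω (z 0) (z 1) (z 4) = 1
  h015 : W3 ω (z 0) (z 1) (z 5) = 0
  h016 : W3 ω (z 0) (z 1) (z 6) = 0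
  h023 : W3 ω (z 0) (z 2) (z 3) = 0
  h024 : W3 ω (z 0) (z 2) (z 4) = 0
  h025 : W3 ω (z 0) (z 2) (z 5) = 1
  h026 : W3 ω (z 0) (z 2) (z 6) = 0
  h034 : W3 ω (z 0) (z 3) (z 4) = 0
  h035 : W3 ω (z 0) (z 3) (z 5) = 0
  h036 : W3 ω (z 0) (z 3) (z 6) = 1
  h045 : W3 ω (z 0) (z 4) (z 5) = 0
  h046 : W3 ω (z 0) (z 4) (z 6) = 0
  h056 : W3 ω (z 0) (z 5) (z 6) = 0

def Pf4 (v a b c d : E) : ℂ :=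
  W3 ω v a b * W3 ω v c d - W3 ω v a c * W3 ω v b d + W3 ω v a d * W3 ω v b c

def Pf6 (v a b c d e f : E) : ℂ :=
  W3 ω v a b * Pf4 ω v c d e f - W3 ω v a c * Pf4 ω v b d e f + W3 ω v a d * Pf4 ω v b c e f
    - W3 ω v a e * Pf4 ω v b c d f + W3 ω v a f * Pf4 ω v b c d e

lemma exists_pair1 (v : E) (h : ¬ ∀ a b, W3 ω v a b = 0) : ∃ e f, W3 ω v e f = 1 := by
  push Not at h
  obtain ⟨e, f, hef⟩ := h
  refine ⟨e, (W3 ω v e f)⁻¹ • f, ?_⟩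
  rw [W3_smul3]; field_simp

structure Pr2 (v e1 f1 e2 f2 : E) : Prop where
  a1 : W3 ω v e1 f1 = 1
  a2 : W3 ω v e2 f2 = 1
  b1 : W3 ω v e1 e2 = 0
  b2 : W3 ω v e1 f2 = 0
  b3 : W3 ω v f1 e2 = 0
  b4 : W3 ω v f1 f2 = 0

lemma pair1_or (v e f : E) (h : W3 ω v e f = 1) :
    (∃ e2 f2, Pr2 ω v e f e2 f2) ∨
    ∀ a b, W3 ω v a b = W3 ω v a e * W3 ω v b f - W3 ω v a f * W3 ω v b e := by
  by_cases hk : ∃ k k', W3 ω v e k = 0 ∧ W3 ω v f k = 0 ∧ W3 ω v e k' = 0 ∧ W3 ω v f k' = 0 ∧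
      W3 ω v k k' ≠ 0
  · left
    obtain ⟨k, k', h1, h2, h3, h4, h5⟩ := hk
    refine ⟨k, (W3 ω v k k')⁻¹ • k', ⟨h, ?_, h1, ?_, h2, ?_⟩⟩
    · rw [W3_smul3]; field_simp
    · rw [W3_smul3, h3, mul_zero]
    · rw [W3_smul3, h4, mul_zero]
  · right
    intro a b
    by_contra hne
    apply hk
    have h' : W3 ω v f e = -1 := by rw [W3_swap23, h]
    refine ⟨a - W3 ω v a f • e + W3 ω v a e • f, b - W3 ω v b f • e + W3 ω v b e • f,
      ?_, ?_, ?_, ?_, ?_⟩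
    · simp only [W3_add3, W3_sub3, W3_smul3, W3_self23, h, W3_swap23 ω v e a]; ring
    · simp only [W3_add3, W3_sub3, W3_smul3, W3_self23, h', W3_swap23 ω v f a]; ring
    · simp only [W3_add3, W3_sub3, W3_smul3, W3_self23, h, W3_swap23 ω v e b]; ring
    · simp only [W3_add3, W3_sub3, W3_smul3, W3_self23, h', W3_swap23 ω v f b]; ring
    · intro h0
      apply hne
      simp only [W3_add3, W3_sub3, W3_smul3, W3_add2, W3_sub2, W3_smul2, W3_self23, h, h',
        W3_swap23 ω v e b, W3_swap23 ω v f b] at h0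
      linear_combination h0

lemma pair2_or (v e f e2 f2 : E) (h : Pr2 ω v e f e2 f2) :
    (∃ z, z 0 = v ∧ Fr ω z) ∨
    ∀ a b, W3 ω v a b = W3 ω v a e * W3 ω v b f - W3 ω v a f * W3 ω v b e
      + (W3 ω v a e2 * W3 ω v b f2 - W3 ω v a f2 * W3 ω v b e2) := by
  obtain ⟨a1, a2, b1, b2, b3, b4⟩ := h
  have a1' : W3 ω v f e = -1 := by rw [W3_swap23, a1]
  have a2' : W3 ω v f2 e2 = -1 := by rw [W3_swap23, a2]
  have b1' : W3 ω v e2 e = 0 := by rw [W3_swap23, b1, neg_zero]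
  have b2' : W3 ω v f2 e = 0 := by rw [W3_swap23, b2, neg_zero]
  have b3' : W3 ω v e2 f = 0 := by rw [W3_swap23, b3, neg_zero]
  have b4' : W3 ω v f2 f = 0 := by rw [W3_swap23, b4, neg_zero]
  by_cases hk : ∃ k k', W3 ω v e k = 0 ∧ W3 ω v f k = 0 ∧ W3 ω v e k' = 0 ∧ W3 ω v f k' = 0 ∧
      W3 ω v e2 k = 0 ∧ W3 ω v f2 k = 0 ∧ W3 ω v e2 k' = 0 ∧ W3 ω v f2 k' = 0 ∧
      W3 ω v k k' ≠ 0
  · left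
    obtain ⟨k, k', h1, h2, h3, h4, h5, h6, h7, h8, h9⟩ := hk
    refine ⟨![v, e, e2, k, f, f2, (W3 ω v k k')⁻¹ • k'], rfl, ?_⟩
    constructor <;> simp [W3_smul3, a1, a2, b1, b2, h1, h2, h3, h4, h5, h6, h7, h8, h9, b3', b4]
    · rw [W3_swap23, h2, neg_zero]
    · rw [W3_swap23, h6, neg_zero]
  · right
    intro a b
    by_contra hne
    apply hk
    refine ⟨a - W3 ω v a f • e + W3 ω v a e • f - W3 ω v a f2 • e2 + W3 ω v a e2 • f2,
      b - W3 ω v b f • e + W3 ω v b e • f - W3 ω v b f2 • e2 + W3 ω v b e2 • f2,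
      ?_, ?_, ?_, ?_, ?_, ?_, ?_, ?_, ?_⟩
    · simp only [W3_add3, W3_sub3, W3_smul3, W3_self23, a1, b1, b2, W3_swap23 ω v e a]; ring
    · simp only [W3_add3, W3_sub3, W3_smul3, W3_self23, a1', b3, b4, W3_swap23 ω v f a]; ring
    · simp only [W3_add3, W3_sub3, W3_smul3, W3_self23, a1, b1, b2, W3_swap23 ω v e b]; ring
    · simp only [W3_add3, W3_sub3, W3_smul3, W3_self23, a1', b3, b4, W3_swap23 ω v f b]; ring
    · simp only [W3_add3, W3_sub3, W3_smul3, W3_self23, a2, b1', b3', W3_swap23 ω v e2 a]; ring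
    · simp only [W3_add3, W3_sub3, W3_smul3, W3_self23, a2', b2', b4', W3_swap23 ω v f2 a]; ring
    · simp only [W3_add3, W3_sub3, W3_smul3, W3_self23, a2, b1', b3', W3_swap23 ω v e2 b]; ring
    · simp only [W3_add3, W3_sub3, W3_smul3, W3_self23, a2', b2', b4', W3_swap23 ω v f2 b]; ring
    · intro h0
      apply hne
      simp only [W3_add3, W3_sub3, W3_smul3, W3_add2, W3_sub2, W3_smul2, W3_self23, a1, a1', a2,
        a2', b1, b2, b3, b4, b1', b2', b3', b4',
        W3_swap23 ω v e b, W3_swap23 ω v f b, W3_swap23 ω v e2 b, W3_swap23 ω v f2 b] at h0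
      linear_combination h0

lemma exists_pr2 (v a b c d : E) (h : Pf4 ω v a b c d ≠ 0) :
    ∃ e f e2 f2, Pr2 ω v e f e2 f2 := by
  by_cases h0 : ∀ a b, W3 ω v a b = 0
  · exact absurd (by simp [Pf4, h0]) h
  obtain ⟨e, f, hef⟩ := exists_pair1 ω v h0
  rcases pair1_or ω v e f hef with ⟨e2, f2, h2⟩ | h2
  · exact ⟨e, f, e2, f2, h2⟩
  · refine absurd ?_ h
    rw [Pf4, h2 a b, h2 c d, h2 a c, h2 b d, h2 a d, h2 b c]
    ring

lemma exists_fr (v a b c d x y : E) (h : Pf6 ω v a b c d x y ≠ 0) :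
    ∃ z, z 0 = v ∧ Fr ω z := by
  have h4 : ∃ e f e2 f2, Pr2 ω v e f e2 f2 := by
    by_contra hn
    have : ∀ a b c d, Pf4 ω v a b c d = 0 := by
      intro a b c d
      by_contra hne
      exact hn (exists_pr2 ω v a b c d hne)
    apply h
    simp [Pf6, this]
  obtain ⟨e, f, e2, f2, h2⟩ := h4
  rcases pair2_or ω v e f e2 f2 h2 with h3 | h3
  · exact h3
  · refine absurd ?_ h
    rw [Pf6, Pf4, Pf4, Pf4, Pf4, Pf4, h3 a b, h3 a c, h3 a d, h3 a x, h3 a y, h3 b c, h3 b d,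
      h3 b x, h3 b y, h3 c d, h3 c x, h3 c y, h3 d x, h3 d y, h3 x y]
    ring

/-- A nonzero vector killed by at most six linear functionals on `ℂ⁷`. -/
lemma exists_ker (f : Fin 6 → ((Fin 7 → ℂ) →ₗ[ℂ] ℂ)) : ∃ k, k ≠ 0 ∧ ∀ i, f i k = 0 := by
  have h : (LinearMap.pi f).ker ≠ ⊥ := LinearMap.ker_ne_bot_of_finrank_lt (by simp)
  obtain ⟨k, hk, hk0⟩ := (Submodule.ne_bot_iff _).1 h
  refine ⟨k, hk0, fun i => ?_⟩
  have := congrFun (LinearMap.mem_ker.1 hk) i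
  simpa using this

end Rank
section Rank2

variable (ω : AlternatingMap ℂ (Fin 7 → ℂ) ℂ (Fin 3))

lemma caseA (hrk : ∀ v : Fin 7 → ℂ, (∀ u w : Fin 7 → ℂ, W3 ω v u w = 0) → v = 0)
    (H4 : ∀ v a b c d, Pf4 ω v a b c d = 0) (hn : ¬ ∃ v e f e2 f2, Pr2 ω v e f e2 f2) : False := by
  obtain ⟨p, hp⟩ : ∃ p : Fin 7 → ℂ, p ≠ 0 := exists_ne 0
  obtain ⟨e, f, hef⟩ := exists_pair1 ω p (fun h => hp (hrk p h))
  rcases pair1_or ω p e f hef with ⟨e2, f2, h2⟩ | h2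
  · exact hn ⟨_, _, _, _, _, h2⟩
  have hfe : W3 ω p f e = -1 := by rw [W3_swap23, hef]
  have claim : ∀ w k k', W3 ω p e k = 0 → W3 ω p f k = 0 → W3 ω p e k' = 0 → W3 ω p f k' = 0 →
      W3 ω w k k' = 0 := by
    intro w k k' h1 h3 h4 h5
    have h6 : W3 ω p k k' = 0 := by
      rw [h2, W3_swap23 ω p k, W3_swap23 ω p k f, h1, h3]; ring
    have q1 := H4 (p + (1 : ℂ) • w) e f k k'
    have q2 := H4 (p + (-1 : ℂ) • w) e f k k'
    simp only [Pf4, W3_add1, W3_smul1, hef, h1, h3, h4, h5, h6] at q1 q2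
    linear_combination (q1 - q2) / 2
  obtain ⟨k, hk0, hk⟩ := exists_ker ![F3 ω p e, F3 ω p f, F3 ω e f, 0, 0, 0]
  have k1 : W3 ω p e k = 0 := hk 0
  have k2 : W3 ω p f k = 0 := hk 1
  have k3 : W3 ω e f k = 0 := hk 2
  apply hk0
  apply hrk
  have k4 : W3 ω k e f = 0 := by rw [W3_swap12, W3_swap23, k3]; ring
  have k5 : W3 ω k f e = 0 := by rw [W3_swap23, k4]; ring
  intro a b
  have ha : ∃ (s t : ℂ) (a' : Fin 7 → ℂ), a = s • e + t • f + a' ∧ W3 ω p e a' = 0 ∧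
      W3 ω p f a' = 0 := by
    refine ⟨W3 ω p a f, - W3 ω p a e, a - W3 ω p a f • e + W3 ω p a e • f, ?_, ?_, ?_⟩
    · module
    · simp only [W3_add3, W3_sub3, W3_smul3, W3_self23, hef, W3_swap23 ω p e a]; ring
    · simp only [W3_add3, W3_sub3, W3_smul3, W3_self23, hfe, W3_swap23 ω p f a]; ring
  have hb : ∃ (s t : ℂ) (a' : Fin 7 → ℂ), b = s • e + t • f + a' ∧ W3 ω p e a' = 0 ∧
      W3 ω p f a' = 0 := by
    refine ⟨W3 ω p b f, - W3 ω p b e, b - W3 ω p b f • e + W3 ω p b e • f, ?_, ?_, ?_⟩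
    · module
    · simp only [W3_add3, W3_sub3, W3_smul3, W3_self23, hef, W3_swap23 ω p e b]; ring
    · simp only [W3_add3, W3_sub3, W3_smul3, W3_self23, hfe, W3_swap23 ω p f b]; ring
  obtain ⟨s, t, a', rfl, ha1, ha2⟩ := ha
  obtain ⟨s', t', b', rfl, hb1, hb2⟩ := hb
  have c0 : W3 ω k a' b' = 0 := claim _ _ _ ha1 ha2 hb1 hb2
  have c1 : ∀ w, W3 ω k w b' = 0 := fun w => by
    rw [W3_swap12, claim _ _ _ k1 k2 hb1 hb2, neg_zero]
  have c2 : ∀ w, W3 ω k a' w = 0 := fun w => by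
    rw [W3_swap23, W3_swap12, claim _ _ _ k1 k2 ha1 ha2]; ring
  simp only [W3_add3, W3_smul3, W3_add2, W3_smul2, W3_self23, k4, k5, c1, c2]
  ring

/-- The skew `2`-forms on the four-space, read off in ordered coordinates. -/
lemma caseB_minors (z : Fin 7 → Fin 7 → ℂ)
    (H : ∀ w u v t, W3 ω w (z 0) u * (W3 ω w (z 1) v * W3 ω w (z 2) t - W3 ω w (z 1) t * W3 ω w (z 2) v)
       - W3 ω w (z 0) v * (W3 ω w (z 1) u * W3 ω w (z 2) t - W3 ω w (z 1) t * W3 ω w (z 2) u)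
       + W3 ω w (z 0) t * (W3 ω w (z 1) u * W3 ω w (z 2) v - W3 ω w (z 1) v * W3 ω w (z 2) u) = 0)
    (h034 : W3 ω (z 0) (z 3) (z 4) = 1) (h056 : W3 ω (z 0) (z 5) (z 6) = 1)
    (h035 : W3 ω (z 0) (z 3) (z 5) = 0) (h036 : W3 ω (z 0) (z 3) (z 6) = 0)
    (h045 : W3 ω (z 0) (z 4) (z 5) = 0) (h046 : W3 ω (z 0) (z 4) (z 6) = 0)
    (s a b c d s' a' b' c' d' : ℂ)
    (h134 : W3 ω (z 1) (z 3) (z 4) = s) (h156 : W3 ω (z 1) (z 5) (z 6) = -s)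
    (h135 : W3 ω (z 1) (z 3) (z 5) = a) (h136 : W3 ω (z 1) (z 3) (z 6) = b)
    (h145 : W3 ω (z 1) (z 4) (z 5) = c) (h146 : W3 ω (z 1) (z 4) (z 6) = d)
    (h234 : W3 ω (z 2) (z 3) (z 4) = s') (h256 : W3 ω (z 2) (z 5) (z 6) = -s')
    (h235 : W3 ω (z 2) (z 3) (z 5) = a') (h236 : W3 ω (z 2) (z 3) (z 6) = b')
    (h245 : W3 ω (z 2) (z 4) (z 5) = c') (h246 : W3 ω (z 2) (z 4) (z 6) = d') :
    (a * b' = a' * b ∧ a * c' = a' * c ∧ a * d' = a' * d ∧ b * c' = b' * c ∧ b * d' = b' * d ∧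
      c * d' = c' * d) ∧ (s * a' = s' * a ∧ s * b' = s' * b ∧ s * c' = s' * c ∧
      s * d' = s' * d) := by
  have q1 := H (z 3) (z 4) (z 5) (z 6)
  have q2 := H (z 4) (z 3) (z 5) (z 6)
  have q3 := H (z 5) (z 6) (z 3) (z 4)
  have q4 := H (z 6) (z 5) (z 3) (z 4)
  have q5 := H (z 3 + z 4) (z 3) (z 5) (z 6)
  have q6 := H (z 5 + z 6) (z 5) (z 3) (z 4)
  have q7 := H (z 3 + z 5) (z 4) (z 6) (z 3)
  have q8 := H (z 3 + z 6) (z 4) (z 5) (z 3)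
  have q9 := H (z 4 + z 5) (z 3) (z 6) (z 4)
  have q10 := H (z 4 + z 6) (z 3) (z 5) (z 4)
  simp (disch := decide) only [W3_add1, W3_ord12, W3_ord23, W3_self12, W3_self23, W3_self13,
    h034, h056, h035, h036, h045, h046, h134, h156, h135, h136, h145, h146,
    h234, h256, h235, h236, h245, h246] at q1 q2 q3 q4 q5 q6 q7 q8 q9 q10
  ring_nf at q1 q2 q3 q4 q5 q6 q7 q8 q9 q10
  have r1 : a * b' = a' * b := by grind
  have r2 : a * c' = a' * c := by grind
  have r3 : b * d' = b' * d := by grind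
  have r4 : c * d' = c' * d := by grind
  have r5 : a * d' = a' * d := by grind
  have r6 : b * c' = b' * c := by grind
  refine ⟨⟨r1, r2, r5, r6, r3, r4⟩, ?_, ?_, ?_, ?_⟩ <;> grind

end Rank2
section Rank3

variable (ω : AlternatingMap ℂ (Fin 7 → ℂ) ℂ (Fin 3))

lemma caseB (hrk : ∀ v : Fin 7 → ℂ, (∀ u w : Fin 7 → ℂ, W3 ω v u w = 0) → v = 0)
    (H6 : ∀ v a b c d x y, Pf6 ω v a b c d x y = 0) (hn : ¬ ∃ z, Fr ω z)
    (p e f e2 f2 : Fin 7 → ℂ) (hpr : Pr2 ω p e f e2 f2) : False := by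
  rcases pair2_or ω p e f e2 f2 hpr with ⟨z, _, hz⟩ | h2
  · exact hn ⟨z, hz⟩
  obtain ⟨a1, a2, b1, b2, b3, b4⟩ := hpr
  have a1' : W3 ω p f e = -1 := by rw [W3_swap23, a1]
  have a2' : W3 ω p f2 e2 = -1 := by rw [W3_swap23, a2]
  have b1' : W3 ω p e2 e = 0 := by rw [W3_swap23, b1, neg_zero]
  have b2' : W3 ω p f2 e = 0 := by rw [W3_swap23, b2, neg_zero]
  have b3' : W3 ω p e2 f = 0 := by rw [W3_swap23, b3, neg_zero]
  have b4' : W3 ω p f2 f = 0 := by rw [W3_swap23, b4, neg_zero]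
  let K : (Fin 7 → ℂ) → Prop := fun k =>
    W3 ω p e k = 0 ∧ W3 ω p f k = 0 ∧ W3 ω p e2 k = 0 ∧ W3 ω p f2 k = 0
  have hKp : ∀ k, K k → ∀ w, W3 ω p k w = 0 := by
    rintro k ⟨h1, h3, h4, h5⟩ w
    rw [h2, W3_swap23 ω p k, W3_swap23 ω p k f, W3_swap23 ω p k e2, W3_swap23 ω p k f2,
      h1, h3, h4, h5]; ring
  have claim : ∀ w k k', K k → K k' → W3 ω w k k' = 0 := by
    rintro w k k' hk hk'
    have h6 := hKp k hk k'
    obtain ⟨h1, h3, h4, h5⟩ := hk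
    obtain ⟨h1', h3', h4', h5'⟩ := hk'
    have q1 := H6 (p + (1 : ℂ) • w) e f e2 f2 k k'
    have q2 := H6 (p + (-1 : ℂ) • w) e f e2 f2 k k'
    have q3 := H6 (p + (2 : ℂ) • w) e f e2 f2 k k'
    simp only [Pf6, Pf4, W3_add1, W3_smul1, a1, a2, b1, b2, b3, b4, h1, h3, h4, h5,
      h1', h3', h4', h5', h6] at q1 q2 q3
    linear_combination q1 - q2 / 3 - q3 / 6
  have hpK : K p := ⟨W3_self13 _ _ _, W3_self13 _ _ _, W3_self13 _ _ _, W3_self13 _ _ _⟩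
  have hdec : ∀ a, ∃ (s t s' t' : ℂ) (a' : Fin 7 → ℂ),
      a = s • e + t • f + s' • e2 + t' • f2 + a' ∧ K a' := by
    intro a
    refine ⟨W3 ω p a f, - W3 ω p a e, W3 ω p a f2, - W3 ω p a e2,
      a - W3 ω p a f • e + W3 ω p a e • f - W3 ω p a f2 • e2 + W3 ω p a e2 • f2,
      by module, ?_, ?_, ?_, ?_⟩
    · simp only [W3_add3, W3_sub3, W3_smul3, W3_self23, a1, b1, b2, W3_swap23 ω p e a]; ring
    · simp only [W3_add3, W3_sub3, W3_smul3, W3_self23, a1', b3, b4, W3_swap23 ω p f a]; ring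
    · simp only [W3_add3, W3_sub3, W3_smul3, W3_self23, a2, b1', b3', W3_swap23 ω p e2 a]; ring
    · simp only [W3_add3, W3_sub3, W3_smul3, W3_self23, a2', b2', b4', W3_swap23 ω p f2 a]; ring
  -- vectors of K killing the four-space vanish
  have hzero : ∀ k, K k → W3 ω k e f = 0 → W3 ω k e2 f2 = 0 → W3 ω k e e2 = 0 →
      W3 ω k e f2 = 0 → W3 ω k f e2 = 0 → W3 ω k f f2 = 0 → k = 0 := by
    intro k hk g1 g2 g3 g4 g5 g6
    apply hrk
    intro a b
    have g1' : W3 ω k f e = 0 := by rw [W3_swap23, g1, neg_zero]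
    have g2' : W3 ω k f2 e2 = 0 := by rw [W3_swap23, g2, neg_zero]
    have g3' : W3 ω k e2 e = 0 := by rw [W3_swap23, g3, neg_zero]
    have g4' : W3 ω k f2 e = 0 := by rw [W3_swap23, g4, neg_zero]
    have g5' : W3 ω k e2 f = 0 := by rw [W3_swap23, g5, neg_zero]
    have g6' : W3 ω k f2 f = 0 := by rw [W3_swap23, g6, neg_zero]
    obtain ⟨s, t, s', t', a', rfl, ha⟩ := hdec a
    obtain ⟨s2, t2, s2', t2', b', rfl, hb⟩ := hdec b
    have c1 : ∀ w, W3 ω k w b' = 0 := fun w => by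
      rw [W3_swap12, claim _ _ _ hk hb, neg_zero]
    have c2 : ∀ w, W3 ω k a' w = 0 := fun w => by
      rw [W3_swap23, W3_swap12, claim _ _ _ hk ha]; ring
    simp only [W3_add3, W3_smul3, W3_add2, W3_smul2, W3_self23, c1, c2, g1, g2, g3, g4, g5, g6,
      g1', g2', g3', g4', g5', g6']
    ring
  have hrot : ∀ u v w, W3 ω u v w = W3 ω v w u := fun u v w => by
    rw [W3_swap12, W3_swap23]; ring
  -- find such vectors with one more linear condition
  have hfind : ∀ φ : (Fin 7 → ℂ) →ₗ[ℂ] ℂ, ∃ k, k ≠ 0 ∧ K k ∧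
      W3 ω k e2 f2 = - W3 ω k e f ∧ φ k = 0 := by
    intro φ
    obtain ⟨k, hk0, hk⟩ := exists_ker ![F3 ω p e, F3 ω p f, F3 ω p e2, F3 ω p f2,
      F3 ω e f + F3 ω e2 f2, φ]
    refine ⟨k, hk0, ⟨hk 0, hk 1, hk 2, hk 3⟩, ?_, hk 5⟩
    have h4 : W3 ω e f k + W3 ω e2 f2 k = 0 := hk 4
    rw [hrot k, hrot k]
    linear_combination h4
  obtain ⟨k1, hk10, hk1, htr1, -⟩ := hfind 0
  have hmin : ∀ k2, K k2 → W3 ω k2 e2 f2 = - W3 ω k2 e f → _ := fun k2 hk2 htr2 =>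
    caseB_minors ω ![p, k1, k2, e, f, e2, f2] (by
      intro w u v t
      have q := H6 w p k1 k2 u v t
      simp only [Pf6, Pf4, claim w _ _ hpK hk1, claim w _ _ hpK hk2, claim w _ _ hk1 hk2] at q
      simp
      linear_combination -q) a1 a2 b1 b2 b3 b4
      (W3 ω k1 e f) (W3 ω k1 e e2) (W3 ω k1 e f2) (W3 ω k1 f e2) (W3 ω k1 f f2)
      (W3 ω k2 e f) (W3 ω k2 e e2) (W3 ω k2 e f2) (W3 ω k2 f e2) (W3 ω k2 f f2)
      rfl htr1 rfl rfl rfl rfl rfl htr2 rfl rfl rfl rfl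
  have key : ∀ u v, (∀ k2, K k2 → W3 ω k2 e2 f2 = - W3 ω k2 e f → W3 ω k2 u v = 0 →
      W3 ω k2 e f = 0 ∧ W3 ω k2 e e2 = 0 ∧ W3 ω k2 e f2 = 0 ∧ W3 ω k2 f e2 = 0 ∧
        W3 ω k2 f f2 = 0) → False := by
    intro u v huv
    obtain ⟨k2, h0, hk2, htr2, h3⟩ := hfind (F3 ω u v)
    rw [F3_apply, ← hrot] at h3
    obtain ⟨g1, g2, g3, g4, g5⟩ := huv k2 hk2 htr2 h3
    exact h0 (hzero k2 hk2 g1 (by rw [htr2, g1, neg_zero]) g2 g3 g4 g5)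
  by_cases d1 : W3 ω k1 e f = 0
  · by_cases d2 : W3 ω k1 e e2 = 0
    · by_cases d3 : W3 ω k1 e f2 = 0
      · by_cases d4 : W3 ω k1 f e2 = 0
        · by_cases d5 : W3 ω k1 f f2 = 0
          · exact hk10 (hzero k1 hk1 d1 (by rw [htr1, d1, neg_zero]) d2 d3 d4 d5)
          · refine key f f2 fun k2 hk2 htr2 h3 => ?_
            obtain ⟨⟨m1, m2, m3, m4, m5, m6⟩, m7, m8, m9, m10⟩ := hmin k2 hk2 htr2
            refine ⟨?_, ?_, ?_, ?_, h3⟩ <;> apply mul_right_cancel₀ d5 <;> grind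
        · refine key f e2 fun k2 hk2 htr2 h3 => ?_
          obtain ⟨⟨m1, m2, m3, m4, m5, m6⟩, m7, m8, m9, m10⟩ := hmin k2 hk2 htr2
          refine ⟨?_, ?_, ?_, h3, ?_⟩ <;> apply mul_right_cancel₀ d4 <;> grind
      · refine key e f2 fun k2 hk2 htr2 h3 => ?_
        obtain ⟨⟨m1, m2, m3, m4, m5, m6⟩, m7, m8, m9, m10⟩ := hmin k2 hk2 htr2
        refine ⟨?_, ?_, h3, ?_, ?_⟩ <;> apply mul_right_cancel₀ d3 <;> grind
    · refine key e e2 fun k2 hk2 htr2 h3 => ?_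
      obtain ⟨⟨m1, m2, m3, m4, m5, m6⟩, m7, m8, m9, m10⟩ := hmin k2 hk2 htr2
      refine ⟨?_, h3, ?_, ?_, ?_⟩ <;> apply mul_right_cancel₀ d2 <;> grind
  · refine key e f fun k2 hk2 htr2 h3 => ?_
    obtain ⟨⟨m1, m2, m3, m4, m5, m6⟩, m7, m8, m9, m10⟩ := hmin k2 hk2 htr2
    refine ⟨h3, ?_, ?_, ?_, ?_⟩ <;> apply mul_right_cancel₀ d1 <;> grind

theorem exists_frame (hrk : ∀ v : Fin 7 → ℂ, (∀ u w : Fin 7 → ℂ, W3 ω v u w = 0) → v = 0) :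
    ∃ z, Fr ω z := by
  by_contra hn
  have H6 : ∀ v a b c d x y, Pf6 ω v a b c d x y = 0 := by
    intro v a b c d x y
    by_contra h
    obtain ⟨z, _, hz⟩ := exists_fr ω v a b c d x y h
    exact hn ⟨z, hz⟩
  by_cases h2 : ∃ v e f e2 f2, Pr2 ω v e f e2 f2
  · obtain ⟨v, e, f, e2, f2, h⟩ := h2
    exact caseB ω hrk H6 hn v e f e2 f2 h
  · refine caseA ω hrk ?_ h2
    intro v a b c d
    by_contra h
    obtain ⟨e, f, e2, f2, h⟩ := exists_pr2 ω v a b c d h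
    exact h2 ⟨v, e, f, e2, f2, h⟩

end Rank3
section Prim

variable {E : Type*} [AddCommGroup E] [Module ℂ E] (ω : AlternatingMap ℂ E ℂ (Fin 3))

structure FP (z : Fin 7 → E) : Prop extends Fr ω z where
  p1 : W3 ω (z 1) (z 2) (z 5) + W3 ω (z 1) (z 3) (z 6) = 0
  p2 : W3 ω (z 2) (z 3) (z 6) - W3 ω (z 1) (z 2) (z 4) = 0
  p3 : W3 ω (z 1) (z 3) (z 4) + W3 ω (z 2) (z 3) (z 5) = 0
  p4 : W3 ω (z 2) (z 4) (z 5) + W3 ω (z 3) (z 4) (z 6) = 0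
  p5 : W3 ω (z 1) (z 4) (z 5) - W3 ω (z 3) (z 5) (z 6) = 0
  p6 : W3 ω (z 1) (z 4) (z 6) + W3 ω (z 2) (z 5) (z 6) = 0

lemma exists_prim (z : Fin 7 → E) (h : Fr ω z) : ∃ z, FP ω z := by
  obtain ⟨h012, h013, h014, h015, h016, h023, h024, h025, h026, h034, h035, h036, h045, h046,
    h056⟩ := h
  refine ⟨![z 0, z 1 + (-(W3 ω (z 1) (z 2) (z 5) + W3 ω (z 1) (z 3) (z 6)) / 2) • z 0,
    z 2 + (-(W3 ω (z 2) (z 3) (z 6) - W3 ω (z 1) (z 2) (z 4)) / 2) • z 0,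
    z 3 + ((W3 ω (z 1) (z 3) (z 4) + W3 ω (z 2) (z 3) (z 5)) / 2) • z 0,
    z 4 + ((W3 ω (z 2) (z 4) (z 5) + W3 ω (z 3) (z 4) (z 6)) / 2) • z 0,
    z 5 + (-(W3 ω (z 1) (z 4) (z 5) - W3 ω (z 3) (z 5) (z 6)) / 2) • z 0,
    z 6 + (-(W3 ω (z 1) (z 4) (z 6) + W3 ω (z 2) (z 5) (z 6)) / 2) • z 0], ⟨?_, ?_, ?_, ?_, ?_, ?_, ?_, ?_, ?_, ?_, ?_, ?_, ?_, ?_, ?_⟩, ?_, ?_, ?_,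
    ?_, ?_, ?_⟩
  all_goals
    simp (disch := decide) only [Matrix.cons_val, W3_add1, W3_add2, W3_add3, W3_smul1, W3_smul2,
      W3_smul3, W3_self12, W3_self23, W3_self13, W3_ord12, W3_ord23, h012, h013, h014, h015, h016,
      h023, h024, h025, h026, h034, h035, h036, h045, h046, h056] <;> ring

lemma move_s1 (z : Fin 7 → E) (h : FP ω z) :
    FP ω ![z 0, z 4, z 2, z 3, - z 1, z 5, z 6] := by
  obtain ⟨⟨h012, h013, h014, h015, h016, h023, h024, h025, h026, h034, h035, h036, h045, h046,
    h056⟩, p1, p2, p3, p4, p5, p6⟩ := h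
  refine ⟨⟨?_, ?_, ?_, ?_, ?_, ?_, ?_, ?_, ?_, ?_, ?_, ?_, ?_, ?_, ?_⟩, ?_, ?_, ?_, ?_, ?_, ?_⟩
  all_goals
    simp (disch := decide) only [Matrix.cons_val, W3_neg1, W3_neg2, W3_neg3,
      W3_self12, W3_self23, W3_self13, W3_ord12, W3_ord23, h012, h013, h014, h015, h016,
      h023, h024, h025, h026, h034, h035, h036, h045, h046, h056] <;> grind

lemma move_s2 (z : Fin 7 → E) (h : FP ω z) :
    FP ω ![z 0, z 1, z 5, z 3, z 4, - z 2, z 6] := by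
  obtain ⟨⟨h012, h013, h014, h015, h016, h023, h024, h025, h026, h034, h035, h036, h045, h046,
    h056⟩, p1, p2, p3, p4, p5, p6⟩ := h
  refine ⟨⟨?_, ?_, ?_, ?_, ?_, ?_, ?_, ?_, ?_, ?_, ?_, ?_, ?_, ?_, ?_⟩, ?_, ?_, ?_, ?_, ?_, ?_⟩
  all_goals
    simp (disch := decide) only [Matrix.cons_val, W3_neg1, W3_neg2, W3_neg3,
      W3_self12, W3_self23, W3_self13, W3_ord12, W3_ord23, h012, h013, h014, h015, h016,
      h023, h024, h025, h026, h034, h035, h036, h045, h046, h056] <;> grind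

lemma move_s3 (z : Fin 7 → E) (h : FP ω z) :
    FP ω ![z 0, z 1, z 2, z 6, z 4, z 5, - z 3] := by
  obtain ⟨⟨h012, h013, h014, h015, h016, h023, h024, h025, h026, h034, h035, h036, h045, h046,
    h056⟩, p1, p2, p3, p4, p5, p6⟩ := h
  refine ⟨⟨?_, ?_, ?_, ?_, ?_, ?_, ?_, ?_, ?_, ?_, ?_, ?_, ?_, ?_, ?_⟩, ?_, ?_, ?_, ?_, ?_, ?_⟩
  all_goals
    simp (disch := decide) only [Matrix.cons_val, W3_neg1, W3_neg2, W3_neg3,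
      W3_self12, W3_self23, W3_self13, W3_ord12, W3_ord23, h012, h013, h014, h015, h016,
      h023, h024, h025, h026, h034, h035, h036, h045, h046, h056] <;> grind

/-- Cyclic rotation of the three planes. -/
lemma move_rot (z : Fin 7 → E) (h : FP ω z) :
    FP ω ![z 0, z 2, z 3, z 1, z 5, z 6, z 4] := by
  obtain ⟨⟨h012, h013, h014, h015, h016, h023, h024, h025, h026, h034, h035, h036, h045, h046,
    h056⟩, p1, p2, p3, p4, p5, p6⟩ := h
  refine ⟨⟨?_, ?_, ?_, ?_, ?_, ?_, ?_, ?_, ?_, ?_, ?_, ?_, ?_, ?_, ?_⟩, ?_, ?_, ?_, ?_, ?_, ?_⟩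
  all_goals
    simp (disch := decide) only [Matrix.cons_val,
      W3_self12, W3_self23, W3_self13, W3_ord12, W3_ord23, h012, h013, h014, h015, h016,
      h023, h024, h025, h026, h034, h035, h036, h045, h046, h056] <;> grind

lemma move_t (z : Fin 7 → E) (h : FP ω z) :
    FP ω ![z 0, z 1 + z 2, z 2, z 3, z 4, z 5 - z 4, z 6] := by
  obtain ⟨⟨h012, h013, h014, h015, h016, h023, h024, h025, h026, h034, h035, h036, h045, h046,
    h056⟩, p1, p2, p3, p4, p5, p6⟩ := h
  refine ⟨⟨?_, ?_, ?_, ?_, ?_, ?_, ?_, ?_, ?_, ?_, ?_, ?_, ?_, ?_, ?_⟩, ?_, ?_, ?_, ?_, ?_, ?_⟩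
  all_goals
    simp (disch := decide) only [Matrix.cons_val, W3_add1, W3_add2, W3_add3, W3_sub1, W3_sub2,
      W3_sub3, W3_self12, W3_self23, W3_self13, W3_ord12, W3_ord23, h012, h013, h014, h015, h016,
      h023, h024, h025, h026, h034, h035, h036, h045, h046, h056] <;> grind

structure Eight (z : Fin 7 → E) : Prop where
  h123 : W3 ω (z 1) (z 2) (z 3) = 0
  h126 : W3 ω (z 1) (z 2) (z 6) = 0
  h135 : W3 ω (z 1) (z 3) (z 5) = 0
  h156 : W3 ω (z 1) (z 5) (z 6) = 0
  h234 : W3 ω (z 2) (z 3) (z 4) = 0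
  h246 : W3 ω (z 2) (z 4) (z 6) = 0
  h345 : W3 ω (z 3) (z 4) (z 5) = 0
  h456 : W3 ω (z 4) (z 5) (z 6) = 0

lemma eight (H : ∀ z, FP ω z → W3 ω (z 1) (z 2) (z 3) = 0) (z : Fin 7 → E) (h : FP ω z) :
    Eight ω z := by
  have q1 := H _ (move_s1 ω _ h)
  have q2 := H _ (move_s2 ω _ h)
  have q3 := H _ (move_s3 ω _ h)
  have q12 := H _ (move_s2 ω _ (move_s1 ω _ h))
  have q13 := H _ (move_s3 ω _ (move_s1 ω _ h))
  have q23 := H _ (move_s3 ω _ (move_s2 ω _ h))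
  have q123 := H _ (move_s3 ω _ (move_s2 ω _ (move_s1 ω _ h)))
  simp (disch := decide) only [Matrix.cons_val, W3_ord12, W3_ord23, neg_neg, neg_eq_zero]
    at q1 q2 q3 q12 q13 q23 q123
  exact ⟨H z h, q3, q2, q23, q1, q13, q12, q123⟩

lemma four (H : ∀ z, FP ω z → W3 ω (z 1) (z 2) (z 3) = 0) (z : Fin 7 → E) (h : FP ω z) :
    W3 ω (z 1) (z 3) (z 4) = 0 ∧ W3 ω (z 2) (z 3) (z 5) = 0 ∧
    W3 ω (z 1) (z 4) (z 6) = 0 ∧ W3 ω (z 2) (z 5) (z 6) = 0 := by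
  have q := eight ω H _ h
  have q' := eight ω H _ (move_t ω _ h)
  obtain ⟨h123, h126, h135, h156, h234, h246, h345, h456⟩ := q
  have q2 := q'.h135
  have q3 := q'.h156
  simp (disch := decide) only [Matrix.cons_val, W3_add1, W3_add2, W3_add3, W3_sub1, W3_sub2,
      W3_sub3, W3_self12, W3_self23, W3_self13, W3_ord12, W3_ord23, h123, h126, h135, h156, h234,
      h246, h345, h456] at q2 q3
  have p3 := h.p3
  have p6 := h.p6
  refine ⟨?_, ?_, ?_, ?_⟩ <;> grind

/-- If no primitive frame has nonzero leading coefficient, all coefficients vanish. -/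
lemma all_zero (H : ∀ z, FP ω z → W3 ω (z 1) (z 2) (z 3) = 0) (z : Fin 7 → E) (h : FP ω z) :
    (W3 ω (z 1) (z 2) (z 3) = 0 ∧ W3 ω (z 1) (z 2) (z 4) = 0 ∧ W3 ω (z 1) (z 2) (z 5) = 0 ∧
     W3 ω (z 1) (z 2) (z 6) = 0 ∧ W3 ω (z 1) (z 3) (z 4) = 0 ∧ W3 ω (z 1) (z 3) (z 5) = 0 ∧
     W3 ω (z 1) (z 3) (z 6) = 0 ∧ W3 ω (z 1) (z 4) (z 5) = 0 ∧ W3 ω (z 1) (z 4) (z 6) = 0 ∧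
     W3 ω (z 1) (z 5) (z 6) = 0) ∧
    (W3 ω (z 2) (z 3) (z 4) = 0 ∧ W3 ω (z 2) (z 3) (z 5) = 0 ∧ W3 ω (z 2) (z 3) (z 6) = 0 ∧
     W3 ω (z 2) (z 4) (z 5) = 0 ∧ W3 ω (z 2) (z 4) (z 6) = 0 ∧ W3 ω (z 2) (z 5) (z 6) = 0 ∧
     W3 ω (z 3) (z 4) (z 5) = 0 ∧ W3 ω (z 3) (z 4) (z 6) = 0 ∧ W3 ω (z 3) (z 5) (z 6) = 0 ∧
     W3 ω (z 4) (z 5) (z 6) = 0) := by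
  obtain ⟨h123, h126, h135, h156, h234, h246, h345, h456⟩ := eight ω H z h
  obtain ⟨a1, a2, a3, a4⟩ := four ω H z h
  obtain ⟨b1, b2, b3, b4⟩ := four ω H _ (move_rot ω _ h)
  obtain ⟨c1, c2, c3, c4⟩ := four ω H _ (move_rot ω _ (move_rot ω _ h))
  simp (disch := decide) only [Matrix.cons_val, W3_ord12, W3_ord23, neg_neg, neg_eq_zero]
    at b1 b2 b3 b4 c1 c2 c3 c4
  exact ⟨⟨h123, c2, b1, h126, a1, h135, b2, c4, a3, h156⟩,
    h234, a2, c1, b3, h246, a4, h345, b4, c3, h456⟩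

end Prim
section Norm

variable {E : Type*} [AddCommGroup E] [Module ℂ E] (ω : AlternatingMap ℂ E ℂ (Fin 3))

/-- Frames with vanishing `A`-part and symmetric `B`-part. -/
structure FB (z : Fin 7 → E) : Prop extends Fr ω z where
  a : W3 ω (z 1) (z 2) (z 3) ≠ 0
  h124 : W3 ω (z 1) (z 2) (z 4) = 0
  h125 : W3 ω (z 1) (z 2) (z 5) = 0
  h126 : W3 ω (z 1) (z 2) (z 6) = 0
  h134 : W3 ω (z 1) (z 3) (z 4) = 0
  h135 : W3 ω (z 1) (z 3) (z 5) = 0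
  h136 : W3 ω (z 1) (z 3) (z 6) = 0
  h234 : W3 ω (z 2) (z 3) (z 4) = 0
  h235 : W3 ω (z 2) (z 3) (z 5) = 0
  h236 : W3 ω (z 2) (z 3) (z 6) = 0
  p4 : W3 ω (z 2) (z 4) (z 5) = - W3 ω (z 3) (z 4) (z 6)
  p5 : W3 ω (z 1) (z 4) (z 5) = W3 ω (z 3) (z 5) (z 6)
  p6 : W3 ω (z 1) (z 4) (z 6) = - W3 ω (z 2) (z 5) (z 6)

lemma exists_FB (z : Fin 7 → E) (h : FP ω z) (ha : W3 ω (z 1) (z 2) (z 3) ≠ 0) :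
    ∃ z, FB ω z := by
  obtain ⟨⟨h012, h013, h014, h015, h016, h023, h024, h025, h026, h034, h035, h036, h045, h046,
    h056⟩, p1, p2, p3, p4, p5, p6⟩ := h
  obtain ⟨a, haa⟩ : ∃ a, a = W3 ω (z 1) (z 2) (z 3) := ⟨_, rfl⟩
  rw [← haa] at ha
  have key : ∀ b : ℂ, ∃ t, b = a * t := fun b => ⟨b / a, by field_simp⟩
  obtain ⟨T33, h126⟩ := key (W3 ω (z 1) (z 2) (z 6))
  obtain ⟨T23, h125⟩ := key (W3 ω (z 1) (z 2) (z 5))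
  obtain ⟨T13, h124⟩ := key (W3 ω (z 1) (z 2) (z 4))
  obtain ⟨T12, h235⟩ := key (W3 ω (z 2) (z 3) (z 5))
  obtain ⟨T22, h135⟩ := key (- W3 ω (z 1) (z 3) (z 5))
  obtain ⟨T11, h234⟩ := key (W3 ω (z 2) (z 3) (z 4))
  have h135' : W3 ω (z 1) (z 3) (z 5) = - a * T22 := by linear_combination - h135
  have h136 : W3 ω (z 1) (z 3) (z 6) = - a * T23 := by linear_combination p1 - h125
  have h134 : W3 ω (z 1) (z 3) (z 4) = - a * T12 := by linear_combination p3 - h235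
  have h236 : W3 ω (z 2) (z 3) (z 6) = a * T13 := by linear_combination p2 + h124
  refine ⟨![z 0, z 1, z 2, z 3, z 4 - (T11 • z 1 + T12 • z 2 + T13 • z 3),
    z 5 - (T12 • z 1 + T22 • z 2 + T23 • z 3), z 6 - (T13 • z 1 + T23 • z 2 + T33 • z 3)],
    ⟨?_, ?_, ?_, ?_, ?_, ?_, ?_, ?_, ?_, ?_, ?_, ?_, ?_, ?_, ?_⟩, ?_, ?_, ?_, ?_, ?_, ?_, ?_, ?_,
    ?_, ?_, ?_, ?_, ?_⟩
  case refine_16 => simpa [← haa] using ha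
  all_goals
    simp (disch := decide) only [Matrix.cons_val, W3_add1, W3_add2, W3_add3, W3_smul1, W3_smul2,
      W3_smul3, W3_sub1, W3_sub2, W3_sub3,
      W3_self12, W3_self23, W3_self13, W3_ord12, W3_ord23, h012, h013, h014, h015, h016,
      h023, h024, h025, h026, h034, h035, h036, h045, h046, h056, h126, h125, h124, h235, h135',
      h234, h136, h134, h236, ← haa]
  case refine_26 => linear_combination p4
  case refine_27 => linear_combination p5
  case refine_28 => linear_combination p6
  all_goals ring

/-- Simultaneous diagonalization of a symmetric `3 × 3` matrix by congruence. -/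
lemma diag3 (B : Matrix (Fin 3) (Fin 3) ℂ) (hB : B.IsSymm) :
    ∃ g : Matrix (Fin 3) (Fin 3) ℂ, g.det ≠ 0 ∧ ∀ i j, i ≠ j → (g * B * g.transpose) i j = 0 := by
  have hs : LinearMap.IsSymm (Matrix.toBilin' B) := by
    constructor
    intro x y
    simp only [Matrix.toBilin'_apply', RingHom.id_apply]
    rw [Matrix.dotProduct_mulVec, ← Matrix.mulVec_transpose, hB.eq, dotProduct_comm]
  obtain ⟨v, hv⟩ := LinearMap.BilinForm.exists_orthogonal_basis (B := Matrix.toBilin' B) hs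
  have hf : Module.finrank ℂ (Fin 3 → ℂ) = 3 := by simp
  let v' := v.reindex (finCongr hf)
  refine ⟨Matrix.of v', ?_, ?_⟩
  · have := Matrix.linearIndependent_rows_iff_isUnit.1 (show LinearIndependent ℂ (Matrix.of v').row from v'.linearIndependent)
    rw [Matrix.isUnit_iff_isUnit_det] at this
    exact this.ne_zero
  · intro i j hij
    have := hv (i := (finCongr hf).symm i) (j := (finCongr hf).symm j) (by simpa using hij)
    simp only [Function.onFun] at this
    have e : (Matrix.of v' * B * (Matrix.of v').transpose) i j
      = Matrix.toBilin' B (v' i) (v' j) := by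
      simp only [Matrix.toBilin'_apply', Matrix.mul_assoc, Matrix.mul_apply, dotProduct,
        Matrix.mulVec, Matrix.transpose_apply, Matrix.of_apply, Fin.sum_univ_three]
      ring
    rw [e]
    simpa [v'] using this

/-- Tensor frames. -/
structure TF (z : Fin 7 → E) (t1 t2 t3 t4 t5 t6 t7 t8 : ℂ) : Prop extends Fr ω z where
  h123 : W3 ω (z 1) (z 2) (z 3) = t1
  h126 : W3 ω (z 1) (z 2) (z 6) = t2
  h135 : W3 ω (z 1) (z 3) (z 5) = t3
  h156 : W3 ω (z 1) (z 5) (z 6) = t4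
  h234 : W3 ω (z 2) (z 3) (z 4) = t5
  h246 : W3 ω (z 2) (z 4) (z 6) = t6
  h345 : W3 ω (z 3) (z 4) (z 5) = t7
  h456 : W3 ω (z 4) (z 5) (z 6) = t8
  h124 : W3 ω (z 1) (z 2) (z 4) = 0
  h125 : W3 ω (z 1) (z 2) (z 5) = 0
  h134 : W3 ω (z 1) (z 3) (z 4) = 0
  h136 : W3 ω (z 1) (z 3) (z 6) = 0
  h145 : W3 ω (z 1) (z 4) (z 5) = 0
  h146 : W3 ω (z 1) (z 4) (z 6) = 0
  h235 : W3 ω (z 2) (z 3) (z 5) = 0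
  h236 : W3 ω (z 2) (z 3) (z 6) = 0
  h245 : W3 ω (z 2) (z 4) (z 5) = 0
  h256 : W3 ω (z 2) (z 5) (z 6) = 0
  h346 : W3 ω (z 3) (z 4) (z 6) = 0
  h356 : W3 ω (z 3) (z 5) (z 6) = 0

lemma exists_TF (z : Fin 7 → E) (h : FB ω z) :
    ∃ z a d1 d2 d3 b, TF ω z a 0 0 d1 0 d2 d3 b ∧ a ≠ 0 := by
  obtain ⟨⟨h012, h013, h014, h015, h016, h023, h024, h025, h026, h034, h035, h036, h045, h046,
    h056⟩, ha, h124, h125, h126, h134, h135, h136, h234, h235, h236, p4, p5, p6⟩ := h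
  obtain ⟨a, haa⟩ : ∃ a, W3 ω (z 1) (z 2) (z 3) = a := ⟨_, rfl⟩
  obtain ⟨B11, h156⟩ : ∃ a, W3 ω (z 1) (z 5) (z 6) = a := ⟨_, rfl⟩
  obtain ⟨B22', h246⟩ : ∃ a, W3 ω (z 2) (z 4) (z 6) = a := ⟨_, rfl⟩
  obtain ⟨B33, h345⟩ : ∃ a, W3 ω (z 3) (z 4) (z 5) = a := ⟨_, rfl⟩
  obtain ⟨B12, h256⟩ : ∃ a, W3 ω (z 2) (z 5) (z 6) = a := ⟨_, rfl⟩
  obtain ⟨B13, h356⟩ : ∃ a, W3 ω (z 3) (z 5) (z 6) = a := ⟨_, rfl⟩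
  obtain ⟨B23', h346⟩ : ∃ a, W3 ω (z 3) (z 4) (z 6) = a := ⟨_, rfl⟩
  rw [h346] at p4
  rw [h356] at p5
  rw [h256] at p6
  rw [haa] at ha
  obtain ⟨g, hg, hd⟩ := diag3 !![B11, B12, B13; B12, -B22', -B23'; B13, -B23', B33] (by
    ext i j; fin_cases i <;> fin_cases j <;> rfl)
  have d12 := hd 0 1 (by decide)
  have d13 := hd 0 2 (by decide)
  have d23 := hd 1 2 (by decide)
  clear hd
  simp only [Matrix.mul_apply, Fin.sum_univ_three, Matrix.of_apply, Matrix.cons_val, 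
    Matrix.transpose_apply] at d12 d13 d23
  obtain ⟨D, hD⟩ : ∃ D, D = g.det := ⟨_, rfl⟩
  rw [← hD] at hg
  rw [Matrix.det_fin_three] at hD
  obtain ⟨I, hI⟩ : ∃ I, I * D = 1 := ⟨D⁻¹, by field_simp⟩
  generalize g 0 0 = g11 at *
  generalize g 0 1 = g12 at *
  generalize g 0 2 = g13 at *
  generalize g 1 0 = g21 at *
  generalize g 1 1 = g22 at *
  generalize g 1 2 = g23 at *
  generalize g 2 0 = g31 at *
  generalize g 2 1 = g32 at *
  generalize g 2 2 = g33 at *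
  refine ⟨![I • z 0, g11 • z 1 + g12 • z 2 + g13 • z 3, g21 • z 1 + g22 • z 2 + g23 • z 3,
    g31 • z 1 + g32 • z 2 + g33 • z 3,
    (g22 * g33 - g23 * g32) • z 4 + (g23 * g31 - g21 * g33) • z 5 + (g21 * g32 - g22 * g31) • z 6,
    (g32 * g13 - g33 * g12) • z 4 + (g33 * g11 - g31 * g13) • z 5 + (g31 * g12 - g32 * g11) • z 6,
    (g12 * g23 - g13 * g22) • z 4 + (g13 * g21 - g11 * g23) • z 5 + (g11 * g22 - g12 * g21) • z 6],
    D * a, _, _, _, _, ⟨⟨?_, ?_, ?_, ?_, ?_, ?_, ?_, ?_, ?_, ?_, ?_, ?_, ?_, ?_, ?_⟩,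
    ?_, ?_, ?_, rfl, ?_, rfl, rfl, rfl, ?_, ?_, ?_, ?_, ?_, ?_, ?_, ?_, ?_, ?_, ?_, ?_⟩,
    mul_ne_zero hg ha⟩
  all_goals
    simp (disch := decide) only [Matrix.cons_val, W3_add1, W3_add2, W3_add3, W3_smul1, W3_smul2,
      W3_smul3, W3_sub1, W3_sub2, W3_sub3,
      W3_self12, W3_self23, W3_self13, W3_ord12, W3_ord23, h012, h013, h014, h015, h016,
      h023, h024, h025, h026, h034, h035, h036, h045, h046, h056, h126, h125, h124, h235, h135,
      h234, h136, h134, h236, haa, p4, p5, p6, h156, h246, h345, h256, h356, h346]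
  all_goals first
    | ring1
    | linear_combination hI - I * hD
    | linear_combination -a * hD
    | linear_combination (g11 * g22 * g33 - g11 * g23 * g32 - g12 * g21 * g33 + g12 * g23 * g31 + g13 * g21 * g32 - g13 * g22 * g31) * d12
    | linear_combination -(g11 * g22 * g33 - g11 * g23 * g32 - g12 * g21 * g33 + g12 * g23 * g31 + g13 * g21 * g32 - g13 * g22 * g31) * d12
    | linear_combination (g11 * g22 * g33 - g11 * g23 * g32 - g12 * g21 * g33 + g12 * g23 * g31 + g13 * g21 * g32 - g13 * g22 * g31) * d13
    | linear_combination -(g11 * g22 * g33 - g11 * g23 * g32 - g12 * g21 * g33 + g12 * g23 * g31 + g13 * g21 * g32 - g13 * g22 * g31) * d13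
    | linear_combination (g11 * g22 * g33 - g11 * g23 * g32 - g12 * g21 * g33 + g12 * g23 * g31 + g13 * g21 * g32 - g13 * g22 * g31) * d23
    | linear_combination -(g11 * g22 * g33 - g11 * g23 * g32 - g12 * g21 * g33 + g12 * g23 * g31 + g13 * g21 * g32 - g13 * g22 * g31) * d23

end Norm
section Move

variable {E : Type*} [AddCommGroup E] [Module ℂ E] (ω : AlternatingMap ℂ E ℂ (Fin 3))

/-- Changing bases in the three planes. -/
lemma TF_move {z : Fin 7 → E} {t1 t2 t3 t4 t5 t6 t7 t8 : ℂ} (h : TF ω z t1 t2 t3 t4 t5 t6 t7 t8)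
    (c α1 β1 γ1 δ1 α2 β2 γ2 δ2 α3 β3 γ3 δ3 s1 s2 s3 s4 s5 s6 s7 s8 : ℂ)
    (e1 : c * (α1 * δ1 - β1 * γ1) = 1) (e2 : c * (α2 * δ2 - β2 * γ2) = 1)
    (e3 : c * (α3 * δ3 - β3 * γ3) = 1)
    (q1 : α1 * α2 * α3 * t1 + α1 * α2 * β3 * t2 - α1 * β2 * α3 * t3 + α1 * β2 * β3 * t4
      + β1 * α2 * α3 * t5 - β1 * α2 * β3 * t6 + β1 * β2 * α3 * t7 + β1 * β2 * β3 * t8 = s1)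
    (q2 : α1 * α2 * γ3 * t1 + α1 * α2 * δ3 * t2 - α1 * β2 * γ3 * t3 + α1 * β2 * δ3 * t4
      + β1 * α2 * γ3 * t5 - β1 * α2 * δ3 * t6 + β1 * β2 * γ3 * t7 + β1 * β2 * δ3 * t8 = s2)
    (q3 : α1 * γ2 * α3 * t1 + α1 * γ2 * β3 * t2 - α1 * δ2 * α3 * t3 + α1 * δ2 * β3 * t4
      + β1 * γ2 * α3 * t5 - β1 * γ2 * β3 * t6 + β1 * δ2 * α3 * t7 + β1 * δ2 * β3 * t8 = -s3)
    (q4 : α1 * γ2 * γ3 * t1 + α1 * γ2 * δ3 * t2 - α1 * δ2 * γ3 * t3 + α1 * δ2 * δ3 * t4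
      + β1 * γ2 * γ3 * t5 - β1 * γ2 * δ3 * t6 + β1 * δ2 * γ3 * t7 + β1 * δ2 * δ3 * t8 = s4)
    (q5 : γ1 * α2 * α3 * t1 + γ1 * α2 * β3 * t2 - γ1 * β2 * α3 * t3 + γ1 * β2 * β3 * t4
      + δ1 * α2 * α3 * t5 - δ1 * α2 * β3 * t6 + δ1 * β2 * α3 * t7 + δ1 * β2 * β3 * t8 = s5)
    (q6 : γ1 * α2 * γ3 * t1 + γ1 * α2 * δ3 * t2 - γ1 * β2 * γ3 * t3 + γ1 * β2 * δ3 * t4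
      + δ1 * α2 * γ3 * t5 - δ1 * α2 * δ3 * t6 + δ1 * β2 * γ3 * t7 + δ1 * β2 * δ3 * t8 = -s6)
    (q7 : γ1 * γ2 * α3 * t1 + γ1 * γ2 * β3 * t2 - γ1 * δ2 * α3 * t3 + γ1 * δ2 * β3 * t4
      + δ1 * γ2 * α3 * t5 - δ1 * γ2 * β3 * t6 + δ1 * δ2 * α3 * t7 + δ1 * δ2 * β3 * t8 = s7)
    (q8 : γ1 * γ2 * γ3 * t1 + γ1 * γ2 * δ3 * t2 - γ1 * δ2 * γ3 * t3 + γ1 * δ2 * δ3 * t4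
      + δ1 * γ2 * γ3 * t5 - δ1 * γ2 * δ3 * t6 + δ1 * δ2 * γ3 * t7 + δ1 * δ2 * δ3 * t8 = s8) :
    TF ω ![c • z 0, α1 • z 1 + β1 • z 4, α2 • z 2 + β2 • z 5, α3 • z 3 + β3 • z 6,
      γ1 • z 1 + δ1 • z 4, γ2 • z 2 + δ2 • z 5, γ3 • z 3 + δ3 • z 6] s1 s2 s3 s4 s5 s6 s7 s8 := by
  obtain ⟨⟨h012, h013, h014, h015, h016, h023, h024, h025, h026, h034, h035, h036, h045, h046,
    h056⟩, h123, h126, h135, h156, h234, h246, h345, h456, h124, h125, h134, h136, h145, h146,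
    h235, h236, h245, h256, h346, h356⟩ := h
  refine ⟨⟨?_, ?_, ?_, ?_, ?_, ?_, ?_, ?_, ?_, ?_, ?_, ?_, ?_, ?_, ?_⟩,
    ?_, ?_, ?_, ?_, ?_, ?_, ?_, ?_, ?_, ?_, ?_, ?_, ?_, ?_, ?_, ?_, ?_, ?_, ?_, ?_⟩
  all_goals
    simp (disch := decide) only [Matrix.cons_val, W3_add1, W3_add2, W3_add3, W3_smul1, W3_smul2,
      W3_smul3,
      W3_self12, W3_self23, W3_self13, W3_ord12, W3_ord23, h012, h013, h014, h015, h016,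
      h023, h024, h025, h026, h034, h035, h036, h045, h046, h056, h123, h126, h135, h156, h234,
      h246, h345, h456, h124, h125, h134, h136, h145, h146, h235, h236, h245, h256, h346, h356]
  case refine_3 => linear_combination e1
  case refine_8 => linear_combination e2
  case refine_12 => linear_combination e3
  case refine_16 => linear_combination q1
  case refine_17 => linear_combination q2
  case refine_18 => linear_combination -q3
  case refine_19 => linear_combination q4
  case refine_20 => linear_combination q5
  case refine_21 => linear_combination -q6
  case refine_22 => linear_combination q7
  case refine_23 => linear_combination q8
  all_goals ring1

lemma TF_rot {z : Fin 7 → E} {t1 t2 t3 t4 t5 t6 t7 t8 : ℂ} (h : TF ω z t1 t2 t3 t4 t5 t6 t7 t8) :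
    TF ω ![z 0, z 2, z 3, z 1, z 5, z 6, z 4] t1 t5 (-t2) (-t6) (-t3) (-t7) t4 t8 := by
  obtain ⟨⟨h012, h013, h014, h015, h016, h023, h024, h025, h026, h034, h035, h036, h045, h046,
    h056⟩, h123, h126, h135, h156, h234, h246, h345, h456, h124, h125, h134, h136, h145, h146,
    h235, h236, h245, h256, h346, h356⟩ := h
  refine ⟨⟨?_, ?_, ?_, ?_, ?_, ?_, ?_, ?_, ?_, ?_, ?_, ?_, ?_, ?_, ?_⟩,
    ?_, ?_, ?_, ?_, ?_, ?_, ?_, ?_, ?_, ?_, ?_, ?_, ?_, ?_, ?_, ?_, ?_, ?_, ?_, ?_⟩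
  all_goals
    simp (disch := decide) only [Matrix.cons_val,
      W3_ord12, W3_ord23, h012, h013, h014, h015, h016,
      h023, h024, h025, h026, h034, h035, h036, h045, h046, h056, h123, h126, h135, h156, h234,
      h246, h345, h456, h124, h125, h134, h136, h145, h146, h235, h236, h245, h256, h346, h356]
    try ring1

/-- The frame for the five normal forms. -/
def Five : Prop :=
  (∃ z, TF ω z 0 0 0 0 0 0 0 0) ∨ (∃ z, TF ω z 1 0 0 0 0 0 0 0) ∨
  (∃ z, TF ω z 0 1 1 0 0 0 0 0) ∨ (∃ z q, TF ω z 0 1 1 0 0 0 0 q ∧ q ≠ 0) ∨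
  (∃ z, TF ω z 1 0 0 0 0 0 0 1)

lemma ghz {z : Fin 7 → E} {a b : ℂ} (h : TF ω z a 0 0 0 0 0 0 b) (ha : a ≠ 0) (hb : b ≠ 0) :
    Five ω := by
  obtain ⟨c, hc⟩ := IsAlgClosed.exists_pow_nat_eq (a * b) (n := 3) (by norm_num)
  have hc0 : c ≠ 0 := by
    rintro rfl
    apply mul_ne_zero ha hb
    rw [← hc]; ring
  refine .inr <| .inr <| .inr <| .inr ⟨_, TF_move ω h c a⁻¹ 0 0 (a / c) 1 0 0 c⁻¹ 1 0 0 c⁻¹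
    _ _ _ _ _ _ _ _ ?_ ?_ ?_ ?_ ?_ ?_ ?_ ?_ ?_ ?_ ?_⟩
  all_goals field_simp <;> grind

lemma nf00 {z : Fin 7 → E} {n q : ℂ} (h : TF ω z 0 1 1 0 0 (-n) n q) : Five ω := by
  by_cases hn : n = 0
  · subst hn
    rw [neg_zero] at h
    by_cases hq : q = 0
    · subst hq
      exact .inr <| .inr <| .inl ⟨z, h⟩
    · exact .inr <| .inr <| .inr <| .inl ⟨z, q, h, hq⟩
  · have h1 := TF_move ω h 1 1 0 0 1 1 0 (-q / (2 * n)) 1 1 0 (-q / (2 * n)) 1 0 1 1 0 0 (-n) n 0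
      (by ring) (by ring) (by ring) (by ring) (by ring) (by ring) (by ring) (by ring) (by ring)
      (by ring) (by field_simp; ring)
    have h2 := TF_move ω h1 1 n 1 (-1 / 2) (1 / (2 * n)) 1 0 0 1 0 1 (-1) 0 (2 * n) 0 0 0 0 0 0 (-1)
      (by field_simp; ring) (by ring) (by ring) (by ring) (by ring) (by ring) (by ring)
      (by field_simp; ring) (by ring)
      (by ring) (by field_simp; ring)
    exact ghz ω h2 (by simpa using hn) (by norm_num)

lemma nf {z : Fin 7 → E} {m n q : ℂ} (h : TF ω z 0 1 1 0 m (-n) n q) : Five ω := by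
  by_cases hq : q = 0
  · subst hq
    exact nf00 ω (TF_move ω h 1 1 0 0 1 0 1 (-1) 0 0 1 (-1) 0 0 1 1 0 0 (-(-n)) (-n) m
      (by ring) (by ring) (by ring) (by ring) (by ring) (by ring) (by ring) (by ring) (by ring)
      (by ring) (by ring))
  · obtain ⟨s, hs⟩ := IsAlgClosed.exists_pow_nat_eq (n ^ 2 - m * q) (n := 2) (by norm_num)
    obtain ⟨t, ht⟩ : ∃ t, m + 2 * t * n + t ^ 2 * q = 0 := by
      refine ⟨(-n + s) / q, ?_⟩
      field_simp
      linear_combination hs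
    exact nf00 ω (TF_move ω h 1 1 0 0 1 1 t 0 1 1 t 0 1 0 1 1 0 0 (-(n + t * q)) (n + t * q) q
      (by ring) (by ring) (by ring) (by ring) (by ring) (by ring) (by ring)
      (by linear_combination ht) (by ring) (by ring) (by ring))

lemma nd {z : Fin 7 → E} {a d1 d2 d3 b : ℂ} (h : TF ω z a 0 0 d1 0 d2 d3 b) (ha : a ≠ 0)
    (hd : d1 ≠ 0) : Five ω := by
  obtain ⟨l, hl⟩ := IsAlgClosed.exists_pow_nat_eq ((a * d1)⁻¹) (n := 2) (by norm_num)
  have hl' : l ^ 2 * (a * d1) = 1 := by rw [hl]; field_simp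
  have hl0 : l ≠ 0 := by
    rintro rfl
    simp at hl'
  have h1 := TF_move ω h 1 l 0 0 l⁻¹ (-1 / (a * l)) 0 0 (-(a * l)) 0 1 (-1) 0
    0 1 1 0 _ _ _ _
    (by field_simp; ring) (by field_simp; ring) (by ring) (by ring) (by field_simp; ring)
    (by field_simp; linear_combination - hl') (by ring) rfl (neg_neg _).symm rfl rfl
  generalize_proofs at h1
  revert h1
  generalize ((![(1 : ℂ) • z 0, l • z 1 + (0 : ℂ) • z 4, (-1 / (a * l)) • z 2 + (0 : ℂ) • z 5,
    (0 : ℂ) • z 3 + (1 : ℂ) • z 6, (0 : ℂ) • z 1 + l⁻¹ • z 4, (0 : ℂ) • z 2 + (-(a * l)) • z 5,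
    (-1 : ℂ) • z 3 + (0 : ℂ) • z 6] : Fin 7 → E)) = z'
  intro h1
  obtain ⟨u5, u6, u7, u8, h1⟩ : ∃ u5 u6 u7 u8, TF ω z' 0 1 1 0 u5 u6 u7 u8 := ⟨_, _, _, _, h1⟩
  exact nf ω (TF_move ω h1 1 1 0 ((u6 + u7) / 2) 1 1 0 0 1 1 0 0 1 0 1 1 0 u5 (-((u7 - u6) / 2))
    ((u7 - u6) / 2) u8 (by ring) (by ring) (by ring) (by ring) (by ring) (by ring) (by ring)
      (by ring) (by ring) (by ring) (by ring))

lemma five_of_TF {z : Fin 7 → E} {a d1 d2 d3 b : ℂ} (h : TF ω z a 0 0 d1 0 d2 d3 b)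
    (ha : a ≠ 0) : Five ω := by
  by_cases h1 : d1 = 0
  swap
  · exact nd ω h ha h1
  by_cases h2 : d2 = 0
  swap
  · have h' := TF_rot ω h
    rw [neg_zero] at h'
    exact nd ω h' ha (neg_ne_zero.2 h2)
  by_cases h3 : d3 = 0
  swap
  · have h' := TF_rot ω (TF_rot ω h)
    rw [neg_zero, neg_zero] at h'
    exact nd ω h' ha (by simpa using h3)
  subst h1 h2 h3
  by_cases hb : b = 0
  · subst hb
    refine .inr <| .inl ⟨_, TF_move ω h 1 a⁻¹ 0 0 a 1 0 0 1 1 0 0 1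
      _ _ _ _ _ _ _ _ ?_ ?_ ?_ ?_ ?_ ?_ ?_ ?_ ?_ ?_ ?_⟩
    all_goals field_simp <;> ring
  · exact ghz ω h ha hb

lemma exists_five (z : Fin 7 → E) (h : FP ω z) : Five ω := by
  by_cases H : ∀ z, FP ω z → W3 ω (z 1) (z 2) (z 3) = 0
  · left
    obtain ⟨⟨h123, h124, h125, h126, h134, h135, h136, h145, h146, h156⟩,
      h234, h235, h236, h245, h246, h256, h345, h346, h356, h456⟩ := all_zero ω H z h
    exact ⟨z, h.toFr, h123, h126, h135, h156, h234, h246, h345, h456, h124, h125, h134, h136, h145,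
      h146, h235, h236, h245, h256, h346, h356⟩
  · push Not at H
    obtain ⟨z, hz, ha⟩ := H
    obtain ⟨z, hz⟩ := exists_FB ω z hz ha
    obtain ⟨z, a, d1, d2, d3, b, hz, ha⟩ := exists_TF ω z hz
    exact five_of_TF ω hz ha

end Move
section Final

variable (ω : AlternatingMap ℂ (Fin 7 → ℂ) ℂ (Fin 3))

lemma fin1 {z : Fin 7 → Fin 7 → ℂ} (h : TF ω z 0 0 0 0 0 0 0 0) :
    ∃ g : (Fin 7 → ℂ) ≃ₗ[ℂ] (Fin 7 → ℂ), ∀ u v w : Fin 7 → ℂ,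
        ω ![g u, g v, g w] = schouten1 u v w := by
  obtain ⟨⟨h012, h013, h014, h015, h016, h023, h024, h025, h026, h034, h035, h036, h045, h046,
    h056⟩, h123, h126, h135, h156, h234, h246, h345, h456, h124, h125, h134, h136, h145, h146,
    h235, h236, h245, h256, h346, h356⟩ := h
  obtain ⟨g, hg⟩ := build ω (eDetAlt 0 1 4 + eDetAlt 0 2 5 + eDetAlt 0 3 6)
    z
    (by
      apply forall_sorted
      all_goals repeat' apply And.intro
      all_goals
        simp (disch := decide) only [Matrix.cons_val, W3_add1, W3_add2, W3_add3, W3_smul1, W3_smul2,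
          W3_smul3, W3_sub1, W3_sub2, W3_sub3, W3_neg1, W3_neg2, W3_neg3,
          W3_self12, W3_self23, W3_self13, W3_ord12 ω z, W3_ord23 ω z, h012, h013, h014, h015, h016,
          h023, h024, h025, h026, h034, h035, h036, h045, h046, h056, h123, h126, h135, h156, h234,
          h246, h345, h456, h124, h125, h134, h136, h145, h146, h235, h236, h245, h256, h346, h356,
          W3_addAlt, eDetAlt_apply]
        simp [eDet, Matrix.det_fin_three, Pi.single_apply]
        try field_simp
        try ring)
    (by
      intro v hv
      simp only [W3_addAlt, eDetAlt_apply] at hv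
      have k0 := hv 1 4
      have k1 := hv 0 4
      have k2 := hv 0 5
      have k3 := hv 0 6
      have k4 := hv 0 1
      have k5 := hv 0 2
      have k6 := hv 0 3
      simp [eDet, Matrix.det_fin_three, Pi.single_apply] at k0 k1 k2 k3 k4 k5 k6
      ext i
      fin_cases i <;> assumption)
  refine ⟨g, fun u v w => ?_⟩
  rw [hg]
  simp only [W3_addAlt, eDetAlt_apply, schouten1]

lemma fin2 {z : Fin 7 → Fin 7 → ℂ} (h : TF ω z 1 0 0 0 0 0 0 0) :
    ∃ g : (Fin 7 → ℂ) ≃ₗ[ℂ] (Fin 7 → ℂ), ∀ u v w : Fin 7 → ℂ,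
        ω ![g u, g v, g w] = schouten2 u v w := by
  obtain ⟨⟨h012, h013, h014, h015, h016, h023, h024, h025, h026, h034, h035, h036, h045, h046,
    h056⟩, h123, h126, h135, h156, h234, h246, h345, h456, h124, h125, h134, h136, h145, h146,
    h235, h236, h245, h256, h346, h356⟩ := h
  obtain ⟨g, hg⟩ := build ω (eDetAlt 0 1 4 + eDetAlt 0 2 5 + eDetAlt 0 3 6 + eDetAlt 1 2 3)
    z
    (by
      apply forall_sorted
      all_goals repeat' apply And.intro
      all_goals
        simp (disch := decide) only [Matrix.cons_val, W3_add1, W3_add2, W3_add3, W3_smul1, W3_smul2,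
          W3_smul3, W3_sub1, W3_sub2, W3_sub3, W3_neg1, W3_neg2, W3_neg3,
          W3_self12, W3_self23, W3_self13, W3_ord12 ω z, W3_ord23 ω z, h012, h013, h014, h015, h016,
          h023, h024, h025, h026, h034, h035, h036, h045, h046, h056, h123, h126, h135, h156, h234,
          h246, h345, h456, h124, h125, h134, h136, h145, h146, h235, h236, h245, h256, h346, h356,
          W3_addAlt, eDetAlt_apply]
        simp [eDet, Matrix.det_fin_three, Pi.single_apply]
        try field_simp
        try ring)
    (by
      intro v hv
      simp only [W3_addAlt, eDetAlt_apply] at hv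
      have k0 := hv 1 4
      have k1 := hv 0 4
      have k2 := hv 0 5
      have k3 := hv 0 6
      have k4 := hv 0 1
      have k5 := hv 0 2
      have k6 := hv 0 3
      simp [eDet, Matrix.det_fin_three, Pi.single_apply] at k0 k1 k2 k3 k4 k5 k6
      ext i
      fin_cases i <;> assumption)
  refine ⟨g, fun u v w => ?_⟩
  rw [hg]
  simp only [W3_addAlt, eDetAlt_apply, schouten2]

lemma fin3 {z : Fin 7 → Fin 7 → ℂ} (h : TF ω z 0 1 1 0 0 0 0 0) :
    ∃ g : (Fin 7 → ℂ) ≃ₗ[ℂ] (Fin 7 → ℂ), ∀ u v w : Fin 7 → ℂ,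
        ω ![g u, g v, g w] = schouten3 u v w := by
  obtain ⟨⟨h012, h013, h014, h015, h016, h023, h024, h025, h026, h034, h035, h036, h045, h046,
    h056⟩, h123, h126, h135, h156, h234, h246, h345, h456, h124, h125, h134, h136, h145, h146,
    h235, h236, h245, h256, h346, h356⟩ := h
  obtain ⟨g, hg⟩ := build ω (eDetAlt 0 1 4 + eDetAlt 1 2 5 + eDetAlt 2 3 6)
    ![(1 / 4 : ℂ) • (z 5 + z 6), z 0 + z 1, z 0 - z 1, z 2 - z 3, z 2 + z 3, (-1 / 2 : ℂ) • z 4,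
      (1 / 4 : ℂ) • (z 5 - z 6)]
    (by
      apply forall_sorted
      all_goals repeat' apply And.intro
      all_goals
        simp (disch := decide) only [Matrix.cons_val, W3_add1, W3_add2, W3_add3, W3_smul1, W3_smul2,
          W3_smul3, W3_sub1, W3_sub2, W3_sub3, W3_neg1, W3_neg2, W3_neg3,
          W3_self12, W3_self23, W3_self13, W3_ord12 ω z, W3_ord23 ω z, h012, h013, h014, h015, h016,
          h023, h024, h025, h026, h034, h035, h036, h045, h046, h056, h123, h126, h135, h156, h234,
          h246, h345, h456, h124, h125, h134, h136, h145, h146, h235, h236, h245, h256, h346, h356,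
          W3_addAlt, eDetAlt_apply]
        simp [eDet, Matrix.det_fin_three, Pi.single_apply]
        try field_simp
        try ring)
    (by
      intro v hv
      simp only [W3_addAlt, eDetAlt_apply] at hv
      have k0 := hv 1 4
      have k1 := hv 0 4
      have k2 := hv 3 6
      have k3 := hv 2 6
      have k4 := hv 0 1
      have k5 := hv 1 2
      have k6 := hv 2 3
      simp [eDet, Matrix.det_fin_three, Pi.single_apply] at k0 k1 k2 k3 k4 k5 k6
      ext i
      fin_cases i <;> assumption)
  refine ⟨g, fun u v w => ?_⟩
  rw [hg]
  simp only [W3_addAlt, eDetAlt_apply, schouten3]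

lemma fin4 {z : Fin 7 → Fin 7 → ℂ} {q : ℂ} (h : TF ω z 0 1 1 0 0 0 0 q) (hq : q ≠ 0) :
    ∃ g : (Fin 7 → ℂ) ≃ₗ[ℂ] (Fin 7 → ℂ), ∀ u v w : Fin 7 → ℂ,
        ω ![g u, g v, g w] = schouten4 u v w := by
  obtain ⟨⟨h012, h013, h014, h015, h016, h023, h024, h025, h026, h034, h035, h036, h045, h046,
    h056⟩, h123, h126, h135, h156, h234, h246, h345, h456, h124, h125, h134, h136, h145, h146,
    h235, h236, h245, h256, h346, h356⟩ := h
  obtain ⟨g, hg⟩ := build ω (eDetAlt 0 1 4 + eDetAlt 0 3 6 + eDetAlt 2 3 5 + eDetAlt 2 1 6)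
    ![(1 / 2 : ℂ) • (z 0 + z 1), (1 / 2 : ℂ) • (z 5 + z 6), (-1 / (2 * q)) • (z 5 - z 6),
      (1 / 2 : ℂ) • (z 0 - z 1), -(z 2 + z 3), (-q) • (z 2 - z 3), (-2 : ℂ) • z 4]
    (by
      apply forall_sorted
      all_goals repeat' apply And.intro
      all_goals
        simp (disch := decide) only [Matrix.cons_val, W3_add1, W3_add2, W3_add3, W3_smul1, W3_smul2,
          W3_smul3, W3_sub1, W3_sub2, W3_sub3, W3_neg1, W3_neg2, W3_neg3,
          W3_self12, W3_self23, W3_self13, W3_ord12 ω z, W3_ord23 ω z, h012, h013, h014, h015, h016,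
          h023, h024, h025, h026, h034, h035, h036, h045, h046, h056, h123, h126, h135, h156, h234,
          h246, h345, h456, h124, h125, h134, h136, h145, h146, h235, h236, h245, h256, h346, h356,
          W3_addAlt, eDetAlt_apply]
        simp [eDet, Matrix.det_fin_three, Pi.single_apply]
        try field_simp
        try ring)
    (by
      intro v hv
      simp only [W3_addAlt, eDetAlt_apply] at hv
      have k0 := hv 1 4
      have k1 := hv 0 4
      have k2 := hv 3 5
      have k3 := hv 2 5
      have k4 := hv 0 1
      have k5 := hv 2 3
      have k6 := hv 0 3
      simp [eDet, Matrix.det_fin_three, Pi.single_apply] at k0 k1 k2 k3 k4 k5 k6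
      ext i
      fin_cases i <;> assumption)
  refine ⟨g, fun u v w => ?_⟩
  rw [hg]
  simp only [W3_addAlt, eDetAlt_apply, schouten4]

lemma fin5 {z : Fin 7 → Fin 7 → ℂ} (h : TF ω z 1 0 0 0 0 0 0 1) :
    ∃ g : (Fin 7 → ℂ) ≃ₗ[ℂ] (Fin 7 → ℂ), ∀ u v w : Fin 7 → ℂ,
        ω ![g u, g v, g w] = schouten5 u v w := by
  obtain ⟨⟨h012, h013, h014, h015, h016, h023, h024, h025, h026, h034, h035, h036, h045, h046,
    h056⟩, h123, h126, h135, h156, h234, h246, h345, h456, h124, h125, h134, h136, h145, h146,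
    h235, h236, h245, h256, h346, h356⟩ := h
  obtain ⟨g, hg⟩ := build ω (eDetAlt 0 1 4 + eDetAlt 0 2 5 + eDetAlt 0 3 6 + eDetAlt 1 2 3 + eDetAlt 4 5 6)
    z
    (by
      apply forall_sorted
      all_goals repeat' apply And.intro
      all_goals
        simp (disch := decide) only [Matrix.cons_val, W3_add1, W3_add2, W3_add3, W3_smul1, W3_smul2,
          W3_smul3, W3_sub1, W3_sub2, W3_sub3, W3_neg1, W3_neg2, W3_neg3,
          W3_self12, W3_self23, W3_self13, W3_ord12 ω z, W3_ord23 ω z, h012, h013, h014, h015, h016,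
          h023, h024, h025, h026, h034, h035, h036, h045, h046, h056, h123, h126, h135, h156, h234,
          h246, h345, h456, h124, h125, h134, h136, h145, h146, h235, h236, h245, h256, h346, h356,
          W3_addAlt, eDetAlt_apply]
        simp [eDet, Matrix.det_fin_three, Pi.single_apply]
        try field_simp
        try ring)
    (by
      intro v hv
      simp only [W3_addAlt, eDetAlt_apply] at hv
      have k0 := hv 1 4
      have k1 := hv 0 4
      have k2 := hv 0 5
      have k3 := hv 0 6
      have k4 := hv 0 1
      have k5 := hv 0 2
      have k6 := hv 0 3
      simp [eDet, Matrix.det_fin_three, Pi.single_apply] at k0 k1 k2 k3 k4 k5 k6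
      ext i
      fin_cases i <;> assumption)
  refine ⟨g, fun u v w => ?_⟩
  rw [hg]
  simp only [W3_addAlt, eDetAlt_apply, schouten5]

end Final
/-- Schouten's theorem: every three-form of maximal rank in seven variables is
`GL₇`-equivalent to one of the five normal forms `ω₁, …, ω₅`. -/
theorem schouten_theorem
    (ω : AlternatingMap ℂ (Fin 7 → ℂ) ℂ (Fin 3))
    (hrk : ∀ v : Fin 7 → ℂ, (∀ u w : Fin 7 → ℂ, ω ![v, u, w] = 0) → v = 0) :
    (∃ g : (Fin 7 → ℂ) ≃ₗ[ℂ] (Fin 7 → ℂ), ∀ u v w : Fin 7 → ℂ,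
        ω ![g u, g v, g w] = schouten1 u v w) ∨
    (∃ g : (Fin 7 → ℂ) ≃ₗ[ℂ] (Fin 7 → ℂ), ∀ u v w : Fin 7 → ℂ,
        ω ![g u, g v, g w] = schouten2 u v w) ∨
    (∃ g : (Fin 7 → ℂ) ≃ₗ[ℂ] (Fin 7 → ℂ), ∀ u v w : Fin 7 → ℂ,
        ω ![g u, g v, g w] = schouten3 u v w) ∨
    (∃ g : (Fin 7 → ℂ) ≃ₗ[ℂ] (Fin 7 → ℂ), ∀ u v w : Fin 7 → ℂ,
        ω ![g u, g v, g w] = schouten4 u v w) ∨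
    (∃ g : (Fin 7 → ℂ) ≃ₗ[ℂ] (Fin 7 → ℂ), ∀ u v w : Fin 7 → ℂ,
        ω ![g u, g v, g w] = schouten5 u v w) := by
  obtain ⟨z, hz⟩ := exists_frame ω hrk
  obtain ⟨z, hz⟩ := exists_prim ω z hz
  rcases exists_five ω z hz with ⟨z, h⟩ | ⟨z, h⟩ | ⟨z, h⟩ | ⟨z, q, h, hq⟩ | ⟨z, h⟩
  · exact .inl (fin1 ω h)
  · exact .inr (.inl (fin2 ω h))
  · exact .inr (.inr (.inl (fin3 ω h)))
  · exact .inr (.inr (.inr (.inl (fin4 ω h hq))))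
  · exact .inr (.inr (.inr (.inr (fin5 ω h))))
end
end

section
/- Normal forms of nets of alternating two-forms in four variables: let H be a three-dimensional ℂ-subspace of the space of alternating two-forms on V = Fin 4 → ℂ such that the supports of its elements span the dual space, i.e. for every nonzero v ∈ V there exist γ ∈ H and w ∈ V with γ(v,w) ≠ 0. Then there is a linear automorphism g of V such that the pullback of H by g (the span of the forms (u,v) ↦ γ(gu,gv) for γ ∈ H) equals one of the following subspaces: span(e^{12}, e^{13}, e^{14}); span(e^{12}, e^{13}, e^{14}+e^{23}); span(e^{12}, e^{23}, e^{34}); span(e^{12}, e^{34}, (e¹+e³)∧(e²+e⁴)). -/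
noncomputable section

/-- The wedge product `f ∧ g` of two linear functionals, as an alternating two-form:
`(u, v) ↦ f u * g v - f v * g u`. -/
def wedge (f g : (Fin 4 → ℂ) →ₗ[ℂ] ℂ) : AlternatingMap ℂ (Fin 4 → ℂ) ℂ (Fin 2) :=
  MultilinearMap.alternatization
    ((MultilinearMap.mkPiAlgebra ℂ (Fin 2) ℂ).compLinearMap ![f, g])

/-- The basic two-form `e^{ij}`, `(u, v) ↦ uᵢ vⱼ - uⱼ vᵢ`. -/
def e2 (i j : Fin 4) : AlternatingMap ℂ (Fin 4 → ℂ) ℂ (Fin 2) :=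
  wedge (LinearMap.proj i) (LinearMap.proj j)

abbrev TF_s4 := AlternatingMap ℂ (Fin 4 → ℂ) ℂ (Fin 2)
abbrev LF := (Fin 4 → ℂ) →ₗ[ℂ] ℂ

lemma wedge_apply (f g : LF) (x : Fin 2 → Fin 4 → ℂ) :
    wedge f g x = f (x 0) * g (x 1) - f (x 1) * g (x 0) := by
  have hu : (Finset.univ : Finset (Equiv.Perm (Fin 2))) = {1, Equiv.swap 0 1} := by decide
  rw [wedge, MultilinearMap.alternatization_apply, hu, Finset.sum_pair (by decide)]
  simp [Fin.prod_univ_two]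
  ring

def EE (i : Fin 4) : Fin 4 → ℂ := Pi.single i 1

def co (γ : TF_s4) (i j : Fin 4) : ℂ := γ ![EE i, EE j]

lemma co_self (γ : TF_s4) (i : Fin 4) : co γ i i = 0 :=
  γ.map_eq_zero_of_eq (i := 0) (j := 1) _ (by simp) (by simp)

lemma co_swap (γ : TF_s4) (i j : Fin 4) : co γ i j = - co γ j i := by
  have := γ.map_swap (i := 0) (j := 1) ![EE i, EE j] (by simp)
  unfold co
  rw [← neg_eq_iff_eq_neg, ← this]
  congr 1
  ext k
  fin_cases k <;> simp

lemma co_ext {γ δ : TF_s4} (h01 : co γ 0 1 = co δ 0 1) (h02 : co γ 0 2 = co δ 0 2)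
    (h03 : co γ 0 3 = co δ 0 3) (h12 : co γ 1 2 = co δ 1 2) (h13 : co γ 1 3 = co δ 1 3)
    (h23 : co γ 2 3 = co δ 2 3) : γ = δ := by
  have key : ∀ i j, co γ i j = co δ i j := by
    have hs : ∀ i j, co γ i j = co δ i j → co γ j i = co δ j i := by
      intro i j h; rw [co_swap γ, co_swap δ, h]
    intro i j
    fin_cases i <;> fin_cases j <;>
      first
      | exact (co_self _ _).trans (co_self _ _).symm
      | assumption
      | (apply hs; assumption)
  refine Module.Basis.ext_alternating (Pi.basisFun ℂ (Fin 4)) fun v _ => ?_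
  have := key (v 0) (v 1)
  unfold co EE at this
  have e : (fun i => (Pi.basisFun ℂ (Fin 4)) (v i)) = ![Pi.single (v 0) 1, Pi.single (v 1) 1] := by
    ext i : 1
    fin_cases i <;> simp
  rw [e]; exact this

@[simp] lemma co_add (γ δ : TF_s4) (i j) : co (γ + δ) i j = co γ i j + co δ i j := rfl
@[simp] lemma co_sub (γ δ : TF_s4) (i j) : co (γ - δ) i j = co γ i j - co δ i j := rfl
@[simp] lemma co_neg (γ : TF_s4) (i j) : co (-γ) i j = - co γ i j := rfl
@[simp] lemma co_smul (a : ℂ) (γ : TF_s4) (i j) : co (a • γ) i j = a * co γ i j := rfl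
@[simp] lemma co_zero (i j) : co 0 i j = 0 := rfl
@[simp] lemma co_wedge (f g : LF) (i j) :
    co (wedge f g) i j = f (EE i) * g (EE j) - f (EE j) * g (EE i) := by
  simp [co, wedge_apply]

/-- the polarized Pfaffian -/
def BB : LinearMap.BilinForm ℂ TF_s4 :=
  LinearMap.mk₂ ℂ (fun γ δ => co γ 0 1 * co δ 2 3 - co γ 0 2 * co δ 1 3 + co γ 0 3 * co δ 1 2
      + co γ 1 2 * co δ 0 3 - co γ 1 3 * co δ 0 2 + co γ 2 3 * co δ 0 1)
    (by intros; simp; ring) (by intros; simp; ring) (by intros; simp; ring)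
    (by intros; simp; ring)

lemma BB_apply (γ δ : TF_s4) : BB γ δ =
    co γ 0 1 * co δ 2 3 - co γ 0 2 * co δ 1 3 + co γ 0 3 * co δ 1 2
      + co γ 1 2 * co δ 0 3 - co γ 1 3 * co δ 0 2 + co γ 2 3 * co δ 0 1 := rfl

lemma BB_symm (γ δ : TF_s4) : BB γ δ = BB δ γ := by simp only [BB_apply]; ring

def LL (x : Fin 4 → ℂ) : LF := ∑ i, x i • LinearMap.proj i

@[simp] lemma LL_EE (x : Fin 4 → ℂ) (j : Fin 4) : LL x (EE j) = x j := by
  simp [LL, EE, Pi.single_apply]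

lemma decomp (γ : TF_s4) (h : BB γ γ = 0) : ∃ f g : LF, γ = wedge f g := by
  have P : co γ 0 1 * co γ 2 3 - co γ 0 2 * co γ 1 3 + co γ 0 3 * co γ 1 2 = 0 := by
    rw [BB_apply] at h; linear_combination h / 2
  have s10 := co_swap γ 1 0
  have s20 := co_swap γ 2 0
  have s30 := co_swap γ 3 0
  have s21 := co_swap γ 2 1
  have s31 := co_swap γ 3 1
  have s32 := co_swap γ 3 2
  have piv : ∀ i j : Fin 4, i < j → co γ i j ≠ 0 → ∃ f g : LF, γ = wedge f g := by
    intro i j hij hne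
    refine ⟨(co γ i j)⁻¹ • LL (co γ i), LL (co γ j), ?_⟩
    fin_cases i <;> fin_cases j <;> first | (exact absurd hij (by decide)) | skip
    all_goals
      simp only [Fin.zero_eta, Fin.mk_one, Fin.reduceFinMk, Fin.isValue] at hne ⊢
      apply co_ext <;>
      simp only [co_wedge, LinearMap.smul_apply, LL_EE, smul_eq_mul, co_self, s10, s20, s30, s21, s31, s32] <;>
      field_simp <;>
      first
      | ring1
      | linear_combination P
      | linear_combination -P
  by_cases h01 : co γ 0 1 = 0
  swap; · exact piv 0 1 (by decide) h01
  by_cases h02 : co γ 0 2 = 0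
  swap; · exact piv 0 2 (by decide) h02
  by_cases h03 : co γ 0 3 = 0
  swap; · exact piv 0 3 (by decide) h03
  by_cases h12 : co γ 1 2 = 0
  swap; · exact piv 1 2 (by decide) h12
  by_cases h13 : co γ 1 3 = 0
  swap; · exact piv 1 3 (by decide) h13
  by_cases h23 : co γ 2 3 = 0
  swap; · exact piv 2 3 (by decide) h23
  exact ⟨0, 0, by apply co_ext <;> simp [*]⟩

/-- determinant of four functionals -/
def DD (f : Fin 4 → LF) : ℂ := BB (wedge (f 0) (f 1)) (wedge (f 2) (f 3))

lemma exists_equiv (f : Fin 4 → LF) (h : DD f ≠ 0) :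
    ∃ φ : (Fin 4 → ℂ) ≃ₗ[ℂ] (Fin 4 → ℂ), ∀ v i, φ v i = f i v := by
  have hinj : Function.Injective (LinearMap.pi f) := by
    rw [← LinearMap.ker_eq_bot, LinearMap.ker_eq_bot']
    intro v hv
    have hf : ∀ i, f i v = 0 := fun i => congrFun hv i
    have hM : (Matrix.of fun i j => f i (EE j)).mulVec v = 0 := by
      ext i
      rw [Pi.zero_apply, ← hf i]
      conv_rhs => rw [pi_eq_sum_univ' v]
      simp [Matrix.mulVec, dotProduct, EE, map_sum, mul_comm]
      
    by_contra hv0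
    have := Matrix.exists_mulVec_eq_zero_iff.1 ⟨v, hv0, hM⟩
    apply h
    rw [← this]
    simp [DD, BB_apply, Matrix.det_succ_row_zero, Fin.sum_univ_succ, Fin.succAbove]
    ring
  exact ⟨LinearEquiv.ofInjectiveEndo _ hinj, fun v i => rfl⟩

lemma e2_expand (γ : TF_s4) : γ = co γ 0 1 • e2 0 1 + co γ 0 2 • e2 0 2 + co γ 0 3 • e2 0 3
    + co γ 1 2 • e2 1 2 + co γ 1 3 • e2 1 3 + co γ 2 3 • e2 2 3 := by
  apply co_ext <;> simp [e2, EE]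

lemma wedge_comp (f g : LF) (φ : (Fin 4 → ℂ) →ₗ[ℂ] (Fin 4 → ℂ)) :
    (wedge f g).compLinearMap φ = wedge (f ∘ₗ φ) (g ∘ₗ φ) := by
  ext v; simp [wedge_apply]

lemma expand (f : Fin 4 → LF) (h : DD f ≠ 0) (γ : TF_s4) : ∃ a b c d e k : ℂ,
    γ = a • wedge (f 0) (f 1) + b • wedge (f 0) (f 2) + c • wedge (f 0) (f 3)
    + d • wedge (f 1) (f 2) + e • wedge (f 1) (f 3) + k • wedge (f 2) (f 3) := by
  obtain ⟨φ, hφ⟩ := exists_equiv f h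
  have h1 := e2_expand (γ.compLinearMap φ.symm.toLinearMap)
  have h2 := congrArg (fun δ : TF_s4 => δ.compLinearMap φ.toLinearMap) h1
  have hp : ∀ i, (LinearMap.proj i : LF) ∘ₗ φ.toLinearMap = f i := by
    intro i; ext v; simp [hφ]
  set δ := γ.compLinearMap φ.symm.toLinearMap
  refine ⟨co δ 0 1, co δ 0 2, co δ 0 3, co δ 1 2, co δ 1 3, co δ 2 3, Eq.trans ?_ (h2.trans ?_)⟩
  · ext v; simp [δ]
  · simp only [← hp, ← wedge_comp]
    rfl

lemma expandL (f : Fin 4 → LF) (h : DD f ≠ 0) (l : LF) : ∃ a b c d : ℂ,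
    l = a • f 0 + b • f 1 + c • f 2 + d • f 3 := by
  obtain ⟨φ, hφ⟩ := exists_equiv f h
  refine ⟨l (φ.symm (EE 0)), l (φ.symm (EE 1)), l (φ.symm (EE 2)), l (φ.symm (EE 3)), ?_⟩
  refine LinearMap.ext fun v => ?_
  conv_lhs => rw [← φ.symm_apply_apply v, pi_eq_sum_univ' (φ v)]
  simp [Fin.sum_univ_four, hφ, EE]
  ring_nf

lemma mem3 {x y z w : TF_s4} (a b c : ℂ) (h : w = a • x + b • y + c • z) :
    w ∈ Submodule.span ℂ {x, y, z} := by
  rw [h]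
  refine add_mem (add_mem ?_ ?_) ?_ <;> refine Submodule.smul_mem _ _ (Submodule.subset_span ?_) <;>
    simp

lemma span3_eq {x y z x' y' z' : TF_s4} (h1 : x ∈ Submodule.span ℂ {x', y', z'})
    (h2 : y ∈ Submodule.span ℂ {x', y', z'}) (h3 : z ∈ Submodule.span ℂ {x', y', z'})
    (h1' : x' ∈ Submodule.span ℂ {x, y, z})
    (h2' : y' ∈ Submodule.span ℂ {x, y, z}) (h3' : z' ∈ Submodule.span ℂ {x, y, z}) :
    Submodule.span ℂ {x, y, z} = Submodule.span ℂ {x', y', z'} := by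
  apply le_antisymm <;> rw [Submodule.span_le] <;>
    rintro w (rfl | rfl | rfl) <;> assumption

lemma pull (f : Fin 4 → LF) (h : DD f ≠ 0) : ∃ g : (Fin 4 → ℂ) ≃ₗ[ℂ] (Fin 4 → ℂ),
    ∀ i, f i ∘ₗ g.toLinearMap = LinearMap.proj i := by
  obtain ⟨φ, hφ⟩ := exists_equiv f h
  refine ⟨φ.symm, fun i => LinearMap.ext fun v => ?_⟩
  simp [← hφ]

lemma pull_span {H : Submodule ℂ TF_s4} {a b c : TF_s4} (hH : H = Submodule.span ℂ {a, b, c})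
    (g : (Fin 4 → ℂ) →ₗ[ℂ] (Fin 4 → ℂ)) :
    Submodule.span ℂ ((fun γ : TF_s4 => γ.compLinearMap g) '' (H : Set TF_s4)) =
      Submodule.span ℂ {a.compLinearMap g, b.compLinearMap g, c.compLinearMap g} := by
  let F : TF_s4 →ₗ[ℂ] TF_s4 :=
    { toFun := fun γ => γ.compLinearMap g
      map_add' := fun _ _ => rfl
      map_smul' := fun _ _ => rfl }
  have : (fun γ : TF_s4 => γ.compLinearMap g) '' (H : Set TF_s4) = (Submodule.map F H : Set TF_s4) := rfl
  rw [this, Submodule.span_eq, hH, Submodule.map_span]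
  congr 1
  rw [Set.image_insert_eq, Set.image_insert_eq, Set.image_singleton]
  rfl

def Goal (H : Submodule ℂ TF_s4) : Prop :=
    ∃ g : (Fin 4 → ℂ) ≃ₗ[ℂ] (Fin 4 → ℂ),
      (Submodule.span ℂ
          ((fun γ : AlternatingMap ℂ (Fin 4 → ℂ) ℂ (Fin 2) =>
            γ.compLinearMap (g : (Fin 4 → ℂ) →ₗ[ℂ] (Fin 4 → ℂ))) '' (H : Set _)) =
        Submodule.span ℂ {e2 0 1, e2 0 2, e2 0 3}) ∨
      (Submodule.span ℂ
          ((fun γ : AlternatingMap ℂ (Fin 4 → ℂ) ℂ (Fin 2) =>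
            γ.compLinearMap (g : (Fin 4 → ℂ) →ₗ[ℂ] (Fin 4 → ℂ))) '' (H : Set _)) =
        Submodule.span ℂ {e2 0 1, e2 0 2, e2 0 3 + e2 1 2}) ∨
      (Submodule.span ℂ
          ((fun γ : AlternatingMap ℂ (Fin 4 → ℂ) ℂ (Fin 2) =>
            γ.compLinearMap (g : (Fin 4 → ℂ) →ₗ[ℂ] (Fin 4 → ℂ))) '' (H : Set _)) =
        Submodule.span ℂ {e2 0 1, e2 1 2, e2 2 3}) ∨
      (Submodule.span ℂ
          ((fun γ : AlternatingMap ℂ (Fin 4 → ℂ) ℂ (Fin 2) =>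
            γ.compLinearMap (g : (Fin 4 → ℂ) →ₗ[ℂ] (Fin 4 → ℂ))) '' (H : Set _)) =
        Submodule.span ℂ {e2 0 1, e2 2 3,
          wedge ((LinearMap.proj 0 : (Fin 4 → ℂ) →ₗ[ℂ] ℂ) + LinearMap.proj 2)
            ((LinearMap.proj 1 : (Fin 4 → ℂ) →ₗ[ℂ] ℂ) + LinearMap.proj 3)})

lemma goal1 {H : Submodule ℂ TF_s4} (f : Fin 4 → LF) (h : DD f ≠ 0)
    (hH : H = Submodule.span ℂ {wedge (f 0) (f 1), wedge (f 0) (f 2), wedge (f 0) (f 3)}) :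
    Goal H := by
  obtain ⟨g, hg⟩ := pull f h
  refine ⟨g, Or.inl ?_⟩
  rw [pull_span hH]
  simp only [wedge_comp, hg]
  rfl

lemma goal2 {H : Submodule ℂ TF_s4} (f : Fin 4 → LF) (h : DD f ≠ 0)
    (hH : H = Submodule.span ℂ {wedge (f 0) (f 1), wedge (f 0) (f 2),
      wedge (f 0) (f 3) + wedge (f 1) (f 2)}) :
    Goal H := by
  obtain ⟨g, hg⟩ := pull f h
  refine ⟨g, Or.inr (Or.inl ?_)⟩
  rw [pull_span hH]
  simp only [AlternatingMap.add_compLinearMap, wedge_comp, hg]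
  rfl

lemma goal3 {H : Submodule ℂ TF_s4} (f : Fin 4 → LF) (h : DD f ≠ 0)
    (hH : H = Submodule.span ℂ {wedge (f 0) (f 1), wedge (f 1) (f 2), wedge (f 2) (f 3)}) :
    Goal H := by
  obtain ⟨g, hg⟩ := pull f h
  refine ⟨g, Or.inr (Or.inr (Or.inl ?_))⟩
  rw [pull_span hH]
  simp only [wedge_comp, hg]
  rfl

lemma goal4 {H : Submodule ℂ TF_s4} (f : Fin 4 → LF) (h : DD f ≠ 0)
    (hH : H = Submodule.span ℂ {wedge (f 0) (f 1), wedge (f 2) (f 3),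
      wedge (f 0 + f 2) (f 1 + f 3)}) :
    Goal H := by
  obtain ⟨g, hg⟩ := pull f h
  refine ⟨g, Or.inr (Or.inr (Or.inr ?_))⟩
  rw [pull_span hH]
  simp only [wedge_comp, LinearMap.add_comp, hg]
  rfl

lemma BB01 (f0 f1 f2 f3 : LF) (a b c d e k : ℂ) :
    BB (wedge f0 f1) (a • wedge f0 f1 + b • wedge f0 f2 + c • wedge f0 f3
      + d • wedge f1 f2 + e • wedge f1 f3 + k • wedge f2 f3) =
      k * BB (wedge f0 f1) (wedge f2 f3) := by
  simp only [BB_apply, co_add, co_smul, co_wedge]; ring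

lemma BB23 (f0 f1 f2 f3 : LF) (a b c d e k : ℂ) :
    BB (wedge f2 f3) (a • wedge f0 f1 + b • wedge f0 f2 + c • wedge f0 f3
      + d • wedge f1 f2 + e • wedge f1 f3 + k • wedge f2 f3) =
      a * BB (wedge f0 f1) (wedge f2 f3) := by
  simp only [BB_apply, co_add, co_smul, co_wedge]; ring

lemma BB02 (f0 f1 f2 f3 : LF) (a b c d e k : ℂ) :
    BB (wedge f0 f2) (a • wedge f0 f1 + b • wedge f0 f2 + c • wedge f0 f3
      + d • wedge f1 f2 + e • wedge f1 f3 + k • wedge f2 f3) =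
      - e * BB (wedge f0 f1) (wedge f2 f3) := by
  simp only [BB_apply, co_add, co_smul, co_wedge]; ring

lemma BB03 (f0 f1 f2 f3 : LF) (a b c d e k : ℂ) :
    BB (wedge f0 f3) (a • wedge f0 f1 + b • wedge f0 f2 + c • wedge f0 f3
      + d • wedge f1 f2 + e • wedge f1 f3 + k • wedge f2 f3) =
      d * BB (wedge f0 f1) (wedge f2 f3) := by
  simp only [BB_apply, co_add, co_smul, co_wedge]; ring

lemma BB12 (f0 f1 f2 f3 : LF) (a b c d e k : ℂ) :
    BB (wedge f1 f2) (a • wedge f0 f1 + b • wedge f0 f2 + c • wedge f0 f3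
      + d • wedge f1 f2 + e • wedge f1 f3 + k • wedge f2 f3) =
      c * BB (wedge f0 f1) (wedge f2 f3) := by
  simp only [BB_apply, co_add, co_smul, co_wedge]; ring

lemma BB13 (f0 f1 f2 f3 : LF) (a b c d e k : ℂ) :
    BB (wedge f1 f3) (a • wedge f0 f1 + b • wedge f0 f2 + c • wedge f0 f3
      + d • wedge f1 f2 + e • wedge f1 f3 + k • wedge f2 f3) =
      - b * BB (wedge f0 f1) (wedge f2 f3) := by
  simp only [BB_apply, co_add, co_smul, co_wedge]; ring

lemma BBself (f0 f1 f2 f3 : LF) (a b c d e k : ℂ) (γ : TF_s4)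
    (hγ : γ = a • wedge f0 f1 + b • wedge f0 f2 + c • wedge f0 f3
      + d • wedge f1 f2 + e • wedge f1 f3 + k • wedge f2 f3) :
    BB γ γ = 2 * (a * k - b * e + c * d) * BB (wedge f0 f1) (wedge f2 f3) := by
  conv_lhs => enter [1, 2]; rw [hγ]
  simp only [map_add, map_smul, LinearMap.add_apply, LinearMap.smul_apply, smul_eq_mul]
  rw [hγ, BB01, BB02, BB03, BB12, BB13, BB23]
  ring

lemma rank_one (f0 f1 f2 f3 : LF) (b c d e : ℂ) (hm : b * e = c * d)
    (hne : ¬ (b = 0 ∧ c = 0 ∧ d = 0 ∧ e = 0)) :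
    ∃ (p0 p1 p2 p3 : LF) (l m : ℂ), l ≠ 0 ∧ m ≠ 0 ∧ wedge p0 p1 = l • wedge f0 f1 ∧
      wedge p2 p3 = m • wedge f2 f3 ∧
      wedge p1 p2 = b • wedge f0 f2 + c • wedge f0 f3 + d • wedge f1 f2 + e • wedge f1 f3 := by
  by_cases hb : b = 0
  swap
  · have he : e = c * d / b := by field_simp; linear_combination hm
    refine ⟨f1, b • f0 + d • f1, f2 + (c / b) • f3, f3, -b, 1, by simpa, by simp, ?_, ?_, ?_⟩ <;>
      apply co_ext <;> simp [he] <;> field_simp <;> ring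
  by_cases hc : c = 0
  swap
  · have he : d = b * e / c := by field_simp; linear_combination -hm
    refine ⟨f1, c • f0 + e • f1, (b / c) • f2 + f3, f2, -c, -1, by simpa, by simp, ?_, ?_, ?_⟩ <;>
      apply co_ext <;> simp [he] <;> field_simp <;> ring
  by_cases hd : d = 0
  swap
  · have he : c = b * e / d := by field_simp; linear_combination -hm
    refine ⟨f0, b • f0 + d • f1, f2 + (e / d) • f3, f3, d, 1, by simpa, by simp, ?_, ?_, ?_⟩ <;>
      apply co_ext <;> simp [he] <;> field_simp <;> ring
  by_cases he : e = 0
  swap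
  · have hb : b = c * d / e := by field_simp; linear_combination hm
    refine ⟨f0, c • f0 + e • f1, (d / e) • f2 + f3, f2, e, -1, by simpa, by simp, ?_, ?_, ?_⟩ <;>
      apply co_ext <;> simp [hb] <;> field_simp <;> ring
  exact absurd ⟨hb, hc, hd, he⟩ hne

lemma case3 {H : Submodule ℂ TF_s4} {a b c : TF_s4} (hH : H = Submodule.span ℂ {a, b, c})
    (haa : BB a a = 0) (hbb : BB b b = 0) (hcc : BB c c = 0)
    (hab : BB a b ≠ 0) (hac : BB a c ≠ 0) (hbc : BB b c ≠ 0) : Goal H := by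
  obtain ⟨f0, f1, rfl⟩ := decomp a haa
  obtain ⟨f2, f3, rfl⟩ := decomp b hbb
  obtain ⟨h, k, rfl⟩ := decomp c hcc
  obtain ⟨h0, h1, h2, h3, hh⟩ := expandL ![f0, f1, f2, f3] hab h
  obtain ⟨k0, k1, k2, k3, hk⟩ := expandL ![f0, f1, f2, f3] hab k
  simp only [Matrix.cons_val] at hh hk
  have hw : wedge h k = (h0 * k1 - h1 * k0) • wedge f0 f1 + (h0 * k2 - h2 * k0) • wedge f0 f2
      + (h0 * k3 - h3 * k0) • wedge f0 f3 + (h1 * k2 - h2 * k1) • wedge f1 f2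
      + (h1 * k3 - h3 * k1) • wedge f1 f3 + (h2 * k3 - h3 * k2) • wedge f2 f3 := by
    rw [hh, hk]; apply co_ext <;> simp <;> ring
  have n1 : h2 * k3 - h3 * k2 ≠ 0 := by
    intro h0; rw [hw, BB01, h0] at hac; simp at hac
  have n2 : h0 * k1 - h1 * k0 ≠ 0 := by
    intro h0; rw [hw, BB23, h0] at hbc; simp at hbc
  have w1 : wedge (h0 • f0 + h1 • f1) (k0 • f0 + k1 • f1) =
      (h0 * k1 - h1 * k0) • wedge f0 f1 := by apply co_ext <;> simp <;> ring
  have w2 : wedge (h2 • f2 + h3 • f3) (k2 • f2 + k3 • f3) =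
      (h2 * k3 - h3 * k2) • wedge f2 f3 := by apply co_ext <;> simp <;> ring
  have w3 : wedge ((h0 • f0 + h1 • f1) + (h2 • f2 + h3 • f3))
      ((k0 • f0 + k1 • f1) + (k2 • f2 + k3 • f3)) = wedge h k := by
    rw [hh, hk]; congr 1 <;> abel
  refine goal4 ![h0 • f0 + h1 • f1, k0 • f0 + k1 • f1, h2 • f2 + h3 • f3, k2 • f2 + k3 • f3] ?_ ?_
  · simp only [DD, Matrix.cons_val]
    rw [w1, w2]
    simp only [map_smul, LinearMap.smul_apply, smul_eq_mul]
    exact mul_ne_zero n1 (mul_ne_zero n2 hab)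
  · simp only [Matrix.cons_val]
    rw [w1, w2, w3, hH]
    apply span3_eq
    · exact mem3 (h0 * k1 - h1 * k0)⁻¹ 0 0 (by rw [smul_smul, inv_mul_cancel₀ n2]; simp)
    · exact mem3 0 (h2 * k3 - h3 * k2)⁻¹ 0 (by simp [smul_smul, n1])
    · exact mem3 0 0 1 (by simp)
    · exact mem3 (h0 * k1 - h1 * k0) 0 0 (by simp)
    · exact mem3 0 (h2 * k3 - h3 * k2) 0 (by simp)
    · exact mem3 0 0 1 (by simp)

lemma case2 {H : Submodule ℂ TF_s4} {a b c : TF_s4} (hH : H = Submodule.span ℂ {a, b, c})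
    (haa : BB a a = 0) (hbb : BB b b = 0) (hcc : BB c c = 0)
    (hab : BB a b ≠ 0) (hac : BB a c = 0) (hbc : BB b c = 0) (hc : c ≠ 0) : Goal H := by
  obtain ⟨f0, f1, rfl⟩ := decomp a haa
  obtain ⟨f2, f3, rfl⟩ := decomp b hbb
  obtain ⟨x, y, z, u, v, w, hw⟩ := expand ![f0, f1, f2, f3] hab c
  simp only [Matrix.cons_val] at hw
  rw [BBself _ _ _ _ _ _ _ _ _ _ _ hw] at hcc
  rw [hw, BB01] at hac
  rw [hw, BB23] at hbc
  have hw0 : w = 0 := (mul_eq_zero.1 hac).resolve_right hab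
  have hx0 : x = 0 := (mul_eq_zero.1 hbc).resolve_right hab
  have h2 := (mul_eq_zero.1 hcc).resolve_right hab
  subst hw0 hx0
  obtain ⟨p0, p1, p2, p3, l, m, hl, hm, w1, w2, w3⟩ := rank_one f0 f1 f2 f3 y z u v
    (by linear_combination -h2 / 2) (by
      rintro ⟨rfl, rfl, rfl, rfl⟩; apply hc; rw [hw]; simp)
  have w3' : wedge p1 p2 = c := by rw [w3, hw]; module
  refine goal3 ![p0, p1, p2, p3] ?_ ?_
  · simp only [DD, Matrix.cons_val]
    rw [w1, w2]
    simp only [map_smul, LinearMap.smul_apply, smul_eq_mul]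
    exact mul_ne_zero hm (mul_ne_zero hl hab)
  · simp only [Matrix.cons_val]
    rw [w1, w2, w3', hH]
    apply span3_eq
    · exact mem3 l⁻¹ 0 0 (by rw [smul_smul, inv_mul_cancel₀ hl]; simp)
    · exact mem3 0 0 m⁻¹ (by simp [smul_smul, hm])
    · exact mem3 0 1 0 (by simp)
    · exact mem3 l 0 0 (by simp)
    · exact mem3 0 0 1 (by simp)
    · exact mem3 0 m 0 (by simp)

lemma case1' {H : Submodule ℂ TF_s4} {f0 f1 f2 f3 : LF} {c : TF_s4}
    (hH : H = Submodule.span ℂ {wedge f0 f1, wedge f0 f2, c})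
    (hD : BB (wedge f0 f1) (wedge f2 f3) ≠ 0)
    (h1 : BB (wedge f0 f1) c = 0) (h2 : BB (wedge f0 f2) c = 0)
    (hsupp : ∀ v : Fin 4 → ℂ, v ≠ 0 → ∃ γ ∈ H, ∃ w : Fin 4 → ℂ, γ ![v, w] ≠ 0) : Goal H := by
  obtain ⟨x, y, z, u, v, w, hw⟩ := expand ![f0, f1, f2, f3] hD c
  simp only [Matrix.cons_val] at hw
  rw [hw, BB01] at h1
  rw [hw, BB02] at h2
  have hw0 : w = 0 := (mul_eq_zero.1 h1).resolve_right hD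
  have hv0 : v = 0 := neg_eq_zero.1 ((mul_eq_zero.1 h2).resolve_right hD)
  subst hw0 hv0
  by_cases hz : z = 0
  · exfalso
    subst hz
    obtain ⟨φ, hφ⟩ := exists_equiv ![f0, f1, f2, f3] hD
    have e : ∀ i, (![f0, f1, f2, f3] : Fin 4 → LF) i (φ.symm (EE 3)) = EE 3 i := by
      intro i; rw [← hφ]; simp
    have e0 : f0 (φ.symm (EE 3)) = 0 := by simpa [EE] using e 0
    have e1 : f1 (φ.symm (EE 3)) = 0 := by simpa [EE] using e 1
    have e2 : f2 (φ.symm (EE 3)) = 0 := by simpa [EE] using e 2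
    obtain ⟨γ, hγ, t, ht⟩ := hsupp (φ.symm (EE 3)) (by simp [EE])
    apply ht
    rw [hH] at hγ
    induction hγ using Submodule.span_induction with
    | mem q hq =>
      rcases hq with rfl | rfl | rfl
      · simp [wedge_apply, e0, e1]
      · simp [wedge_apply, e0, e2]
      · rw [hw]; simp [wedge_apply, e0, e1, e2]
    | zero => simp
    | add p q _ _ hp hq => 
      by_cases h : p ![φ.symm (EE 3), t] = 0
      · by_cases h' : q ![φ.symm (EE 3), t] = 0
        · simp [h, h']
        · exact absurd (hq h') h'
      · exact absurd (hp h) h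
    | smul r q _ hq =>
      by_cases h' : q ![φ.symm (EE 3), t] = 0
      · simp [h']
      · exact absurd (hq h') h'
  by_cases hu : u = 0
  · subst hu
    refine goal1 ![f0, f1, f2, f3] hD ?_
    simp only [Matrix.cons_val]
    rw [hH]
    apply span3_eq
    · exact mem3 1 0 0 (by simp)
    · exact mem3 0 1 0 (by simp)
    · exact mem3 x y z (by rw [hw]; simp)
    · exact mem3 1 0 0 (by simp)
    · exact mem3 0 1 0 (by simp)
    · exact mem3 (- (z⁻¹ * x)) (-(z⁻¹ * y)) z⁻¹ (by rw [hw]; match_scalars <;> field_simp <;> ring)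
  · refine goal2 ![f0, f1, u • f2, z • f3] ?_ ?_
    · simp only [DD, Matrix.cons_val]
      have : wedge (u • f2) (z • f3) = (u * z) • wedge f2 f3 := by
        apply co_ext <;> simp <;> ring
      rw [this, map_smul, smul_eq_mul]
      exact mul_ne_zero (mul_ne_zero hu hz) hD
    · simp only [Matrix.cons_val]
      have q1 : wedge f0 (u • f2) = u • wedge f0 f2 := by apply co_ext <;> simp <;> ring
      have q2 : wedge f0 (z • f3) + wedge f1 (u • f2) = z • wedge f0 f3 + u • wedge f1 f2 := by
        apply co_ext <;> simp <;> ring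
      rw [hH, q1, q2]
      apply span3_eq
      · exact mem3 1 0 0 (by simp)
      · exact mem3 0 u⁻¹ 0 (by rw [smul_smul, inv_mul_cancel₀ hu]; simp)
      · exact mem3 x (y * u⁻¹) 1 (by rw [hw]; match_scalars <;> field_simp <;> ring)
      · exact mem3 1 0 0 (by simp)
      · exact mem3 0 u 0 (by simp)
      · exact mem3 (-x) (-y) 1 (by rw [hw]; module)

lemma case1 {H : Submodule ℂ TF_s4} {a b c : TF_s4} (hH : H = Submodule.span ℂ {a, b, c})
    (haa : BB a a = 0) (hbb : BB b b = 0) 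
    (hab : BB a b = 0) (hac : BB a c = 0) (hbc : BB b c = 0) (ha : a ≠ 0) (hb : ∀ t : ℂ, b ≠ t • a)
    (hsupp : ∀ v : Fin 4 → ℂ, v ≠ 0 → ∃ γ ∈ H, ∃ w : Fin 4 → ℂ, γ ![v, w] ≠ 0) : Goal H := by
  have hex : ∃ f2 f3 : LF, BB a (wedge f2 f3) ≠ 0 := by
    by_contra! hcon
    apply ha
    have h01 := hcon (LinearMap.proj 0) (LinearMap.proj 1)
    have h02 := hcon (LinearMap.proj 0) (LinearMap.proj 2)
    have h03 := hcon (LinearMap.proj 0) (LinearMap.proj 3)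
    have h12 := hcon (LinearMap.proj 1) (LinearMap.proj 2)
    have h13 := hcon (LinearMap.proj 1) (LinearMap.proj 3)
    have h23 := hcon (LinearMap.proj 2) (LinearMap.proj 3)
    simp [BB_apply, EE] at h01 h02 h03 h12 h13 h23
    apply co_ext <;> simp [*]
  obtain ⟨f0, f1, rfl⟩ := decomp a haa
  obtain ⟨f2, f3, hD⟩ := hex
  obtain ⟨x, y, z, u, v, w, hw⟩ := expand ![f0, f1, f2, f3] hD b
  simp only [Matrix.cons_val] at hw
  rw [BBself _ _ _ _ _ _ _ _ _ _ _ hw] at hbb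
  have hw0 : w = 0 := by
    rw [hw, BB01] at hab
    exact (mul_eq_zero.1 hab).resolve_right hD
  have h2 := (mul_eq_zero.1 hbb).resolve_right hD
  subst hw0
  obtain ⟨p0, p1, p2, p3, l, m, hl, hm, w1, w2, w3⟩ := rank_one f0 f1 f2 f3 y z u v
    (by linear_combination -h2 / 2) (by
      rintro ⟨rfl, rfl, rfl, rfl⟩; apply hb x; rw [hw]; simp)
  have w3' : wedge p1 p2 = b - x • wedge f0 f1 := by rw [w3, hw]; module
  have w1' : wedge p1 p0 = (-l) • wedge f0 f1 := by
    rw [neg_smul, ← w1]; apply co_ext <;> simp <;> ring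
  refine case1' (f0 := p1) (f1 := p0) (f2 := p2) (f3 := p3) (c := c) ?_ ?_ ?_ ?_ hsupp
  · rw [hH, w1', w3']
    apply span3_eq
    · exact mem3 (-l⁻¹) 0 0 (by match_scalars <;> field_simp <;> ring)
    · exact mem3 (-l⁻¹ * x) 1 0 (by match_scalars <;> field_simp <;> ring)
    · exact mem3 0 0 1 (by simp)
    · exact mem3 (-l) 0 0 (by simp)
    · exact mem3 (-x) 1 0 (by module)
    · exact mem3 0 0 1 (by simp)
  · rw [w1', w2]
    simp only [map_smul, LinearMap.smul_apply, smul_eq_mul]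
    exact mul_ne_zero hm (mul_ne_zero (neg_ne_zero.2 hl) hD)
  · rw [w1', map_smul, LinearMap.smul_apply, hac, smul_zero]
  · rw [w3', map_sub, map_smul, LinearMap.sub_apply, LinearMap.smul_apply, hac, hbc]; simp


lemma exists_sq (z : ℂ) : ∃ s : ℂ, s ^ 2 = z := IsAlgClosed.exists_pow_nat_eq z (by norm_num)

lemma rk3 {H : Submodule ℂ TF_s4} {a b c : TF_s4} (hH : H = Submodule.span ℂ {a, b, c})
    (hab : BB a b = 0) (hac : BB a c = 0) (hbc : BB b c = 0)
    (haa : BB a a ≠ 0) (hbb : BB b b ≠ 0) (hcc : BB c c ≠ 0) : Goal H := by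
  obtain ⟨s, hs⟩ := exists_sq (- BB a a / BB b b)
  obtain ⟨t, ht⟩ := exists_sq (- BB a a / BB c c)
  have hs' : s ^ 2 * BB b b = - BB a a := by rw [hs]; field_simp
  have ht' : t ^ 2 * BB c c = - BB a a := by rw [ht]; field_simp
  have hs0 : s ≠ 0 := by
    rintro rfl; apply haa; linear_combination hs'
  have ht0 : t ≠ 0 := by
    rintro rfl; apply haa; linear_combination ht'
  have hba := (BB_symm b a).trans hab
  have hca := (BB_symm c a).trans hac
  have hcb := (BB_symm c b).trans hbc
  refine case3 (a := a + s • b) (b := a - s • b) (c := a + t • c) ?_ ?_ ?_ ?_ ?_ ?_ ?_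
  · rw [hH]
    apply span3_eq
    · exact mem3 (1/2) (1/2) 0 (by module)
    · exact mem3 (1/2 * s⁻¹) (-1/2 * s⁻¹) 0 (by match_scalars <;> field_simp <;> ring)
    · exact mem3 (-1/2 * t⁻¹) (-1/2 * t⁻¹) t⁻¹ (by match_scalars <;> field_simp <;> ring)
    · exact mem3 1 s 0 (by module)
    · exact mem3 1 (-s) 0 (by module)
    · exact mem3 1 0 t (by module)
  all_goals
    simp only [map_add, map_sub, map_smul, LinearMap.add_apply, LinearMap.sub_apply,
      LinearMap.smul_apply, smul_eq_mul, hab, hac, hbc, hba, hca, hcb]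
  · linear_combination hs'
  · linear_combination hs'
  · linear_combination ht'
  · intro h; apply haa; linear_combination (h + hs') / 2
  · intro h; apply haa; linear_combination h
  · intro h; apply haa; linear_combination h

lemma rk2 {H : Submodule ℂ TF_s4} {a b c : TF_s4} (hH : H = Submodule.span ℂ {a, b, c})
    (hab : BB a b = 0) (hac : BB a c = 0) (hbc : BB b c = 0)
    (haa : BB a a ≠ 0) (hbb : BB b b ≠ 0) (hcc : BB c c = 0) (hc : c ≠ 0) : Goal H := by
  obtain ⟨s, hs⟩ := exists_sq (- BB a a / BB b b)
  have hs' : s ^ 2 * BB b b = - BB a a := by rw [hs]; field_simp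
  have hs0 : s ≠ 0 := by
    rintro rfl; apply haa; linear_combination hs'
  have hba := (BB_symm b a).trans hab
  refine case2 (a := a + s • b) (b := a - s • b) (c := c) ?_ ?_ ?_ hcc ?_ ?_ ?_ hc
  · rw [hH]
    apply span3_eq
    · exact mem3 (1/2) (1/2) 0 (by module)
    · exact mem3 (1/2 * s⁻¹) (-1/2 * s⁻¹) 0 (by match_scalars <;> field_simp <;> ring)
    · exact mem3 0 0 1 (by module)
    · exact mem3 1 s 0 (by module)
    · exact mem3 1 (-s) 0 (by module)
    · exact mem3 0 0 1 (by module)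
  all_goals
    simp only [map_add, map_sub, map_smul, LinearMap.add_apply, LinearMap.sub_apply,
      LinearMap.smul_apply, smul_eq_mul, hab, hac, hbc, hba]
  · linear_combination hs'
  · linear_combination hs'
  · intro h; apply haa; linear_combination (h + hs') / 2
  · simp
  · simp

/-- Normal forms of nets of alternating two-forms in four variables (indices `1,…,4`
rendered as `0,…,3` in `Fin 4`). -/
theorem nets_of_twoForms_normal_forms
    (H : Submodule ℂ (AlternatingMap ℂ (Fin 4 → ℂ) ℂ (Fin 2)))
    (hdim : Module.finrank ℂ H = 3)
    (hsupp : ∀ v : Fin 4 → ℂ, v ≠ 0 → ∃ γ ∈ H, ∃ w : Fin 4 → ℂ, γ ![v, w] ≠ 0) :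
    ∃ g : (Fin 4 → ℂ) ≃ₗ[ℂ] (Fin 4 → ℂ),
      (Submodule.span ℂ
          ((fun γ : AlternatingMap ℂ (Fin 4 → ℂ) ℂ (Fin 2) =>
            γ.compLinearMap (g : (Fin 4 → ℂ) →ₗ[ℂ] (Fin 4 → ℂ))) '' (H : Set _)) =
        Submodule.span ℂ {e2 0 1, e2 0 2, e2 0 3}) ∨
      (Submodule.span ℂ
          ((fun γ : AlternatingMap ℂ (Fin 4 → ℂ) ℂ (Fin 2) =>
            γ.compLinearMap (g : (Fin 4 → ℂ) →ₗ[ℂ] (Fin 4 → ℂ))) '' (H : Set _)) =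
        Submodule.span ℂ {e2 0 1, e2 0 2, e2 0 3 + e2 1 2}) ∨
      (Submodule.span ℂ
          ((fun γ : AlternatingMap ℂ (Fin 4 → ℂ) ℂ (Fin 2) =>
            γ.compLinearMap (g : (Fin 4 → ℂ) →ₗ[ℂ] (Fin 4 → ℂ))) '' (H : Set _)) =
        Submodule.span ℂ {e2 0 1, e2 1 2, e2 2 3}) ∨
      (Submodule.span ℂ
          ((fun γ : AlternatingMap ℂ (Fin 4 → ℂ) ℂ (Fin 2) =>
            γ.compLinearMap (g : (Fin 4 → ℂ) →ₗ[ℂ] (Fin 4 → ℂ))) '' (H : Set _)) =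
        Submodule.span ℂ {e2 0 1, e2 2 3,
          wedge ((LinearMap.proj 0 : (Fin 4 → ℂ) →ₗ[ℂ] ℂ) + LinearMap.proj 2)
            ((LinearMap.proj 1 : (Fin 4 → ℂ) →ₗ[ℂ] ℂ) + LinearMap.proj 3)}) := by
  
  change Goal H
  have hfd : FiniteDimensional ℂ H := Module.finite_of_finrank_pos (by omega)
  obtain ⟨v, hv⟩ := LinearMap.BilinForm.exists_orthogonal_basis
    (B := BB.restrict H) ⟨fun x y => BB_symm x y⟩
  let b := v.reindex (finCongr hdim)
  let h : Fin 3 → TF_s4 := fun i => (b i : TF_s4)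
  have ho : ∀ i j, i ≠ j → BB (h i) (h j) = 0 := by
    intro i j hij
    have := hv (i := (finCongr hdim).symm i) (j := (finCongr hdim).symm j) (by simpa using hij)
    simpa [h, b, LinearMap.IsOrtho] using this
  have hn : ∀ i, h i ≠ 0 := by
    intro i hi
    exact b.ne_zero i (Subtype.ext hi)
  have hp : ∀ i j, i ≠ j → ∀ t : ℂ, h j ≠ t • h i := by
    intro i j hij t ht
    have h1 : b j = t • b i := Subtype.ext ht
    have h2 := congrArg (fun x => b.repr x j) h1
    simp [hij] at h2
  have hspan : H = Submodule.span ℂ (Set.range h) := by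
    have h1 : Set.range h = H.subtype '' Set.range b := by
      rw [← Set.range_comp]; rfl
    rw [h1, ← Submodule.map_span, b.span_eq, Submodule.map_top, Submodule.range_subtype]
  have hs : ∀ i j k : Fin 3, i ≠ j → i ≠ k → j ≠ k → H = Submodule.span ℂ {h i, h j, h k} := by
    intro i j k hij hik hjk
    rw [hspan]
    congr 1
    ext x
    simp only [Set.mem_range, Set.mem_insert_iff, Set.mem_singleton_iff]
    constructor
    · rintro ⟨l, rfl⟩
      have : l = i ∨ l = j ∨ l = k := by omega
      rcases this with rfl | rfl | rfl <;> simp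
    · rintro (rfl | rfl | rfl) <;> exact ⟨_, rfl⟩
  have r2 : ∀ i j k : Fin 3, i ≠ j → i ≠ k → j ≠ k → BB (h i) (h i) ≠ 0 → BB (h j) (h j) ≠ 0 →
      BB (h k) (h k) = 0 → Goal H := fun i j k hij hik hjk h1 h2 h3 =>
    rk2 (hs i j k hij hik hjk) (ho _ _ hij) (ho _ _ hik) (ho _ _ hjk) h1 h2 h3 (hn k)
  have r1 : ∀ i j k : Fin 3, i ≠ j → i ≠ k → j ≠ k → BB (h i) (h i) = 0 → BB (h j) (h j) = 0 →
      Goal H := fun i j k hij hik hjk h1 h2 =>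
    case1 (hs i j k hij hik hjk) h1 h2 (ho _ _ hij) (ho _ _ hik) (ho _ _ hjk) (hn i)
      (hp i j hij) hsupp
  by_cases h0 : BB (h 0) (h 0) = 0 <;> by_cases h1 : BB (h 1) (h 1) = 0 <;>
    by_cases h2 : BB (h 2) (h 2) = 0
  · exact r1 0 1 2 (by decide) (by decide) (by decide) h0 h1
  · exact r1 0 1 2 (by decide) (by decide) (by decide) h0 h1
  · exact r1 0 2 1 (by decide) (by decide) (by decide) h0 h2
  · exact r2 1 2 0 (by decide) (by decide) (by decide) h1 h2 h0
  · exact r1 1 2 0 (by decide) (by decide) (by decide) h1 h2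
  · exact r2 0 2 1 (by decide) (by decide) (by decide) h0 h2 h1
  · exact r2 0 1 2 (by decide) (by decide) (by decide) h0 h1 h2
  · exact rk3 (hs 0 1 2 (by decide) (by decide) (by decide)) (ho _ _ (by decide))
      (ho _ _ (by decide)) (ho _ _ (by decide)) h0 h1 h2
end
end

section
/- Null-planes in the complex octonions: (i) there exists a two-dimensional ℂ-subspace N of the complex octonions 𝕆^ℂ such that x*y = 0 for all x, y ∈ N (a null-plane); (ii) every ℂ-subspace N of 𝕆^ℂ satisfying x*y = 0 for all x, y ∈ N has dimension at most two, and any such subspace of dimension exactly two is a null-plane. -/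
noncomputable section

/-- The Cayley–Dickson product on the complex octonions
`𝕆^ℂ = Quaternion ℂ × Quaternion ℂ`:  `(a,b)·(c,d) = (a c - d* b, b c* + d a)`. -/
def octMul (x y : Quaternion ℂ × Quaternion ℂ) : Quaternion ℂ × Quaternion ℂ :=
  (x.1 * y.1 - star y.2 * x.2, x.2 * star y.1 + y.2 * x.1)

@[simp] lemma oq_zero_re : QuaternionAlgebra.re (0 : Quaternion ℂ) = 0 := rfl
@[simp] lemma oq_zero_imI : QuaternionAlgebra.imI (0 : Quaternion ℂ) = 0 := rfl
@[simp] lemma oq_zero_imJ : QuaternionAlgebra.imJ (0 : Quaternion ℂ) = 0 := rfl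
@[simp] lemma oq_zero_imK : QuaternionAlgebra.imK (0 : Quaternion ℂ) = 0 := rfl
@[simp] lemma oq_one_re : QuaternionAlgebra.re (1 : Quaternion ℂ) = 1 := rfl
@[simp] lemma oq_one_imI : QuaternionAlgebra.imI (1 : Quaternion ℂ) = 0 := rfl
@[simp] lemma oq_one_imJ : QuaternionAlgebra.imJ (1 : Quaternion ℂ) = 0 := rfl
@[simp] lemma oq_one_imK : QuaternionAlgebra.imK (1 : Quaternion ℂ) = 0 := rfl

def octD (x y : Quaternion ℂ × Quaternion ℂ) : ℂ :=
  x.1.re * y.1.re + x.1.imI * y.1.imI + x.1.imJ * y.1.imJ + x.1.imK * y.1.imK +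
  x.2.re * y.2.re + x.2.imI * y.2.imI + x.2.imJ * y.2.imJ + x.2.imK * y.2.imK

lemma oct_ext {x y : Quaternion ℂ × Quaternion ℂ} (h : ∀ w, octD x w = octD y w) : x = y := by
  have h1 := h (⟨1,0,0,0⟩, ⟨0,0,0,0⟩)
  have h2 := h (⟨0,1,0,0⟩, ⟨0,0,0,0⟩)
  have h3 := h (⟨0,0,1,0⟩, ⟨0,0,0,0⟩)
  have h4 := h (⟨0,0,0,1⟩, ⟨0,0,0,0⟩)
  have h5 := h (⟨0,0,0,0⟩, ⟨1,0,0,0⟩)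
  have h6 := h (⟨0,0,0,0⟩, ⟨0,1,0,0⟩)
  have h7 := h (⟨0,0,0,0⟩, ⟨0,0,1,0⟩)
  have h8 := h (⟨0,0,0,0⟩, ⟨0,0,0,1⟩)
  simp [octD] at h1 h2 h3 h4 h5 h6 h7 h8
  ext <;> assumption

lemma octD_comb (a b : ℂ) (x y w : Quaternion ℂ × Quaternion ℂ) :
    octD (a • x + b • y) w = a * octD x w + b * octD y w := by
  simp [octD]; ring

lemma octMul_comb (x y z : Quaternion ℂ × Quaternion ℂ) (a b : ℂ) :
    octMul x (a • y + b • z) = a • octMul x y + b • octMul x z := by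
  ext <;> simp [octMul] <;> ring

lemma octMul_smul' (x y : Quaternion ℂ × Quaternion ℂ) (a : ℂ) :
    octMul x (a • y) = a • octMul x y := by
  ext <;> simp [octMul] <;> ring

lemma oct_mod {M : Type*} [AddCommGroup M] [Module ℂ M] (x y z : M) (a b c d e f p : ℂ)
    (h : a • b • z + (1:ℂ) • (p • (0 : M) + c • d • z) = e • x + f • y) :
    (-e) • x + (-f) • y + (a * b + c * d) • z = 0 := by
  have : (a * b + c * d) • z = e • x + f • y := by rw [← h]; module
  rw [this]; module

lemma octMul_zero' (w : Quaternion ℂ × Quaternion ℂ) : octMul w 0 = 0 := by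
  simp [octMul]

set_option maxHeartbeats 4000000 in
lemma oct_P1 (x w z : Quaternion ℂ × Quaternion ℂ) (hx : x.1.re = 0) :
    octMul x (octMul w z) = (-2 * octD x w) • z + (2 * w.1.re) • octMul x z
      - octMul w (octMul x z) := by
  ext <;> simp [octMul, octD, hx] <;> ring

lemma oct_P2 (x u : Quaternion ℂ × Quaternion ℂ) (hx : x.1.re = 0) :
    octMul x u = (-2 * octD x u) • ((1 : Quaternion ℂ), (0 : Quaternion ℂ))
      + (1:ℂ) • ((2 * u.1.re) • x + (-1 : ℂ) • octMul u x) := by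
  ext <;> simp [octMul, octD, hx] <;> ring

lemma octMul_one' (x : Quaternion ℂ × Quaternion ℂ) :
    octMul x ((1 : Quaternion ℂ), (0 : Quaternion ℂ)) = x := by
  simp [octMul]

lemma oct_A (x y u : Quaternion ℂ × Quaternion ℂ) (hx : x.1.re = 0) (hy : y.1.re = 0)
    (h : octMul x y = 0) :
    octMul x (octMul y u) = (-2 * octD y u) • x + (2 * octD x u) • y := by
  rw [oct_P2 y u hy, octMul_comb, octMul_comb, octMul_one', h, oct_P1 x u y hx, h, octMul_zero']
  module

lemma oct_re (x : Quaternion ℂ × Quaternion ℂ) (h : octMul x x = 0) : x.1.re = 0 := by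
  by_contra h0
  have e := h
  rw [octMul, Prod.ext_iff] at e
  obtain ⟨e1, e2⟩ := e
  simp only [Quaternion.ext_iff] at e1 e2
  simp at e1 e2
  obtain ⟨a1, a2, a3, a4⟩ := e1
  obtain ⟨b1, b2, b3, b4⟩ := e2
  have c1 : x.2.re = 0 := b1.resolve_right h0
  have c2 : x.2.imI = 0 := mul_left_cancel₀ h0 (by linear_combination b2 / 2)
  have c3 : x.2.imJ = 0 := mul_left_cancel₀ h0 (by linear_combination b3 / 2)
  have c4 : x.2.imK = 0 := mul_left_cancel₀ h0 (by linear_combination b4 / 2)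
  simp only [c1, c2, c3, c4] at a1 a2 a3 a4
  have d2 : x.1.imI = 0 := mul_left_cancel₀ h0 (by linear_combination a2 / 2)
  have d3 : x.1.imJ = 0 := mul_left_cancel₀ h0 (by linear_combination a3 / 2)
  have d4 : x.1.imK = 0 := mul_left_cancel₀ h0 (by linear_combination a4 / 2)
  simp only [d2, d3, d4] at a1
  exact h0 (mul_left_cancel₀ h0 (by linear_combination a1))

lemma oct_key (x y z w v : Quaternion ℂ × Quaternion ℂ) (hx : x.1.re = 0) (hy : y.1.re = 0)
    (hxy : octMul x y = 0) (hxz : octMul x z = 0) (hyz : octMul y z = 0) :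
    ∃ a b : ℂ, a • x + b • y + (4 * (octD y v * octD x w - octD y w * octD x v)) • z = 0 := by
  have hX : ∀ w, octMul x (octMul w z) = (-2 * octD x w) • z := fun w => by
    rw [oct_P1 x w z hx, hxz, octMul_zero']; module
  have hY : ∀ w, octMul y (octMul w z) = (-2 * octD y w) • z := fun w => by
    rw [oct_P1 y w z hy, hyz, octMul_zero']; module
  have e1 : octMul y (octMul v (octMul w z)) = (-2 * octD y v) • octMul w z
      + (1:ℂ) • ((2 * v.1.re * (-2 * octD y w)) • z + (2 * octD y w) • octMul v z) := by
    rw [oct_P1 y v _ hy, hY]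
    rw [octMul_smul']; module
  have e2 := oct_A x y (octMul v (octMul w z)) hx hy hxy
  rw [e1, octMul_comb, octMul_comb, hX, hX, hxz] at e2
  refine ⟨-(-2 * octD y (octMul v (octMul w z))), -(2 * octD x (octMul v (octMul w z))), ?_⟩
  have e3 := oct_mod _ _ _ _ _ _ _ _ _ _ e2
  have e4 : 4 * (octD y v * octD x w - octD y w * octD x v) =
      -2 * octD y v * (-2 * octD x w) + 2 * octD y w * (-2 * octD x v) := by ring
  rw [e4]
  exact e3

lemma oct_li {M : Type*} [AddCommGroup M] [Module ℂ M] (N : Submodule ℂ M)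
    (h : 3 ≤ Module.finrank ℂ N) :
    ∃ f : Fin 3 → M, LinearIndependent ℂ f ∧ ∀ i, f i ∈ N := by
  obtain ⟨f, hf⟩ := exists_linearIndependent_of_le_finrank h
  exact ⟨fun i => f i, hf.map' N.subtype (Submodule.ker_subtype N), fun i => (f i).2⟩

/-- Null-planes in the complex octonions: (i) there exists a two-dimensional subspace on
which all products vanish; (ii) every subspace on which all products vanish has dimension
at most two (so the two-dimensional ones are exactly the maximal ones, the null-planes). -/
theorem null_planes_complex_octonions :
    (∃ N : Submodule ℂ (Quaternion ℂ × Quaternion ℂ),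
      Module.finrank ℂ N = 2 ∧ ∀ x ∈ N, ∀ y ∈ N, octMul x y = 0) ∧
    (∀ N : Submodule ℂ (Quaternion ℂ × Quaternion ℂ),
      (∀ x ∈ N, ∀ y ∈ N, octMul x y = 0) → Module.finrank ℂ N ≤ 2) := by
  constructor
  · obtain ⟨a, a1, a2, a3, a4⟩ : ∃ a : Quaternion ℂ, a.re = 0 ∧ a.imI = 1 ∧ a.imJ = Complex.I ∧
        a.imK = 0 := ⟨⟨0, 1, Complex.I, 0⟩, rfl, rfl, rfl, rfl⟩
    refine ⟨Submodule.span ℂ (Set.range ![(a, (0 : Quaternion ℂ)), ((0 : Quaternion ℂ), a)]), ?_, ?_⟩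
    · rw [finrank_span_eq_card]
      · simp
      · rw [LinearIndependent.pair_iff]
        intro s t h
        rw [Prod.ext_iff, Quaternion.ext_iff, Quaternion.ext_iff] at h
        obtain ⟨⟨_, h1, _⟩, ⟨_, h2, _⟩⟩ := h
        simp [a2] at h1 h2
        exact ⟨h1, h2⟩
    · intro x hx y hy
      simp only [Matrix.range_cons, Matrix.range_empty, Set.union_empty, Set.singleton_union,
        Submodule.mem_span_pair] at hx hy
      obtain ⟨p, q, rfl⟩ := hx
      obtain ⟨r, s, rfl⟩ := hy
      ext <;> simp [octMul, a1, a2, a3, a4] <;> ring_nf <;> simp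
  · intro N hN
    by_contra hc
    obtain ⟨f, hf', hmem⟩ := oct_li N (by omega)
    rw [Fintype.linearIndependent_iff] at hf'
    set x : Quaternion ℂ × Quaternion ℂ := f 0 with hxd
    set y : Quaternion ℂ × Quaternion ℂ := f 1 with hyd
    set z : Quaternion ℂ × Quaternion ℂ := f 2 with hzd
    have ind : ∀ a b c : ℂ, a • x + b • y + c • z = 0 → a = 0 ∧ b = 0 ∧ c = 0 := by
      intro a b c h
      have := hf' ![a, b, c] (by simpa [Fin.sum_univ_three] using h)
      exact ⟨this 0, this 1, this 2⟩
    have m : ∀ i j : Fin 3, octMul (f i) (f j) = 0 := fun i j => hN _ (hmem i) _ (hmem j)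
    have minor : ∀ w v, octD y v * octD x w - octD y w * octD x v = 0 := by
      intro w v
      obtain ⟨a, b, h⟩ := oct_key x y z w v (oct_re _ (m 0 0)) (oct_re _ (m 1 1)) (m 0 1)
        (m 0 2) (m 1 2)
      simpa using (ind _ _ _ h).2.2
    have hy0 : y = 0 := by
      apply oct_ext
      intro v
      have h : octD y v • x + (-octD x v) • y = 0 := by
        apply oct_ext
        intro w
        rw [octD_comb]
        have := minor w v
        have h0 : octD 0 w = 0 := by simp [octD]
        rw [h0]; linear_combination this
      have h0 : octD 0 v = 0 := by simp [octD]
      rw [h0]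
      exact (ind _ _ 0 (by rw [h]; module)).1
    have := (ind 0 1 0 (by rw [hy0]; module)).2.1
    exact one_ne_zero this
end
end
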